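/- (de Simon's theorem, Hilbert space case.) Suppose X_0 is a complex Hilbert space and suppose there exists M>0 such that for every λ ∈ ℂ with Re λ ≥ 0 the operator λ+A : X_1 → X_0 is bijective with ‖(λ+A)^{−1}‖_{B(X_0)} ≤ M/(1+|λ|) (i.e., −A generates an exponentially stable analytic semigroup in X_0). Then A ∈ MR_p(X_0) for every p ∈ (1,∞). -/

import Mathlib

open MeasureTheory Set

noncomputable section

/-- Membership in the weighted space `L_{p,μ}(s;X)`: `f` is (a.e.) strongly measurable on `s`
and `t ↦ t^(1-μ) f t` is `p`-integrable on `s`. -/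
def MemWLp {X : Type*} [NormedAddCommGroup X] (p μ : ℝ) (s : Set ℝ) (f : ℝ → X) : Prop :=
  AEStronglyMeasurable f (volume.restrict s) ∧
    IntegrableOn (fun t : ℝ => (t ^ (1 - μ) * ‖f t‖) ^ p) s

/-- The norm of the weighted space `L_{p,μ}(s;X)`. -/
def wLpNorm {X : Type*} [NormedAddCommGroup X] (p μ : ℝ) (s : Set ℝ) (f : ℝ → X) : ℝ :=
  (∫ t in s, (t ^ (1 - μ) * ‖f t‖) ^ p) ^ (1 / p)

/-- `g` is the weak (distributional) derivative of `u` on the open set `s ⊆ ℝ`;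
in particular `u, g ∈ L_{1,loc}(s;X)`. -/
def IsWeakDeriv {X : Type*} [NormedAddCommGroup X] [NormedSpace ℂ X]
    (s : Set ℝ) (u g : ℝ → X) : Prop :=
  LocallyIntegrableOn u s ∧ LocallyIntegrableOn g s ∧
    ∀ φ : ℝ → ℝ, ContDiff ℝ (⊤ : ℕ∞) φ → HasCompactSupport φ → tsupport φ ⊆ s →
      (∫ t in s, deriv φ t • u t) = -∫ t in s, φ t • g t

/-- `v : s → X` has trace `x` at `t = 0`: it has a representative `w` which is continuous
on `{0} ∪ s` with `w 0 = x`. -/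
def HasTrace {X : Type*} [NormedAddCommGroup X] (s : Set ℝ) (v : ℝ → X) (x : X) : Prop :=
  ∃ w : ℝ → X, ContinuousOn w (insert 0 s) ∧
    (∀ᵐ t ∂(volume.restrict s), w t = v t) ∧ w 0 = x

variable {X₀ X₁ : Type*} [NormedAddCommGroup X₀] [NormedSpace ℂ X₀] [CompleteSpace X₀]
  [NormedAddCommGroup X₁] [NormedSpace ℂ X₁] [CompleteSpace X₁]

/-- The graph norm of `A` (with respect to the embedding `ι : X₁ → X₀`) is equivalent to
the norm of `X₁`. -/
def GraphNormEquiv (ι A : X₁ →L[ℂ] X₀) : Prop :=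
  ∃ c₁ > (0 : ℝ), ∃ c₂ > (0 : ℝ), ∀ x : X₁,
    c₁ * ‖x‖ ≤ ‖ι x‖ + ‖A x‖ ∧ ‖ι x‖ + ‖A x‖ ≤ c₂ * ‖x‖

/-- Membership (of the pair `(u, u')`, `u'` being the weak derivative of `u`) in the maximal
regularity class `E_{1,μ}(s) = W^1_{p,μ}(s;X₀) ∩ L_{p,μ}(s;X₁)`, where `ι : X₁ → X₀` is the
embedding. -/
def MemE (p μ : ℝ) (s : Set ℝ) (ι : X₁ →L[ℂ] X₀) (u : ℝ → X₁) (u' : ℝ → X₀) : Prop :=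
  MemWLp p μ s u ∧ MemWLp p μ s (fun t => ι (u t)) ∧ MemWLp p μ s u' ∧
    IsWeakDeriv s (fun t => ι (u t)) u'

/-- The norm of the maximal regularity class `E_{1,μ}(s)`. -/
def eNorm (p μ : ℝ) (s : Set ℝ) (u : ℝ → X₁) (u' : ℝ → X₀) : ℝ :=
  (wLpNorm p μ s u ^ p + wLpNorm p μ s u' ^ p) ^ (1 / p)

/-- `(u, u')` (with `u'` the weak derivative of `u`) solves the linear problem
`u̇ + A u = f` a.e. on `s`, `u(0) = x`, in the class `E_{1,μ}(s)`. -/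
def IsLinSol (p μ : ℝ) (s : Set ℝ) (ι A : X₁ →L[ℂ] X₀) (f : ℝ → X₀) (x : X₀)
    (u : ℝ → X₁) (u' : ℝ → X₀) : Prop :=
  MemE p μ s ι u u' ∧
    (∀ᵐ t ∂(volume.restrict s), u' t + A (u t) = f t) ∧
    HasTrace s (fun t => ι (u t)) x

/-- `A` has maximal `L_{p,μ}`-regularity, `A ∈ MR_{p,μ}(X₀)`: for every
`f ∈ L_{p,μ}(ℝ₊;X₀)` there is a solution `u ∈ W^1_{p,μ}(ℝ₊;X₀) ∩ L_{p,μ}(ℝ₊;X₁)` of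
`u̇ + A u = f`, `u(0) = 0`, and it is unique (up to a.e. equality). -/
def MRw (p μ : ℝ) (ι A : X₁ →L[ℂ] X₀) : Prop :=
  ∀ f : ℝ → X₀, MemWLp p μ (Set.Ioi 0) f →
    (∃ u u', IsLinSol p μ (Set.Ioi 0) ι A f 0 u u') ∧
    ∀ u₁ u₁' u₂ u₂', IsLinSol p μ (Set.Ioi 0) ι A f 0 u₁ u₁' →
      IsLinSol p μ (Set.Ioi 0) ι A f 0 u₂ u₂' →
      ∀ᵐ t ∂(volume.restrict (Set.Ioi 0)), u₁ t = u₂ t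

/-- `x` belongs to the trace space `X_{γ,μ} = {u(0) : u ∈ E_{1,μ}}`. -/
def InTrace (p μ : ℝ) (ι : X₁ →L[ℂ] X₀) (x : X₀) : Prop :=
  ∃ u u', MemE p μ (Set.Ioi 0) ι u u' ∧ HasTrace (Set.Ioi 0) (fun t => ι (u t)) x

/-- The trace norm `‖x‖_{X_{γ,μ}} = inf {‖u‖_{E_{1,μ}} : u ∈ E_{1,μ}, u(0) = x}`. -/
def traceNorm (p μ : ℝ) (ι : X₁ →L[ℂ] X₀) (x : X₀) : ℝ :=
  sInf {r : ℝ | ∃ u u', MemE p μ (Set.Ioi 0) ι u u' ∧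
    HasTrace (Set.Ioi 0) (fun t => ι (u t)) x ∧ r = eNorm p μ (Set.Ioi 0) u u'}

namespace DS
open FourierTransform SchwartzMap
open scoped ENNReal

variable {H : Type*} [NormedAddCommGroup H] [InnerProductSpace ℂ H] [CompleteSpace H]

/-- A real smooth compactly supported function as a complex Schwartz function. -/
def toS (φ : ℝ → ℝ) (h1 : ContDiff ℝ (⊤ : ℕ∞) φ) (h2 : HasCompactSupport φ) : 𝓢(ℝ, ℂ) :=
  HasCompactSupport.toSchwartzMap (f := fun x => (φ x : ℂ))
    (h2.comp_left (g := fun x : ℝ => (x : ℂ)) (by simp)) (Complex.ofRealCLM.contDiff.comp h1)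

lemma toS_apply (φ : ℝ → ℝ) (h1 : ContDiff ℝ (⊤ : ℕ∞) φ) (h2 : HasCompactSupport φ) (x : ℝ) :
    toS φ h1 h2 x = (φ x : ℂ) := rfl

lemma integral_fourier_smul_flip {f : ℝ → H} (hf : Integrable f) (φ : 𝓢(ℝ, ℂ)) :
    ∫ x, (𝓕 φ) x • f x = ∫ x, φ x • 𝓕 f x := by
  have := VectorFourier.integral_fourierIntegral_smul_eq_flip (e := Real.fourierChar)
    (μ := volume) (ν := volume) (L := innerₗ ℝ) Real.continuous_fourierChar continuous_inner
    φ.integrable hf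
  rw [flip_innerₗ] at this
  exact this

lemma fourier_toLp_ae {f : ℝ → H} (hf : Integrable f) (hf2 : MemLp f 2) :
    (𝓕 (hf2.toLp f) : Lp (α := ℝ) H 2) =ᵐ[volume] 𝓕 f := by
  refine ae_eq_of_integral_contDiff_smul_eq ?_ ?_ ?_
  · exact (Lp.memLp _).locallyIntegrable (by norm_num)
  · exact (VectorFourier.fourierIntegral_continuous Real.continuous_fourierChar
      (L := innerₗ ℝ) continuous_inner hf).locallyIntegrable
  · intro g h1 h2
    have h := DFunLike.congr_fun (Lp.fourier_toTemperedDistribution_eq (hf2.toLp f)) (toS g h1 h2)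
    rw [TemperedDistribution.fourier_apply, Lp.toTemperedDistribution_apply,
      Lp.toTemperedDistribution_apply] at h
    have e1 : ∫ x, (𝓕 (toS g h1 h2)) x • (hf2.toLp f) x = ∫ x, (𝓕 (toS g h1 h2)) x • f x := by
      refine integral_congr_ae ?_
      filter_upwards [hf2.coeFn_toLp] with x hx
      rw [hx]
    rw [e1, integral_fourier_smul_flip hf] at h
    simpa [toS_apply] using h.symm

lemma memLp_of_fourier {g : ℝ → H} (hg : Integrable g) (hF : MemLp (𝓕 g) 2 volume) :
    MemLp g 2 volume ∧ eLpNorm g 2 volume = eLpNorm (𝓕 g) 2 volume := by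
  set G : Lp (α := ℝ) H 2 volume := 𝓕⁻ (hF.toLp (𝓕 g)) with hG
  have key : (G : ℝ → H) =ᵐ[volume] g := by
    refine ae_eq_of_integral_contDiff_smul_eq ?_ hg.locallyIntegrable ?_
    · exact (Lp.memLp _).locallyIntegrable (by norm_num)
    · intro φ h1 h2
      have h := DFunLike.congr_fun (Lp.fourierInv_toTemperedDistribution_eq (hF.toLp (𝓕 g)))
        (toS φ h1 h2)
      rw [TemperedDistribution.fourierInv_apply, Lp.toTemperedDistribution_apply,
        Lp.toTemperedDistribution_apply] at h
      have e1 : ∫ x, (𝓕⁻ (toS φ h1 h2)) x • (hF.toLp (𝓕 g)) x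
          = ∫ x, (𝓕⁻ (toS φ h1 h2)) x • 𝓕 g x := by
        refine integral_congr_ae ?_
        filter_upwards [hF.coeFn_toLp] with x hx
        rw [hx]
      rw [e1, ← integral_fourier_smul_flip hg, fourier_fourierInv_eq] at h
      simpa [toS_apply] using h.symm
  refine ⟨(memLp_congr_ae key).1 (Lp.memLp _), ?_⟩
  have h1 : ‖G‖ = ‖hF.toLp (𝓕 g)‖ := by
    rw [← Lp.norm_fourier_eq G, hG, fourier_fourierInv_eq]
  rw [← eLpNorm_congr_ae key, ← eLpNorm_congr_ae hF.coeFn_toLp]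
  rw [Lp.norm_def, Lp.norm_def] at h1
  exact (ENNReal.toReal_eq_toReal_iff' (Lp.eLpNorm_ne_top _) (Lp.eLpNorm_ne_top _)).1 h1

/-- the convolution operator -/
def cv (K : ℝ → H →L[ℂ] H) (f : ℝ → H) : ℝ → H := fun t => ∫ s, K (t - s) (f s)

lemma cv_eq (K : ℝ → H →L[ℂ] H) (f : ℝ → H) :
    cv K f = convolution K f (ContinuousLinearMap.id ℂ (H →L[ℂ] H)) volume := by
  ext t
  rw [convolution_eq_swap]
  rfl

lemma cv_integrable {K : ℝ → H →L[ℂ] H} (hK : Integrable K) {f : ℝ → H} (hf : Integrable f) :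
    Integrable (cv K f) := by
  rw [cv_eq]
  exact hK.integrable_convolution _ hf

lemma cv_L2 {K : ℝ → H →L[ℂ] H} (hK : Integrable K) {C : ℝ} (hC : ∀ ξ, ‖𝓕 K ξ‖ ≤ C)
    {f : ℝ → H} (hf : Integrable f) (hf2 : MemLp f 2) :
    MemLp (cv K f) 2 ∧
    eLpNorm (cv K f) 2 volume ≤ ENNReal.ofReal C * eLpNorm f 2 volume := by
  have hconv : 𝓕 (cv K f) = fun ξ => (𝓕 K ξ) (𝓕 f ξ) := by
    ext ξ
    rw [cv_eq, Real.fourier_bilin_convolution_eq _ hK hf]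
    rfl
  have hcf : Continuous (𝓕 f) := VectorFourier.fourierIntegral_continuous
    Real.continuous_fourierChar (L := innerₗ ℝ) continuous_inner hf
  have hcK : Continuous (𝓕 K) := VectorFourier.fourierIntegral_continuous
    Real.continuous_fourierChar (L := innerₗ ℝ) continuous_inner hK
  have hFf : MemLp (𝓕 f) 2 := (memLp_congr_ae (fourier_toLp_ae hf hf2)).1 (Lp.memLp _)
  have hbd : ∀ ξ, ‖(𝓕 K ξ) (𝓕 f ξ)‖ ≤ C * ‖𝓕 f ξ‖ := fun ξ =>
    ((𝓕 K ξ).le_opNorm _).trans (by gcongr; exact hC ξ)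
  have hF : MemLp (𝓕 (cv K f)) 2 := by
    rw [hconv]
    exact MemLp.of_le_mul hFf (hcK.clm_apply hcf).aestronglyMeasurable (ae_of_all _ hbd)
  obtain ⟨h1, h2⟩ := memLp_of_fourier (cv_integrable hK hf) hF
  refine ⟨h1, ?_⟩
  have hC0 : 0 ≤ C := (norm_nonneg _).trans (hC 0)
  obtain ⟨_, h3⟩ := memLp_of_fourier hf hFf
  rw [h2, h3, hconv]
  have := eLpNorm_le_mul_eLpNorm_of_ae_le_mul (ae_of_all volume hbd) 2
  exact this

end DS

namespace DS
set_option linter.unusedSectionVars false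
open scoped ENNReal

variable {H : Type*} [NormedAddCommGroup H] [InnerProductSpace ℂ H] [CompleteSpace H]

/-- dyadic interval -/
def dy (n k : ℤ) : Set ℝ := Ico ((k : ℝ) * (2:ℝ)^(-n)) (((k : ℝ) + 1) * (2:ℝ)^(-n))

lemma mem_dy {n k : ℤ} {x : ℝ} : x ∈ dy n k ↔ ⌊(2:ℝ)^n * x⌋ = k := by
  have h2 : (0:ℝ) < (2:ℝ)^n := by positivity
  rw [Int.floor_eq_iff, dy, mem_Ico, zpow_neg]
  constructor
  · rintro ⟨h1, h3⟩
    rw [← div_eq_mul_inv, div_le_iff₀ h2] at h1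
    rw [← div_eq_mul_inv, lt_div_iff₀ h2] at h3
    constructor <;> linarith
  · rintro ⟨h1, h3⟩
    rw [← div_eq_mul_inv, div_le_iff₀ h2, ← div_eq_mul_inv, lt_div_iff₀ h2]
    constructor <;> linarith

lemma floor_coarse {n m : ℤ} (h : m ≤ n) {x y : ℝ}
    (hxy : ⌊(2:ℝ)^n * x⌋ = ⌊(2:ℝ)^n * y⌋) : ⌊(2:ℝ)^m * x⌋ = ⌊(2:ℝ)^m * y⌋ := by
  obtain ⟨d, rfl⟩ : ∃ d : ℕ, n = m + d := ⟨(n - m).toNat, by omega⟩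
  have key : ∀ z : ℝ, (2:ℝ)^m * z = ((2:ℝ)^(m + d : ℤ) * z) / ((2 ^ d : ℕ) : ℝ) := by
    intro z
    rw [zpow_add₀ (by norm_num)]
    push_cast
    field_simp
    simp
  rw [key x, key y, Int.floor_div_natCast, Int.floor_div_natCast, hxy]

lemma dy_volume (n k : ℤ) : volume (dy n k) = ENNReal.ofReal ((2:ℝ)^(-n)) := by
  rw [dy, Real.volume_Ico]
  congr 1; ring

/-- selected intervals -/
def czsel (f : ℝ → H) (l : ℝ) : Set (ℤ × ℤ) :=
  {j | l * (2:ℝ)^(-j.1) < ∫ x in dy j.1 j.2, ‖f x‖ ∧ ∀ m < j.1, ∀ x ∈ dy j.1 j.2,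
    ∫ y in dy m ⌊(2:ℝ)^m * x⌋, ‖f y‖ ≤ l * (2:ℝ)^(-m)}

lemma cz_cover {f : ℝ → H} (hf : Integrable f) {l : ℝ} (hl : 0 < l) {x : ℝ}
    (hx : ∀ j ∈ czsel f l, x ∉ dy j.1 j.2) (n : ℤ) :
    ∫ y in dy n ⌊(2:ℝ)^n * x⌋, ‖f y‖ ≤ l * (2:ℝ)^(-n) := by
  by_contra! hcon
  let P : ℤ → Prop := fun n => l * (2:ℝ)^(-n) < ∫ y in dy n ⌊(2:ℝ)^n * x⌋, ‖f y‖
  have hbdd : ∃ b : ℤ, ∀ z, P z → b ≤ z := by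
    obtain ⟨N, hN⟩ := pow_unbounded_of_one_lt ((∫ y, ‖f y‖) / l) (by norm_num : (1:ℝ) < 2)
    refine ⟨-N, fun z hz => ?_⟩
    by_contra! hlt
    have h1 : ∫ y in dy z ⌊(2:ℝ)^z * x⌋, ‖f y‖ ≤ ∫ y, ‖f y‖ :=
      setIntegral_le_integral hf.norm (ae_of_all _ fun _ => norm_nonneg _)
    have h2 : (2:ℝ)^N ≤ (2:ℝ)^(-z) := by
      rw [← zpow_natCast]
      exact zpow_le_zpow_right₀ (by norm_num) (by omega)
    rw [div_lt_iff₀ hl] at hN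
    have h3 : l * (2:ℝ)^N ≤ l * (2:ℝ)^(-z) := by gcongr
    simp only [P] at hz
    linarith
  obtain ⟨m, hm, hmin⟩ := Int.exists_least_of_bdd hbdd ⟨n, hcon⟩
  refine hx (m, ⌊(2:ℝ)^m * x⌋) ⟨hm, ?_⟩ (mem_dy.2 rfl)
  intro m' hm' y hy
  have e : ⌊(2:ℝ)^m' * y⌋ = ⌊(2:ℝ)^m' * x⌋ := floor_coarse hm'.le (mem_dy.1 hy)
  rw [e]
  by_contra! h
  exact absurd (hmin m' h) (by simpa using hm')

lemma cz_disj {f : ℝ → H} {l : ℝ} {i j : ℤ × ℤ} (hi : i ∈ czsel f l) (hj : j ∈ czsel f l)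
    {x : ℝ} (hxi : x ∈ dy i.1 i.2) (hxj : x ∈ dy j.1 j.2) : i = j := by
  have aux : ∀ {i j : ℤ × ℤ}, i ∈ czsel f l → j ∈ czsel f l → x ∈ dy i.1 i.2 → x ∈ dy j.1 j.2 →
      ¬ i.1 < j.1 := by
    intro i j hi hj hxi hxj hlt
    have := hj.2 i.1 hlt x hxj
    rw [mem_dy.1 hxi] at this
    exact absurd hi.1 (not_lt.2 this)
  have e : i.1 = j.1 := le_antisymm (not_lt.1 (aux hj hi hxj hxi)) (not_lt.1 (aux hi hj hxi hxj))
  refine Prod.ext e ?_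
  rw [← mem_dy.1 hxi, ← mem_dy.1 hxj, e]

lemma cz_upper {f : ℝ → H} (hf : Integrable f) {l : ℝ} {j : ℤ × ℤ} (hj : j ∈ czsel f l) :
    ∫ x in dy j.1 j.2, ‖f x‖ ≤ 2 * l * (2:ℝ)^(-j.1) := by
  have hx : (j.2 : ℝ) * (2:ℝ)^(-j.1) ∈ dy j.1 j.2 := by
    rw [dy, left_mem_Ico]
    have : (0:ℝ) < (2:ℝ)^(-j.1) := by positivity
    nlinarith
  have h := hj.2 (j.1 - 1) (by omega) _ hx
  have hsub : dy j.1 j.2 ⊆ dy (j.1 - 1) ⌊(2:ℝ)^(j.1 - 1) * ((j.2 : ℝ) * (2:ℝ)^(-j.1))⌋ := by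
    intro y hy
    rw [mem_dy]
    exact floor_coarse (by omega) ((mem_dy.1 hy).trans (mem_dy.1 hx).symm)
  calc _ ≤ _ := setIntegral_mono_set hf.norm.integrableOn (ae_of_all _ fun _ => norm_nonneg _)
        hsub.eventuallyLE
    _ ≤ _ := h
    _ = _ := by
      rw [neg_sub, sub_eq_add_neg, zpow_add₀ (by norm_num)]; simp; ring

lemma cz_good {f : ℝ → H} (hf : Integrable f) {l : ℝ} (hl : 0 < l) :
    ∀ᵐ x : ℝ, (∀ j ∈ czsel f l, x ∉ dy j.1 j.2) → ‖f x‖ ≤ l := by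
  filter_upwards [IsUnifLocDoublingMeasure.ae_tendsto_average (μ := (volume : Measure ℝ))
    hf.norm.locallyIntegrable 1] with x hx hout
  have h2 : ∀ n : ℕ, (0:ℝ) < (2:ℝ)^(-(n:ℤ)) := fun n => by positivity
  have := hx (l := Filter.atTop) (fun n : ℕ => ((⌊(2:ℝ)^(n:ℤ) * x⌋ : ℝ) + 1/2) * (2:ℝ)^(-(n:ℤ)))
    (fun n : ℕ => (2:ℝ)^(-(n:ℤ)) / 2) ?_ ?_
  · refine le_of_tendsto this (Filter.Eventually.of_forall fun n => ?_)
    have e : Metric.closedBall (((⌊(2:ℝ)^(n:ℤ) * x⌋ : ℝ) + 1/2) * (2:ℝ)^(-(n:ℤ)))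
        ((2:ℝ)^(-(n:ℤ)) / 2) =ᵐ[volume] dy n ⌊(2:ℝ)^(n:ℤ) * x⌋ := by
      rw [Real.closedBall_eq_Icc, dy]
      have e1 : ((⌊(2:ℝ)^(n:ℤ) * x⌋ : ℝ) + 1/2) * (2:ℝ)^(-(n:ℤ)) - (2:ℝ)^(-(n:ℤ)) / 2
        = (⌊(2:ℝ)^(n:ℤ) * x⌋ : ℝ) * (2:ℝ)^(-(n:ℤ)) := by ring
      have e2 : ((⌊(2:ℝ)^(n:ℤ) * x⌋ : ℝ) + 1/2) * (2:ℝ)^(-(n:ℤ)) + (2:ℝ)^(-(n:ℤ)) / 2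
        = ((⌊(2:ℝ)^(n:ℤ) * x⌋ : ℝ) + 1) * (2:ℝ)^(-(n:ℤ)) := by ring
      rw [e1, e2]
      exact Ico_ae_eq_Icc.symm
    rw [setAverage_congr e, setAverage_eq, measureReal_def, dy_volume,
      ENNReal.toReal_ofReal (h2 n).le, smul_eq_mul, inv_mul_le_iff₀ (h2 n)]
    exact (cz_cover hf hl hout n).trans_eq (mul_comm _ _)
  · rw [tendsto_nhdsWithin_iff]
    refine ⟨?_, Filter.Eventually.of_forall fun n => by have := h2 n; simp only [mem_Ioi]; positivity⟩
    have : Filter.Tendsto (fun n : ℕ => ((1/2:ℝ))^n / 2) Filter.atTop (nhds (0/2)) :=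
      (tendsto_pow_atTop_nhds_zero_of_lt_one (by norm_num) (by norm_num)).div_const _
    simpa using this
  · refine Filter.Eventually.of_forall fun n => ?_
    have hm : x ∈ dy n ⌊(2:ℝ)^(n:ℤ) * x⌋ := mem_dy.2 rfl
    rw [dy] at hm
    rw [Real.closedBall_eq_Icc]
    constructor <;> linarith [hm.1, hm.2]

end DS

namespace DS
set_option linter.unusedSectionVars false
open scoped ENNReal

variable {H : Type*} [NormedAddCommGroup H] [InnerProductSpace ℂ H] [CompleteSpace H]

open Classical in
/-- index of the selected interval containing `x` -/
def czidx (f : ℝ → H) (l : ℝ) (x : ℝ) : ℤ × ℤ :=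
  if h : ∃ j ∈ czsel f l, x ∈ dy j.1 j.2 then h.choose else (0, 0)

lemma czidx_eq {f : ℝ → H} {l x : ℝ} {j : ℤ × ℤ} (hj : j ∈ czsel f l) (hx : x ∈ dy j.1 j.2) :
    czidx f l x = j := by
  have h : ∃ j ∈ czsel f l, x ∈ dy j.1 j.2 := ⟨j, hj, hx⟩
  rw [czidx, dif_pos h]
  exact cz_disj h.choose_spec.1 hj h.choose_spec.2 hx

lemma dy_meas (n k : ℤ) : MeasurableSet (dy n k) := measurableSet_Ico

lemma czidx_measurable (f : ℝ → H) (l : ℝ) : Measurable (czidx f l) := by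
  refine measurable_to_countable' fun j => ?_
  have hO : MeasurableSet (⋃ j ∈ czsel f l, dy j.1 j.2) :=
    MeasurableSet.biUnion (to_countable _) fun j _ => dy_meas _ _
  have : czidx f l ⁻¹' {j} = {x | j ∈ czsel f l ∧ x ∈ dy j.1 j.2} ∪
      {x | j = (0,0) ∧ x ∈ (⋃ j ∈ czsel f l, dy j.1 j.2)ᶜ} := by
    ext x
    simp only [mem_preimage, mem_singleton_iff, mem_union, mem_ofPred_eq, mem_compl_iff, mem_iUnion,
      not_exists]
    constructor
    · intro h
      by_cases hx : ∃ j ∈ czsel f l, x ∈ dy j.1 j.2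
      · obtain ⟨i, hi, hxi⟩ := hx
        rw [czidx_eq hi hxi] at h
        subst h
        exact Or.inl ⟨hi, hxi⟩
      · rw [czidx, dif_neg hx] at h
        push Not at hx
        exact Or.inr ⟨h.symm, hx⟩
    · rintro (⟨h1, h2⟩ | ⟨h1, h2⟩)
      · exact czidx_eq h1 h2
      · rw [czidx, dif_neg (by push Not; exact h2), h1]
  rw [this]
  refine MeasurableSet.union ?_ ?_
  · by_cases h : j ∈ czsel f l
    · simpa [h] using dy_meas _ _
    · simp [h]
  · by_cases h : j = (0,0)
    · simp only [h, true_and]; exact hO.compl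
    · simp [h]

lemma cz_decomp {f : ℝ → H} (hf : Integrable f) {l : ℝ} (hl : 0 < l) :
    ∃ (Ω S : Set ℝ) (c r : ℝ → ℝ) (g : ℝ → H), MeasurableSet Ω ∧ MeasurableSet S ∧ Measurable c ∧
      Integrable g ∧ (∀ᵐ x, ‖g x‖ ≤ 2 * l) ∧ (∫ x, ‖g x‖ ≤ 3 * ∫ x, ‖f x‖) ∧
      (∀ x ∉ Ω, g x = f x) ∧ volume S ≤ ENNReal.ofReal (2 * (∫ x, ‖f x‖) / l) ∧
      (∀ s ∈ Ω, 0 < r s ∧ |s - c s| ≤ r s ∧ ∀ t ∉ S, 2 * r s ≤ |t - c s|) ∧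
      (∀ Φ : ℝ → H →L[ℂ] H, ∫ s in Ω, Φ (c s) (f s - g s) = 0) := by
  classical
  set N := ∫ x, ‖f x‖ with hN
  let J := czsel f l
  let Q : J → Set ℝ := fun j => dy j.1.1 j.1.2
  let Ω : Set ℝ := ⋃ j : J, Q j
  let c0 : ℤ × ℤ → ℝ := fun j => ((j.2 : ℝ) + 1/2) * (2:ℝ)^(-j.1)
  let r0 : ℤ × ℤ → ℝ := fun j => (2:ℝ)^(-j.1) / 2
  let S : Set ℝ := ⋃ j : J, Metric.ball (c0 j.1) (2 * r0 j.1)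
  let av : ℤ × ℤ → H := fun j => ((2:ℝ)^(-j.1))⁻¹ • ∫ y in dy j.1 j.2, f y
  let ix := czidx f l
  let g : ℝ → H := Ω.piecewise (fun x => av (ix x)) f
  have hQm : ∀ j : J, MeasurableSet (Q j) := fun j => dy_meas _ _
  have hΩm : MeasurableSet Ω := MeasurableSet.iUnion hQm
  have hSm : MeasurableSet S := MeasurableSet.iUnion fun j => measurableSet_ball
  have hixm : Measurable ix := czidx_measurable f l
  have hdisj : Pairwise (Function.onFun Disjoint Q) := by
    intro i j hij
    rw [Function.onFun, Set.disjoint_left]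
    intro x hxi hxj
    exact hij (Subtype.ext (cz_disj i.2 j.2 hxi hxj))
  have hpos : ∀ j : ℤ × ℤ, (0:ℝ) < (2:ℝ)^(-j.1) := fun j => by positivity
  have hixQ : ∀ j : J, ∀ x ∈ Q j, ix x = j.1 := fun j x hx => czidx_eq j.2 hx
  have hgQ : ∀ j : J, ∀ x ∈ Q j, g x = av j.1 := by
    intro j x hx
    have : x ∈ Ω := mem_iUnion.2 ⟨j, hx⟩
    simp only [g, Set.piecewise_eq_of_mem _ _ _ this, hixQ j x hx]
  have hgO : ∀ x ∉ Ω, g x = f x := fun x hx => Set.piecewise_eq_of_notMem _ _ _ hx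
  have hvolQ : ∀ j : J, volume (Q j) ≤ ENNReal.ofReal l⁻¹ * ∫⁻ x in Q j, ‖f x‖ₑ := by
    intro j
    have h1 := j.2.1
    rw [dy_volume, ← ofReal_integral_norm_eq_lintegral_enorm hf.integrableOn,
      ← ENNReal.ofReal_mul (by positivity)]
    apply ENNReal.ofReal_le_ofReal
    rw [le_inv_mul_iff₀ hl]
    exact h1.le
  have hN0 : 0 ≤ N := integral_nonneg fun _ => norm_nonneg _
  have hfN : ∫⁻ x, ‖f x‖ₑ = ENNReal.ofReal N := (ofReal_integral_norm_eq_lintegral_enorm hf).symm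
  have hvolsum : ∑' j : J, volume (Q j) ≤ ENNReal.ofReal (N / l) := by
    calc _ ≤ ∑' j : J, ENNReal.ofReal l⁻¹ * ∫⁻ x in Q j, ‖f x‖ₑ := ENNReal.tsum_le_tsum hvolQ
      _ = ENNReal.ofReal l⁻¹ * ∫⁻ x in Ω, ‖f x‖ₑ := by
        rw [ENNReal.tsum_mul_left, lintegral_iUnion hQm hdisj]
      _ ≤ ENNReal.ofReal l⁻¹ * ENNReal.ofReal N := by
        gcongr
        rw [← hfN]
        exact setLIntegral_le_lintegral _ _
      _ = _ := by rw [← ENNReal.ofReal_mul (by positivity)]; congr 1; field_simp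
  have hvolΩ : volume Ω ≤ ENNReal.ofReal (N / l) := (measure_iUnion_le _).trans hvolsum
  have hvolS : volume S ≤ ENNReal.ofReal (2 * N / l) := by
    refine (measure_iUnion_le _).trans ?_
    have : ∀ j : J, volume (Metric.ball (c0 j.1) (2 * r0 j.1)) = ENNReal.ofReal 2 * volume (Q j) := by
      intro j
      rw [Real.volume_ball, dy_volume, ← ENNReal.ofReal_mul (by norm_num)]
      congr 1
      simp only [r0]; ring
    simp_rw [this]
    rw [ENNReal.tsum_mul_left, mul_div_assoc, ENNReal.ofReal_mul (by norm_num)]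
    gcongr
  have hav : ∀ j : J, ‖av j.1‖ ≤ 2 * l := by
    intro j
    simp only [av]
    rw [norm_smul, Real.norm_of_nonneg (inv_nonneg.2 (hpos _).le), inv_mul_le_iff₀ (hpos _)]
    calc _ ≤ _ := norm_integral_le_integral_norm _
      _ ≤ _ := cz_upper hf j.2
      _ = _ := mul_comm _ _
  have hgb : ∀ᵐ x, ‖g x‖ ≤ 2 * l := by
    filter_upwards [cz_good hf hl] with x hx
    by_cases hxO : x ∈ Ω
    · obtain ⟨j, hj⟩ := mem_iUnion.1 hxO
      rw [hgQ j x hj]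
      exact hav j
    · rw [hgO x hxO]
      have := hx fun j hj hxj => hxO (mem_iUnion.2 ⟨⟨j, hj⟩, hxj⟩)
      linarith
  have hgm : AEStronglyMeasurable g := by
    refine AEStronglyMeasurable.piecewise hΩm ?_ hf.aestronglyMeasurable.restrict
    exact ((StronglyMeasurable.of_discrete (f := av)).comp_measurable hixm).aestronglyMeasurable
  have hgl : ∫⁻ x, ‖g x‖ₑ ≤ ENNReal.ofReal (3 * N) := by
    rw [← lintegral_add_compl _ hΩm]
    have h1 : ∫⁻ x in Ω, ‖g x‖ₑ ≤ ENNReal.ofReal (2 * N) := by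
      calc _ ≤ ∫⁻ x in Ω, ENNReal.ofReal (2 * l) := by
            refine lintegral_mono_ae ?_
            filter_upwards [ae_restrict_of_ae hgb] with x hx
            rw [← ofReal_norm]
            exact ENNReal.ofReal_le_ofReal hx
        _ ≤ ENNReal.ofReal (2 * l) * ENNReal.ofReal (N / l) := by
            rw [setLIntegral_const]; gcongr
        _ = _ := by
            rw [← ENNReal.ofReal_mul (by positivity)]; congr 1; field_simp
    have h2 : ∫⁻ x in Ωᶜ, ‖g x‖ₑ ≤ ENNReal.ofReal N := by
      rw [setLIntegral_congr_fun hΩm.compl (g := fun x => ‖f x‖ₑ) (fun x hx => by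
        simp only [hgO x hx]), ← hfN]
      exact setLIntegral_le_lintegral _ _
    calc _ ≤ _ := add_le_add h1 h2
      _ = _ := by rw [← ENNReal.ofReal_add (by positivity) hN0]; congr 1; ring
  have hgi : Integrable g := ⟨hgm, hgl.trans_lt ENNReal.ofReal_lt_top⟩
  refine ⟨Ω, S, fun x => c0 (ix x), fun x => r0 (ix x), g, hΩm, hSm,
    (measurable_of_countable c0).comp hixm, hgi, hgb, ?_, hgO, hvolS, ?_, ?_⟩
  · rw [← ENNReal.ofReal_le_ofReal_iff (by positivity), ofReal_integral_norm_eq_lintegral_enorm hgi]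
    exact hgl
  · intro s hs
    obtain ⟨j, hj⟩ := mem_iUnion.1 hs
    simp only [hixQ j s hj]
    have hp := hpos j.1
    refine ⟨by simp only [r0]; positivity, ?_, ?_⟩
    · have := hj
      simp only [Q, dy, mem_Ico] at this
      rw [abs_le]
      simp only [c0, r0]
      constructor <;> linarith [this.1, this.2]
    · intro t ht
      by_contra! hlt
      exact ht (mem_iUnion.2 ⟨j, by rwa [Metric.mem_ball, Real.dist_eq]⟩)
  · intro Φ
    by_cases hi : IntegrableOn (fun s => Φ (c0 (ix s)) (f s - g s)) Ω
    · rw [integral_iUnion hQm hdisj hi]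
      have : ∀ j : J, ∫ s in Q j, Φ (c0 (ix s)) (f s - g s) = 0 := by
        intro j
        have e : ∫ s in Q j, Φ (c0 (ix s)) (f s - g s) = ∫ s in Q j, Φ (c0 j.1) (f s - av j.1) := by
          refine setIntegral_congr_fun (hQm j) fun s hs => ?_
          simp only [hixQ j s hs, hgQ j s hs]
        have hfin : volume (Q j) ≠ ⊤ := by
          simp only [Q, dy_volume]; exact ENNReal.ofReal_ne_top
        have hic : IntegrableOn (fun _ : ℝ => av j.1) (Q j) := integrableOn_const hfin
        have hii : Integrable (fun s => f s - av j.1) (volume.restrict (Q j)) :=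
          hf.integrableOn.sub hic
        rw [e, (Φ (c0 j.1)).integral_comp_comm hii,
          integral_sub hf.integrableOn hic, setIntegral_const, measureReal_def]
        simp only [Q, dy_volume, ENNReal.toReal_ofReal (hpos j.1).le, av]
        rw [smul_smul, mul_inv_cancel₀ (hpos j.1).ne', one_smul, sub_self, map_zero]
      rw [tsum_congr this, tsum_zero]
    · exact integral_undef hi

end DS

namespace DS
set_option linter.unusedSectionVars false
open scoped ENNReal

variable {H : Type*} [NormedAddCommGroup H] [InnerProductSpace ℂ H] [CompleteSpace H]

open scoped FourierTransform in
/-- Calderon-Zygmund kernels -/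
structure CZK (K : ℝ → H →L[ℂ] H) (C : ℝ) : Prop where
  nonneg : 0 ≤ C
  meas : StronglyMeasurable K
  int : Integrable K
  bdd : ∃ b, ∀ t, ‖K t‖ ≤ b
  four : ∀ ξ, ‖𝓕 K ξ‖ ≤ C
  reg : ∀ a b : ℝ, 2 * |a - b| ≤ |b| → ‖K a - K b‖ ≤ C * |a - b| / b ^ 2

lemma aesm_apply {α : Type*} {m : MeasurableSpace α} {μ : Measure α}
    {K : α → H →L[ℂ] H} {f : α → H} (hK : AEStronglyMeasurable K μ)
    (hf : AEStronglyMeasurable f μ) : AEStronglyMeasurable (fun s => K s (f s)) μ :=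
  (isBoundedBilinearMap_apply (𝕜 := ℂ) (E := H) (F := H)).continuous.comp_aestronglyMeasurable
    (hK.prodMk hf)

lemma int_apply {α : Type*} {m : MeasurableSpace α} {μ : Measure α}
    {K : α → H →L[ℂ] H} {f : α → H} (hK : AEStronglyMeasurable K μ) {b : ℝ} (hb : ∀ s, ‖K s‖ ≤ b)
    (hf : Integrable f μ) : Integrable (fun s => K s (f s)) μ := by
  refine Integrable.mono' (hf.norm.const_mul b) (aesm_apply hK hf.aestronglyMeasurable) ?_
  refine Filter.Eventually.of_forall fun s => ?_
  exact ((K s).le_opNorm _).trans (by gcongr; exact hb s)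

lemma CZK.int_apply {K : ℝ → H →L[ℂ] H} {C : ℝ} (hK : CZK K C) {f : ℝ → H} (hf : Integrable f)
    (t : ℝ) : Integrable (fun s => K (t - s) (f s)) := by
  obtain ⟨b, hb⟩ := hK.bdd
  exact DS.int_apply (hK.meas.comp_measurable (by fun_prop)).aestronglyMeasurable
    (fun s => hb _) hf

lemma CZK.cv_add {K : ℝ → H →L[ℂ] H} {C : ℝ} (hK : CZK K C) {f g : ℝ → H} (hf : Integrable f)
    (hg : Integrable g) (t : ℝ) : cv K (fun s => f s + g s) t = cv K f t + cv K g t := by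
  simp only [cv, map_add]
  exact integral_add (hK.int_apply hf t) (hK.int_apply hg t)

lemma inner_bound {C : ℝ} (hC : 0 ≤ C) {R : ℝ} (hR : 0 ≤ R) (c : ℝ) :
    ∫⁻ t in {t | 2 * R ≤ |t - c|}, ENNReal.ofReal (C * R / (t - c) ^ 2) ≤ ENNReal.ofReal C := by
  rcases hR.eq_or_lt with rfl | hR
  · simp
  have h0 : ∀ t ∈ {t | 2 * R ≤ |t - c|}, t ∈ {t | 2 * R ≤ |t - c|} := fun _ h => h
  have hint := integrableOn_Ioi_rpow_of_lt (a := -2) (c := R) (by norm_num) hR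
  have h1 : ∀ σ : ℝ, σ = 1 ∨ σ = -1 → ∫⁻ t in {t | 2 * R ≤ σ * (t - c)},
      ENNReal.ofReal (C * R / (t - c) ^ 2) = ENNReal.ofReal (C / 2) := by
    intro σ hσ
    have hσ2 : σ ^ 2 = 1 := by rcases hσ with rfl | rfl <;> norm_num
    have e1 : ∫⁻ t in {t | 2 * R ≤ σ * (t - c)}, ENNReal.ofReal (C * R / (t - c) ^ 2)
        = ∫⁻ t, (Ici (2 * R)).indicator (fun x => ENNReal.ofReal (C * R / x ^ 2)) (σ * (t - c)) := by
      rw [← lintegral_indicator (measurableSet_le (by fun_prop) (by fun_prop))]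
      congr 1; ext t
      simp only [indicator, mem_ofPred_eq, mem_Ici]
      rw [mul_pow, hσ2, one_mul]
    have e2 : ∀ F : ℝ → ℝ≥0∞, ∫⁻ t, F (σ * (t - c)) = ∫⁻ t, F t := by
      intro F
      rw [lintegral_sub_right_eq_self (fun t => F (σ * t)) c]
      rcases hσ with rfl | rfl
      · simp
      · simpa using lintegral_neg_eq_self (μ := volume) F
    rw [e1, e2, lintegral_indicator measurableSet_Ici, setLIntegral_congr Ioi_ae_eq_Ici.symm]
    have e3 : ∀ x ∈ Ioi (2 * R), C * R / x ^ 2 = C * R * x ^ (-2 : ℝ) := by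
      intro x hx
      have : 0 < x := by have := mem_Ioi.1 hx; linarith
      rw [Real.rpow_neg this.le, div_eq_mul_inv]; norm_cast
    rw [setLIntegral_congr_fun (g := fun x => ENNReal.ofReal (C * R * x ^ (-2 : ℝ))) measurableSet_Ioi
      (fun x hx => by simp only [e3 x hx])]
    have hint := integrableOn_Ioi_rpow_of_lt (a := -2) (c := 2 * R) (by norm_num) (by positivity)
    rw [← ofReal_integral_eq_lintegral_ofReal (hint.const_mul _), integral_const_mul,
      integral_Ioi_rpow_of_lt (by norm_num) (by positivity)]
    · congr 1
      have : (2 * R) ^ (-2 + 1 : ℝ) = (2 * R)⁻¹ := by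
        norm_num; rw [Real.rpow_neg_one, mul_inv, mul_comm]; norm_num [mul_comm]
      rw [this]; field_simp; norm_num
    · filter_upwards [ae_restrict_mem measurableSet_Ioi] with x hx
      have : 0 < x := by have := mem_Ioi.1 hx; linarith
      positivity
  have hsub : {t | 2 * R ≤ |t - c|} ⊆ {t | 2 * R ≤ 1 * (t - c)} ∪ {t | 2 * R ≤ (-1) * (t - c)} := by
    intro t ht
    rcases le_abs.1 (show 2 * R ≤ |t - c| from ht) with h | h
    · left; simpa using h
    · right; simpa using h
  calc _ ≤ _ := lintegral_mono_set hsub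
    _ ≤ _ := lintegral_union_le _ _ _
    _ = ENNReal.ofReal (C / 2) + ENNReal.ofReal (C / 2) := by
      rw [h1 1 (Or.inl rfl), h1 (-1) (Or.inr rfl)]
    _ = _ := by rw [← ENNReal.ofReal_add (by positivity) (by positivity), add_halves]

lemma weak_bad {K : ℝ → H →L[ℂ] H} {C : ℝ} (hK : CZK K C) {Ω S : Set ℝ} (hΩ : MeasurableSet Ω)
    (hS : MeasurableSet S) {c r : ℝ → ℝ} (hc : Measurable c) {b : ℝ → H} (hb : Integrable b)
    (hb0 : ∀ x ∉ Ω, b x = 0)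
    (hcr : ∀ s ∈ Ω, 0 < r s ∧ |s - c s| ≤ r s ∧ ∀ t ∉ S, 2 * r s ≤ |t - c s|)
    (h0 : ∀ Φ : ℝ → H →L[ℂ] H, ∫ s in Ω, Φ (c s) (b s) = 0) :
    ∫⁻ t in Sᶜ, ‖cv K b t‖ₑ ≤ ENNReal.ofReal C * ∫⁻ s, ‖b s‖ₑ := by
  obtain ⟨B, hB⟩ := hK.bdd
  let k : ℝ → ℝ → ℝ≥0∞ := fun t s => ENNReal.ofReal (C * |s - c s| / (t - c s) ^ 2) * ‖b s‖ₑ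
  have h1 : ∀ t ∈ Sᶜ, ‖cv K b t‖ₑ ≤ ∫⁻ s in Ω, k t s := by
    intro t ht
    have i1 : Integrable (fun s => K (t - s) (b s)) := hK.int_apply hb t
    have i2 : Integrable (fun s => K (t - c s) (b s)) :=
      DS.int_apply (hK.meas.comp_measurable (by fun_prop)).aestronglyMeasurable (fun s => hB _) hb
    have e : cv K b t = ∫ s in Ω, (K (t - s) (b s) - K (t - c s) (b s)) := by
      rw [integral_sub i1.integrableOn i2.integrableOn, h0 (fun x => K (t - x)), sub_zero, cv,
        setIntegral_eq_integral_of_forall_compl_eq_zero]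
      intro x hx; rw [hb0 x hx, map_zero]
    rw [e]
    refine (enorm_integral_le_lintegral_enorm _).trans ?_
    refine setLIntegral_mono' hΩ fun s hs => ?_
    obtain ⟨hr, h1, h2⟩ := hcr s hs
    have h2 := h2 t ht
    rw [← sub_apply]
    refine (ContinuousLinearMap.le_opENorm _ _).trans ?_
    simp only [k]
    gcongr
    rw [← ofReal_norm]
    apply ENNReal.ofReal_le_ofReal
    have e : |t - s - (t - c s)| = |s - c s| := by rw [← abs_neg]; congr 1; ring
    have := hK.reg (t - s) (t - c s) (by rw [e]; linarith)
    rwa [e] at this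
  calc _ ≤ ∫⁻ t in Sᶜ, ∫⁻ s in Ω, k t s := setLIntegral_mono' hS.compl h1
    _ = ∫⁻ s in Ω, ∫⁻ t in Sᶜ, k t s := by
      refine lintegral_lintegral_swap ?_
      refine AEMeasurable.mul (f := fun x : ℝ × ℝ => ENNReal.ofReal (C * |x.2 - c x.2| / (x.1 - c x.2) ^ 2)) (g := fun x : ℝ × ℝ => ‖b x.2‖ₑ) ?_ ?_
      · exact Measurable.aemeasurable (by fun_prop)
      · exact (hb.aestronglyMeasurable.enorm.restrict (s := Ω)).comp_snd (μ := volume.restrict Sᶜ)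
    _ ≤ ∫⁻ s in Ω, ENNReal.ofReal C * ‖b s‖ₑ := by
      refine setLIntegral_mono' hΩ fun s hs => ?_
      simp only [k]
      rw [lintegral_mul_const _ (by fun_prop)]
      gcongr
      refine le_trans (lintegral_mono_set ?_) (inner_bound hK.nonneg (abs_nonneg (s - c s)) (c s))
      intro t ht
      obtain ⟨hr, h1, h2⟩ := hcr s hs
      have h2 := h2 t ht
      simp only [mem_ofPred_eq]; linarith
    _ = ENNReal.ofReal C * ∫⁻ s in Ω, ‖b s‖ₑ :=
      lintegral_const_mul'' _ hb.aestronglyMeasurable.enorm.restrict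
    _ ≤ _ := mul_le_mul_right (setLIntegral_le_lintegral _ _) _

lemma weak11 {K : ℝ → H →L[ℂ] H} {C : ℝ} (hK : CZK K C) {f : ℝ → H} (hf : Integrable f)
    {l : ℝ} (hl : 0 < l) :
    volume {t | l < ‖cv K f t‖} ≤
      ENNReal.ofReal ((24 * C ^ 2 + 2 + 8 * C) / l) * ∫⁻ x, ‖f x‖ₑ := by
  have hC := hK.nonneg
  obtain ⟨Ω, S, c, r, g, hΩ, hS, hc, hg, hgb, hgN, hgf, hvS, hcr, h0⟩ := cz_decomp hf hl
  set N := ∫ x, ‖f x‖ with hN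
  have hN0 : 0 ≤ N := integral_nonneg fun _ => norm_nonneg _
  have hfN : ∫⁻ x, ‖f x‖ₑ = ENNReal.ofReal N := (ofReal_integral_norm_eq_lintegral_enorm hf).symm
  have hgl : ∫⁻ x, ‖g x‖ₑ ≤ ENNReal.ofReal (3 * N) := by
    rw [← ofReal_integral_norm_eq_lintegral_enorm hg]; exact ENNReal.ofReal_le_ofReal hgN
  let b : ℝ → H := fun x => f x - g x
  have hbi : Integrable b := hf.sub hg
  have hbl : ∫⁻ x, ‖b x‖ₑ ≤ ENNReal.ofReal (4 * N) := by
    calc _ ≤ ∫⁻ x, (‖f x‖ₑ + ‖g x‖ₑ) := lintegral_mono fun x => enorm_sub_le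
      _ = (∫⁻ x, ‖f x‖ₑ) + ∫⁻ x, ‖g x‖ₑ := lintegral_add_left' hf.aestronglyMeasurable.enorm _
      _ ≤ ENNReal.ofReal N + ENNReal.ofReal (3 * N) := add_le_add hfN.le hgl
      _ = _ := by rw [← ENNReal.ofReal_add hN0 (by positivity)]; congr 1; ring
  have hbad := weak_bad hK hΩ hS hc hbi (fun x hx => by simp [b, hgf x hx]) hcr h0
  have hcg := cv_integrable hK.int hg
  have hcb := cv_integrable hK.int hbi
  have e2 : ∫⁻ x, ‖g x‖ₑ ^ (2:ℝ) ≤ ENNReal.ofReal (2 * l * (3 * N)) := by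
    calc _ ≤ ∫⁻ x, ENNReal.ofReal (2 * l) * ‖g x‖ₑ := by
          refine lintegral_mono_ae ?_
          filter_upwards [hgb] with x hx
          rw [ENNReal.rpow_two, sq]
          gcongr
          rw [← ofReal_norm]; exact ENNReal.ofReal_le_ofReal hx
      _ = ENNReal.ofReal (2 * l) * ∫⁻ x, ‖g x‖ₑ := lintegral_const_mul'' _ hg.aestronglyMeasurable.enorm
      _ ≤ _ := by rw [ENNReal.ofReal_mul (p := 2 * l) (by positivity)]; exact mul_le_mul_right hgl _
  have e3 : eLpNorm g 2 volume ^ (2:ℝ) = ∫⁻ x, ‖g x‖ₑ ^ (2:ℝ) := by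
    have := eLpNorm_nnreal_pow_eq_lintegral (f := g) (μ := volume) (p := 2) (by norm_num)
    simpa using this
  have hg2 : MemLp g 2 := by
    refine ⟨hg.aestronglyMeasurable, ?_⟩
    rw [lt_top_iff_ne_top]
    intro h
    rw [h] at e3
    rw [← e3] at e2
    simp at e2
  obtain ⟨hm, hle⟩ := cv_L2 hK.int hK.four hg hg2
  have A1 : volume {t | ENNReal.ofReal (l / 2) ≤ ‖cv K g t‖ₑ} ≤ ENNReal.ofReal (24 * C ^ 2 / l * N) := by
    have := meas_ge_le_mul_pow_eLpNorm_enorm volume (p := 2) (by norm_num) (by norm_num)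
      hcg.aestronglyMeasurable (ε := ENNReal.ofReal (l/2)) (by simpa using hl) (by simp)
    refine this.trans ?_
    rw [ENNReal.toReal_ofNat]
    calc _ ≤ (ENNReal.ofReal (l/2))⁻¹ ^ (2:ℝ) * (ENNReal.ofReal C * eLpNorm g 2 volume) ^ (2:ℝ) := by
            gcongr
      _ ≤ ENNReal.ofReal ((l/2)⁻¹ ^ 2) * (ENNReal.ofReal (C ^ 2) * ENNReal.ofReal (2 * l * (3 * N))) := by
            rw [ENNReal.mul_rpow_of_nonneg _ _ (by norm_num), e3, ← ENNReal.ofReal_inv_of_pos (by positivity)]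
            rw [ENNReal.rpow_two, ENNReal.rpow_two, ENNReal.ofReal_pow (by positivity),
              ENNReal.ofReal_pow (by positivity)]
            gcongr
      _ = _ := by
            rw [← ENNReal.ofReal_mul (by positivity), ← ENNReal.ofReal_mul (by positivity)]
            congr 1; field_simp; ring
  have A2 : volume.restrict Sᶜ {t | ENNReal.ofReal (l / 2) ≤ ‖cv K b t‖ₑ}
      ≤ ENNReal.ofReal (8 * C / l * N) := by
    refine (meas_ge_le_lintegral_div hcb.aestronglyMeasurable.enorm.restrict
      (by simpa using hl) (by simp)).trans ?_
    rw [ENNReal.div_eq_inv_mul, ← ENNReal.ofReal_inv_of_pos (by positivity)]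
    calc _ ≤ ENNReal.ofReal (l/2)⁻¹ * (ENNReal.ofReal C * ENNReal.ofReal (4 * N)) := by
            gcongr; exact hbad.trans (by gcongr)
      _ = _ := by
            rw [← ENNReal.ofReal_mul (by positivity), ← ENNReal.ofReal_mul (by positivity)]
            congr 1; field_simp; ring
  have hsub : {t | l < ‖cv K f t‖} ⊆ {t | ENNReal.ofReal (l / 2) ≤ ‖cv K g t‖ₑ} ∪
      (S ∪ ({t | ENNReal.ofReal (l / 2) ≤ ‖cv K b t‖ₑ} ∩ Sᶜ)) := by
    intro t ht
    by_contra! hn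
    simp only [mem_union, mem_inter_iff, mem_ofPred_eq, mem_compl_iff, not_or, not_and, not_not] at hn
    obtain ⟨h1, h2, h3⟩ := hn
    have h4 : ¬ ENNReal.ofReal (l / 2) ≤ ‖cv K b t‖ₑ := fun h => h2 (h3 h)
    rw [← ofReal_norm, ENNReal.ofReal_le_ofReal_iff (norm_nonneg _)] at h1 h4
    have := hK.cv_add hg hbi t
    simp only [b, add_sub_cancel] at this
    have ht : l < ‖cv K f t‖ := ht
    rw [this] at ht
    have := norm_add_le (cv K g t) (cv K b t)
    simp only [b] at this h4
    linarith
  calc _ ≤ _ := measure_mono hsub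
    _ ≤ _ := (measure_union_le _ _).trans (add_le_add le_rfl (measure_union_le _ _))
    _ ≤ ENNReal.ofReal (24 * C ^ 2 / l * N) + (ENNReal.ofReal (2 * N / l) +
          ENNReal.ofReal (8 * C / l * N)) := by
        gcongr
        rwa [Measure.restrict_apply' hS.compl] at A2
    _ = _ := by
        rw [hfN, ← ENNReal.ofReal_mul (by positivity), ← ENNReal.ofReal_add (by positivity) (by positivity),
          ← ENNReal.ofReal_add (by positivity) (by positivity)]
        congr 1; field_simp; ring

end DS

namespace DS
set_option linter.unusedSectionVars false
open scoped ENNReal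

variable {H : Type*} [NormedAddCommGroup H] [InnerProductSpace ℂ H] [CompleteSpace H]

lemma mk_i1 {a p : ℝ} (ha : 0 ≤ a) (hp : 1 < p) :
    ∫⁻ l in Ioc 0 a, ENNReal.ofReal (l ^ (p - 2)) = ENNReal.ofReal (a ^ (p - 1) / (p - 1)) := by
  have hi : IntervalIntegrable (fun l : ℝ => l ^ (p - 2)) volume 0 a :=
    intervalIntegral.intervalIntegrable_rpow' (by linarith)
  have hi2 := (intervalIntegrable_iff_integrableOn_Ioc_of_le ha).1 hi
  rw [← ofReal_integral_eq_lintegral_ofReal hi2, ← intervalIntegral.integral_of_le ha,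
    integral_rpow (Or.inl (by linarith))]
  · have : p - 2 + 1 = p - 1 := by ring
    rw [this, Real.zero_rpow (by linarith), sub_zero]
  · filter_upwards [ae_restrict_mem measurableSet_Ioc] with x hx
    exact Real.rpow_nonneg hx.1.le _

lemma mk_i2 {a p : ℝ} (ha : 0 < a) (hp : p < 2) :
    ∫⁻ l in Ioi a, ENNReal.ofReal (l ^ (p - 3)) = ENNReal.ofReal (a ^ (p - 2) / (2 - p)) := by
  have hi := integrableOn_Ioi_rpow_of_lt (a := p - 3) (c := a) (by linarith) ha
  rw [← ofReal_integral_eq_lintegral_ofReal hi, integral_Ioi_rpow_of_lt (by linarith) ha]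
  · have : p - 3 + 1 = p - 2 := by ring
    rw [this, ← neg_div_neg_eq, neg_neg, neg_sub]
  · filter_upwards [ae_restrict_mem measurableSet_Ioi] with x hx
    exact Real.rpow_nonneg (ha.le.trans hx.le) _

lemma mk_split {K : ℝ → H →L[ℂ] H} {C : ℝ} (hK : CZK K C) {f : ℝ → H} (hf : Integrable f)
    (hfm : StronglyMeasurable f) {l : ℝ} (hl : 0 < l) :
    volume {t | l < ‖cv K f t‖} ≤
      ENNReal.ofReal (2 * (24 * C ^ 2 + 2 + 8 * C) / l) * (∫⁻ x, {x | l < ‖f x‖}.indicator (fun x => ‖f x‖ₑ) x)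
       + ENNReal.ofReal (4 * C ^ 2 / l ^ 2) *
        ∫⁻ x, {x | ‖f x‖ ≤ l}.indicator (fun x => ‖f x‖ₑ ^ (2:ℝ)) x := by
  have hC := hK.nonneg
  have hm1 : MeasurableSet {x | l < ‖f x‖} := measurableSet_lt measurable_const hfm.norm.measurable
  have hm2 : MeasurableSet {x | ‖f x‖ ≤ l} := measurableSet_le hfm.norm.measurable measurable_const
  let f1 := {x | l < ‖f x‖}.indicator f
  let f2 := {x | ‖f x‖ ≤ l}.indicator f
  have h1 : Integrable f1 := hf.indicator hm1
  have h2 : Integrable f2 := hf.indicator hm2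
  have hff : f = fun s => f1 s + f2 s := by
    ext s
    by_cases h : l < ‖f s‖
    · simp [f1, f2, h]
    · simp [f1, f2, h, not_lt.1 h]
  have hb2 : ∀ x, ‖f2 x‖ ≤ l := by
    intro x
    by_cases h : ‖f x‖ ≤ l
    · simp [f2, h]
    · simp [f2, h, hl.le]
  have e3 : eLpNorm f2 2 volume ^ (2:ℝ) = ∫⁻ x, ‖f2 x‖ₑ ^ (2:ℝ) := by
    have := eLpNorm_nnreal_pow_eq_lintegral (f := f2) (μ := volume) (p := 2) (by norm_num)
    simpa using this
  have hf2 : MemLp f2 2 := by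
    refine ⟨h2.aestronglyMeasurable, ?_⟩
    have e2 : ∫⁻ x, ‖f2 x‖ₑ ^ (2:ℝ) < ⊤ := by
      calc _ ≤ ∫⁻ x, ENNReal.ofReal l * ‖f2 x‖ₑ := by
            refine lintegral_mono fun x => ?_
            rw [ENNReal.rpow_two, sq]
            gcongr
            rw [← ofReal_norm]; exact ENNReal.ofReal_le_ofReal (hb2 x)
        _ = ENNReal.ofReal l * ∫⁻ x, ‖f2 x‖ₑ := lintegral_const_mul'' _ h2.aestronglyMeasurable.enorm
        _ < ⊤ := ENNReal.mul_lt_top ENNReal.ofReal_lt_top h2.2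
    rw [lt_top_iff_ne_top]
    intro h
    rw [h] at e3
    rw [← e3] at e2
    simp at e2
  obtain ⟨hm, hle⟩ := cv_L2 hK.int hK.four h2 hf2
  have A1 : volume {t | ENNReal.ofReal (l / 2) ≤ ‖cv K f2 t‖ₑ} ≤
      ENNReal.ofReal (4 * C ^ 2 / l ^ 2) * ∫⁻ x, ‖f2 x‖ₑ ^ (2:ℝ) := by
    have := meas_ge_le_mul_pow_eLpNorm_enorm volume (p := 2) (by norm_num) (by norm_num)
      hm.aestronglyMeasurable (ε := ENNReal.ofReal (l/2)) (by simpa using hl) (by simp)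
    refine this.trans ?_
    rw [ENNReal.toReal_ofNat]
    calc _ ≤ (ENNReal.ofReal (l/2))⁻¹ ^ (2:ℝ) * (ENNReal.ofReal C * eLpNorm f2 2 volume) ^ (2:ℝ) := by
            gcongr
      _ = ENNReal.ofReal ((l/2)⁻¹ ^ 2) * (ENNReal.ofReal (C ^ 2) * ∫⁻ x, ‖f2 x‖ₑ ^ (2:ℝ)) := by
            rw [ENNReal.mul_rpow_of_nonneg _ _ (by norm_num), e3, ← ENNReal.ofReal_inv_of_pos (by positivity)]
            rw [ENNReal.rpow_two, ENNReal.rpow_two, ENNReal.ofReal_pow (by positivity),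
              ENNReal.ofReal_pow (by positivity)]
      _ = _ := by
            rw [← mul_assoc, ← ENNReal.ofReal_mul (by positivity)]
            congr 2; field_simp; norm_num [mul_comm]
  have A2 := weak11 hK h1 (l := l / 2) (by positivity)
  have hsub : {t | l < ‖cv K f t‖} ⊆ {t | l / 2 < ‖cv K f1 t‖} ∪ {t | ENNReal.ofReal (l / 2) ≤ ‖cv K f2 t‖ₑ} := by
    intro t ht
    by_contra! hn
    simp only [mem_union, mem_ofPred_eq, not_or, not_lt] at hn
    obtain ⟨h3, h4⟩ := hn
    rw [← ofReal_norm, ENNReal.ofReal_le_ofReal_iff (norm_nonneg _)] at h4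
    have := hK.cv_add h1 h2 t
    rw [← hff] at this
    have ht : l < ‖cv K f t‖ := ht
    rw [this] at ht
    have := norm_add_le (cv K f1 t) (cv K f2 t)
    linarith
  refine (measure_mono hsub).trans ((measure_union_le _ _).trans (add_le_add (A2.trans (le_of_eq ?_))
    (A1.trans (le_of_eq ?_))))
  · congr 1
    · congr 1; field_simp
    · refine lintegral_congr fun x => ?_
      simp only [f1, indicator]; split_ifs <;> simp
  · congr 1
    refine lintegral_congr fun x => ?_
    simp only [f2, indicator]; split_ifs <;> simp

lemma mk_lt2 {K : ℝ → H →L[ℂ] H} {C : ℝ} (hK : CZK K C) {f : ℝ → H} (hf : Integrable f)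
    {p : ℝ} (hp1 : 1 < p) (hp2 : p < 2) :
    ∫⁻ t, ‖cv K f t‖ₑ ^ p ≤ ENNReal.ofReal
      (p * (2 * (24 * C ^ 2 + 2 + 8 * C) / (p - 1) + 4 * C ^ 2 / (2 - p))) * ∫⁻ t, ‖f t‖ₑ ^ p := by
  wlog hfm : StronglyMeasurable f generalizing f
  · have hae := hf.aestronglyMeasurable.ae_eq_mk
    set f' := hf.aestronglyMeasurable.mk f
    have e1 : cv K f = cv K f' := by
      ext t
      refine integral_congr_ae ?_
      filter_upwards [hae] with s hs
      rw [hs]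
    have e2 : ∫⁻ t, ‖f t‖ₑ ^ p = ∫⁻ t, ‖f' t‖ₑ ^ p := by
      refine lintegral_congr_ae ?_
      filter_upwards [hae] with s hs
      rw [hs]
    rw [e1, e2]
    exact this (hf.congr hae) hf.aestronglyMeasurable.stronglyMeasurable_mk
  have hC := hK.nonneg
  set D := 2 * (24 * C ^ 2 + 2 + 8 * C) with hD
  have hD0 : 0 ≤ D := by positivity
  have hp0 : 0 < p := by linarith
  have hp3 : 0 < p - 1 := by linarith
  have hp4 : 0 < 2 - p := by linarith
  have hcv := cv_integrable hK.int hf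
  have e0 : ∫⁻ t, ‖cv K f t‖ₑ ^ p = ∫⁻ t, ENNReal.ofReal (‖cv K f t‖ ^ p) := by
    refine lintegral_congr fun t => ?_
    rw [← ENNReal.ofReal_rpow_of_nonneg (norm_nonneg _) hp0.le, ofReal_norm]
  rw [e0, lintegral_rpow_eq_lintegral_meas_lt_mul _ (Filter.Eventually.of_forall fun t => norm_nonneg _)
    hcv.norm.aestronglyMeasurable.aemeasurable hp0, ENNReal.ofReal_mul hp0.le, mul_assoc]
  gcongr
  have hfn : Measurable fun x => ‖f x‖ := hfm.norm.measurable
  have hfe : Measurable fun x => ‖f x‖ₑ := hfm.enorm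
  let F1 : ℝ → ℝ → ℝ≥0∞ := fun l x => {y : ℝ × ℝ | y.1 < ‖f y.2‖}.indicator
    (fun y => ENNReal.ofReal (D * y.1 ^ (p - 2)) * ‖f y.2‖ₑ) (l, x)
  let F2 : ℝ → ℝ → ℝ≥0∞ := fun l x => {y : ℝ × ℝ | ‖f y.2‖ ≤ y.1}.indicator
    (fun y => ENNReal.ofReal (4 * C ^ 2 * y.1 ^ (p - 3)) * ‖f y.2‖ₑ ^ (2:ℝ)) (l, x)
  have hF1 : Measurable (Function.uncurry F1) := by
    refine Measurable.indicator (by fun_prop) (measurableSet_lt measurable_fst (hfn.comp measurable_snd))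
  have hF2 : Measurable (Function.uncurry F2) := by
    refine Measurable.indicator (by fun_prop) (measurableSet_le (hfn.comp measurable_snd) measurable_fst)
  have hb : ∀ l ∈ Ioi (0:ℝ), volume {a | l < ‖cv K f a‖} * ENNReal.ofReal (l ^ (p - 1)) ≤
      (∫⁻ x, F1 l x) + ∫⁻ x, F2 l x := by
    intro l hl
    have hl : 0 < l := hl
    refine (mul_le_mul_left (mk_split hK hf hfm hl) _).trans (le_of_eq ?_)
    have hm1 : Measurable ({x | l < ‖f x‖}.indicator fun x => ‖f x‖ₑ) :=
      Measurable.indicator hfe (measurableSet_lt (by fun_prop) (by fun_prop))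
    have hm2 : Measurable ({x | ‖f x‖ ≤ l}.indicator fun x => ‖f x‖ₑ ^ (2:ℝ)) :=
      Measurable.indicator (by fun_prop) (measurableSet_le (by fun_prop) (by fun_prop))
    have q1 : D / l * l ^ (p - 1) = D * l ^ (p - 2) := by
      rw [show p - 1 = (p - 2) + 1 by ring, Real.rpow_add_one hl.ne']; field_simp
    have q2 : 4 * C ^ 2 / l ^ 2 * l ^ (p - 1) = 4 * C ^ 2 * l ^ (p - 3) := by
      rw [show p - 1 = (p - 3) + 1 + 1 by ring, Real.rpow_add_one hl.ne', Real.rpow_add_one hl.ne']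
      field_simp
    rw [add_mul, mul_right_comm, mul_right_comm _ (lintegral _ _), ← ENNReal.ofReal_mul (by positivity),
      ← ENNReal.ofReal_mul (by positivity), q1, q2, ← lintegral_const_mul _ hm1,
      ← lintegral_const_mul _ hm2]
    congr 1
    · refine lintegral_congr fun x => ?_
      simp only [F1, indicator, mem_ofPred_eq]; split_ifs <;> simp
    · refine lintegral_congr fun x => ?_
      simp only [F2, indicator, mem_ofPred_eq]; split_ifs <;> simp
  have hx0 : ∀ x, ‖f x‖ₑ = ENNReal.ofReal ‖f x‖ := fun x => (ofReal_norm _).symm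
  have hI1 : ∀ x, ∫⁻ l in Ioi 0, F1 l x ≤ ENNReal.ofReal (D / (p - 1)) * ‖f x‖ₑ ^ p := by
    intro x
    calc _ ≤ ∫⁻ l in Ioi 0, (Ioc 0 ‖f x‖).indicator
          (fun l => ENNReal.ofReal D * ‖f x‖ₑ * ENNReal.ofReal (l ^ (p - 2))) l := by
          refine setLIntegral_mono' measurableSet_Ioi fun l hl => ?_
          simp only [F1, indicator, mem_ofPred_eq, mem_Ioc]
          split_ifs with h1 h2
          · rw [ENNReal.ofReal_mul hD0, mul_right_comm]
          · exact absurd ⟨hl, h1.le⟩ h2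
          · exact zero_le
          · exact le_rfl
      _ ≤ ∫⁻ l, (Ioc 0 ‖f x‖).indicator
          (fun l => ENNReal.ofReal D * ‖f x‖ₑ * ENNReal.ofReal (l ^ (p - 2))) l :=
          setLIntegral_le_lintegral _ _
      _ = ENNReal.ofReal D * ‖f x‖ₑ * ENNReal.ofReal (‖f x‖ ^ (p - 1) / (p - 1)) := by
          rw [lintegral_indicator measurableSet_Ioc, lintegral_const_mul _ (by fun_prop),
            mk_i1 (norm_nonneg _) hp1]
      _ = _ := by
          rw [hx0, ← ENNReal.ofReal_mul hD0, ← ENNReal.ofReal_mul (by positivity),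
            ENNReal.ofReal_rpow_of_nonneg (norm_nonneg _) hp0.le, ← ENNReal.ofReal_mul (by positivity)]
          congr 1
          have : ‖f x‖ ^ p = ‖f x‖ * ‖f x‖ ^ (p - 1) := by
            rw [← Real.rpow_one_add' (norm_nonneg _) (by linarith)]; congr 1; ring
          rw [this]; field_simp
  have hI2 : ∀ x, ∫⁻ l in Ioi 0, F2 l x ≤ ENNReal.ofReal (4 * C ^ 2 / (2 - p)) * ‖f x‖ₑ ^ p := by
    intro x
    rcases (norm_nonneg (f x)).eq_or_lt with h0 | h0
    · have : ‖f x‖ₑ = 0 := by rw [hx0, ← h0]; simp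
      have hz : ∀ l, F2 l x = 0 := by
        intro l; simp [F2, indicator, this]
      simp [hz]
    calc _ ≤ ∫⁻ l in Ioi 0, (Ici ‖f x‖).indicator
          (fun l => ENNReal.ofReal (4 * C ^ 2) * ‖f x‖ₑ ^ (2:ℝ) * ENNReal.ofReal (l ^ (p - 3))) l := by
          refine setLIntegral_mono' measurableSet_Ioi fun l hl => ?_
          simp only [F2, indicator, mem_ofPred_eq, mem_Ici]
          split_ifs with h1
          · rw [ENNReal.ofReal_mul (by positivity), mul_right_comm]
          · exact le_rfl
      _ ≤ ∫⁻ l, (Ici ‖f x‖).indicator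
          (fun l => ENNReal.ofReal (4 * C ^ 2) * ‖f x‖ₑ ^ (2:ℝ) * ENNReal.ofReal (l ^ (p - 3))) l :=
          setLIntegral_le_lintegral _ _
      _ = ENNReal.ofReal (4 * C ^ 2) * ‖f x‖ₑ ^ (2:ℝ) * ENNReal.ofReal (‖f x‖ ^ (p - 2) / (2 - p)) := by
          rw [lintegral_indicator measurableSet_Ici, lintegral_const_mul _ (by fun_prop),
            setLIntegral_congr Ioi_ae_eq_Ici.symm, mk_i2 h0 hp2]
      _ = _ := by
          rw [hx0, ENNReal.ofReal_rpow_of_nonneg (norm_nonneg _) (by norm_num),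
            ← ENNReal.ofReal_mul (by positivity), ← ENNReal.ofReal_mul (by positivity),
            ENNReal.ofReal_rpow_of_nonneg (norm_nonneg _) hp0.le, ← ENNReal.ofReal_mul (by positivity)]
          congr 1
          have : ‖f x‖ ^ p = ‖f x‖ ^ (2:ℝ) * ‖f x‖ ^ (p - 2) := by
            rw [← Real.rpow_add h0]; congr 1; ring
          rw [this]; field_simp
  calc _ ≤ ∫⁻ l in Ioi 0, ((∫⁻ x, F1 l x) + ∫⁻ x, F2 l x) := setLIntegral_mono' measurableSet_Ioi hb
    _ = (∫⁻ l in Ioi 0, ∫⁻ x, F1 l x) + ∫⁻ l in Ioi 0, ∫⁻ x, F2 l x :=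
      lintegral_add_left hF1.lintegral_prod_right' _
    _ = (∫⁻ x, ∫⁻ l in Ioi 0, F1 l x) + ∫⁻ x, ∫⁻ l in Ioi 0, F2 l x := by
      rw [lintegral_lintegral_swap hF1.aemeasurable, lintegral_lintegral_swap hF2.aemeasurable]
    _ ≤ (∫⁻ x, ENNReal.ofReal (D / (p - 1)) * ‖f x‖ₑ ^ p) +
        ∫⁻ x, ENNReal.ofReal (4 * C ^ 2 / (2 - p)) * ‖f x‖ₑ ^ p :=
      add_le_add (lintegral_mono hI1) (lintegral_mono hI2)
    _ = _ := by
      rw [lintegral_const_mul _ (by fun_prop), lintegral_const_mul _ (by fun_prop), ← add_mul,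
        ENNReal.ofReal_add (by positivity) (by positivity)]

end DS

namespace DS
set_option linter.unusedSectionVars false
open scoped ENNReal

variable {H : Type*} [NormedAddCommGroup H] [InnerProductSpace ℂ H] [CompleteSpace H]

open scoped FourierTransform in
lemma CZK.adj {K : ℝ → H →L[ℂ] H} {C : ℝ} (hK : CZK K C) : CZK (fun t => star (K (-t))) C := by
  refine ⟨hK.nonneg, ?_, ?_, ?_, ?_, ?_⟩
  · exact continuous_star.comp_stronglyMeasurable (hK.meas.comp_measurable measurable_neg)
  · refine (hK.int.comp_neg.norm.mono' ?_ (Filter.Eventually.of_forall fun t => ?_))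
    · exact (continuous_star.comp_stronglyMeasurable
        (hK.meas.comp_measurable measurable_neg)).aestronglyMeasurable
    · rw [norm_star]
  · obtain ⟨b, hb⟩ := hK.bdd
    exact ⟨b, fun t => by rw [norm_star]; exact hb _⟩
  · intro ξ
    have : 𝓕 (fun t => star (K (-t))) ξ = star (𝓕 K ξ) := by
      rw [Real.fourier_real_eq, Real.fourier_real_eq]
      have h1 : star (∫ v, Real.fourierChar (-(v * ξ)) • K v)
          = ∫ v, star (Real.fourierChar (-(v * ξ)) • K v) :=
        ((starL' ℝ : (H →L[ℂ] H) ≃L[ℝ] (H →L[ℂ] H)).integral_comp_comm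
          (fun v => Real.fourierChar (-(v * ξ)) • K v)).symm
      rw [h1, ← integral_neg_eq_self]
      congr 1; ext1 v
      rw [neg_neg, Circle.smul_def, Circle.smul_def, star_smul]
      congr 1
      rw [Complex.star_def, ← Circle.coe_inv_eq_conj, ← AddChar.map_neg_eq_inv]
      congr 2; ring
    rw [this, norm_star]; exact hK.four ξ
  · intro a b h
    rw [← star_sub, norm_star]
    have e : |-a - -b| = |a - b| := by rw [← abs_neg]; congr 1; ring
    have := hK.reg (-a) (-b) (by rwa [e, abs_neg])
    rwa [e, neg_sq] at this

lemma dual_pair {K : ℝ → H →L[ℂ] H} {C : ℝ} (hK : CZK K C) {f h : ℝ → H} (hf : Integrable f)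
    (hh : Integrable h) {b : ℝ} (hb : ∀ t, ‖h t‖ ≤ b) :
    ‖∫ t, inner ℂ (h t) (cv K f t)‖ₑ ≤ ∫⁻ s, ‖cv (fun t => star (K (-t))) h s‖ₑ * ‖f s‖ₑ := by
  have hprod : Integrable (fun p : ℝ × ℝ => K (p.1 - p.2) (f p.2)) (volume.prod volume) :=
    Integrable.convolution_integrand ((ContinuousLinearMap.id ℂ (H →L[ℂ] H)).flip) hf hK.int
  have hi : Integrable (Function.uncurry fun t s => inner ℂ (h t) (K (t - s) (f s)))
      (volume.prod volume) := by
    refine (hprod.norm.const_mul b).mono' ?_ (Filter.Eventually.of_forall fun p => ?_)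
    · exact (hh.aestronglyMeasurable.comp_fst).inner hprod.aestronglyMeasurable
    · refine (norm_inner_le_norm _ _).trans ?_
      gcongr; exact hb _
  have e1 : ∫ t, inner ℂ (h t) (cv K f t) = ∫ t, ∫ s, inner ℂ (h t) (K (t - s) (f s)) := by
    congr 1; ext1 t
    rw [integral_inner (hK.int_apply hf t)]; rfl
  have e2 : ∀ s, ∫ t, inner ℂ (h t) (K (t - s) (f s)) =
      inner ℂ (cv (fun t => star (K (-t))) h s) (f s) := by
    intro s
    rw [← inner_conj_symm, cv, ← integral_inner (hK.adj.int_apply hh s), ← integral_conj]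
    congr 1; ext1 t
    rw [inner_conj_symm, ContinuousLinearMap.star_eq_adjoint, ContinuousLinearMap.adjoint_inner_left,
      neg_sub]
  rw [e1, integral_integral_swap hi]
  simp_rw [e2]
  refine (enorm_integral_le_lintegral_enorm _).trans (lintegral_mono fun s => ?_)
  rw [← ofReal_norm, ← ofReal_norm, ← ofReal_norm, ← ENNReal.ofReal_mul (norm_nonneg _)]
  exact ENNReal.ofReal_le_ofReal (norm_inner_le_norm _ _)

lemma dual_core {K : ℝ → H →L[ℂ] H} {C : ℝ} (hK : CZK K C) {p q : ℝ} (hp : 2 < p)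
    (hpq : p.HolderConjugate q) {D : ℝ≥0∞}
    (hD : ∀ h : ℝ → H, Integrable h → ∫⁻ s, ‖cv (fun t => star (K (-t))) h s‖ₑ ^ q ≤ D * ∫⁻ s, ‖h s‖ₑ ^ q)
    {f : ℝ → H} (hf : Integrable f) {E : Set ℝ} (hE : MeasurableSet E) (hE2 : volume E < ⊤)
    {b : ℝ} (hb0 : 0 ≤ b) {G : ℝ → H} (hG : StronglyMeasurable G) (hGf : cv K f =ᵐ[volume] G) (hb : ∀ t ∈ E, ‖G t‖ ≤ b) :
    ∫⁻ t in E, ‖G t‖ₑ ^ p ≤ D ^ (p / q) * ∫⁻ t, ‖f t‖ₑ ^ p := by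
  have hp0 : 0 < p := by linarith
  have hq0 : 0 < q := hpq.symm.pos
  set h : ℝ → H := E.indicator fun t => (‖G t‖ ^ (p - 2) : ℝ) • G t with hh
  have hhb : ∀ t, ‖h t‖ ≤ b ^ (p - 2) * b := by
    intro t
    by_cases ht : t ∈ E
    · simp only [h, indicator_of_mem ht, norm_smul]
      rw [Real.norm_of_nonneg (by positivity)]
      have := hb t ht
      gcongr
    · simp only [h, indicator_of_notMem ht, norm_zero]; positivity
  have hhm : StronglyMeasurable h := by
    refine StronglyMeasurable.indicator ?_ hE
    exact (hG.norm.measurable.pow_const _).stronglyMeasurable.smul hG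
  have hhi : Integrable h := by
    have : IntegrableOn (fun _ : ℝ => b ^ (p - 2) * b) E := integrableOn_const hE2.ne
    refine (this.integrable_indicator hE).mono' hhm.aestronglyMeasurable
      (Filter.Eventually.of_forall fun t => ?_)
    by_cases ht : t ∈ E
    · simp only [indicator_of_mem ht]; exact hhb t
    · simp only [h, indicator_of_notMem ht, norm_zero, le_refl]
  set I := ∫⁻ t in E, ‖G t‖ₑ ^ p with hI
  have hx0 : ∀ x, ‖G x‖ₑ = ENNReal.ofReal ‖G x‖ := fun x => (ofReal_norm _).symm
  have hIfin : I ≠ ⊤ := by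
    have : I ≤ ∫⁻ t in E, ENNReal.ofReal (b ^ p) := by
      refine setLIntegral_mono' hE fun t ht => ?_
      rw [hx0, ENNReal.ofReal_rpow_of_nonneg (norm_nonneg _) hp0.le]
      have := hb t ht
      gcongr
    rw [setLIntegral_const] at this
    exact (this.trans_lt (ENNReal.mul_lt_top ENNReal.ofReal_lt_top hE2)).ne
  have e1 : ∫⁻ t, ‖h t‖ₑ ^ q = I := by
    rw [hI, ← lintegral_indicator hE]
    refine lintegral_congr fun t => ?_
    by_cases ht : t ∈ E
    · simp only [h, indicator_of_mem ht]
      rw [← ofReal_norm, norm_smul, Real.norm_of_nonneg (by positivity), hx0,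
        ENNReal.ofReal_rpow_of_nonneg (by positivity) hq0.le,
        ENNReal.ofReal_rpow_of_nonneg (by positivity) hp0.le]
      congr 1
      rw [← Real.rpow_add_one' (norm_nonneg _) (by linarith), ← Real.rpow_mul (norm_nonneg _)]
      congr 1
      have := hpq.sub_one_mul_conj
      linarith
    · simp only [h, indicator_of_notMem ht]; simp [hq0]
  have e2 : ‖∫ t, inner ℂ (h t) (cv K f t)‖ₑ = I := by
    have : ∫ t, inner ℂ (h t) (cv K f t) = ((∫ t, E.indicator (fun t => ‖G t‖ ^ p) t : ℝ) : ℂ) := by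
      rw [← integral_complex_ofReal]
      refine integral_congr_ae ?_
      filter_upwards [hGf] with t ht
      rw [ht]
      by_cases htE : t ∈ E
      · simp only [h, indicator_of_mem htE]
        rw [← Complex.coe_smul, inner_smul_left, Complex.conj_ofReal, inner_self_eq_norm_sq_to_K]
        change ((‖G t‖ ^ (p - 2) : ℝ) : ℂ) * (‖G t‖ : ℂ) ^ 2 = _
        rw [← Complex.ofReal_pow, ← Complex.ofReal_mul, ← Real.rpow_natCast, ← Real.rpow_add' (norm_nonneg _) (by push_cast; linarith)]
        congr 1; push_cast; ring
      · simp [h, indicator_of_notMem htE]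
    rw [this, ← ofReal_norm, Complex.norm_real, Real.norm_of_nonneg, ofReal_integral_eq_lintegral_ofReal]
    · rw [hI, ← lintegral_indicator hE]
      refine lintegral_congr fun t => ?_
      by_cases htE : t ∈ E
      · simp only [indicator_of_mem htE]
        rw [hx0, ENNReal.ofReal_rpow_of_nonneg (by positivity) hp0.le]
      · simp [indicator_of_notMem htE]
    · refine ⟨((hG.norm.measurable.pow_const _).indicator hE).aestronglyMeasurable, ?_⟩
      have : ∀ t, ‖E.indicator (fun t => ‖G t‖ ^ p) t‖ₑ = E.indicator (fun t => ‖G t‖ₑ ^ p) t := by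
        intro t
        by_cases htE : t ∈ E
        · simp only [indicator_of_mem htE]
          rw [hx0, ENNReal.ofReal_rpow_of_nonneg (by positivity) hp0.le, Real.enorm_of_nonneg (by positivity)]
        · simp [indicator_of_notMem htE]
      rw [HasFiniteIntegral]
      simp_rw [this]
      rw [lintegral_indicator hE]
      exact hIfin.lt_top
    · exact Filter.Eventually.of_forall fun t => indicator_nonneg (fun t _ => by positivity) _
    · exact integral_nonneg fun t => indicator_nonneg (fun t _ => by positivity) _
  have hmain : I ≤ D ^ (1/q) * I ^ (1/q) * (∫⁻ t, ‖f t‖ₑ ^ p) ^ (1/p) := by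
    rw [← e2]
    refine (dual_pair hK hf hhi hhb).trans ?_
    refine (ENNReal.lintegral_mul_le_Lp_mul_Lq volume hpq.symm
      (cv_integrable hK.adj.int hhi).aestronglyMeasurable.enorm hf.aestronglyMeasurable.enorm).trans ?_
    rw [← ENNReal.mul_rpow_of_nonneg _ _ (by positivity), e2, ← e1]
    gcongr
    exact hD h hhi
  rcases eq_or_ne I 0 with h0 | h0
  · rw [h0]; exact zero_le
  have hqp : 1 / p + 1 / q = 1 := by simpa using hpq.inv_add_inv_eq_one
  have h1 : I ^ (1/p) ≤ D ^ (1/q) * (∫⁻ t, ‖f t‖ₑ ^ p) ^ (1/p) := by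
    have e : I = I ^ (1/q) * I ^ (1/p) := by
      rw [← ENNReal.rpow_add _ _ h0 hIfin, add_comm, hqp, ENNReal.rpow_one]
    have hne : I ^ (1/q) ≠ 0 := by
      rw [Ne, ENNReal.rpow_eq_zero_iff]; push Not
      exact ⟨fun h => absurd h h0, fun h => absurd h hIfin⟩
    have hnt : I ^ (1/q) ≠ ⊤ := ENNReal.rpow_ne_top_of_nonneg (by positivity) hIfin
    rw [← ENNReal.mul_le_mul_iff_right hne hnt, ← e]
    refine hmain.trans (le_of_eq (by ring))
  calc I = (I ^ (1/p)) ^ p := by rw [← ENNReal.rpow_mul, one_div_mul_cancel hp0.ne', ENNReal.rpow_one]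
    _ ≤ (D ^ (1/q) * (∫⁻ t, ‖f t‖ₑ ^ p) ^ (1/p)) ^ p := by gcongr
    _ = _ := by
      rw [ENNReal.mul_rpow_of_nonneg _ _ hp0.le, ← ENNReal.rpow_mul, ← ENNReal.rpow_mul,
        one_div_mul_cancel hp0.ne', ENNReal.rpow_one]
      congr 2; ring

lemma cz_Lp (C p : ℝ) (hp : 1 < p) : ∃ D : ℝ≥0∞, D ≠ ⊤ ∧ ∀ K : ℝ → H →L[ℂ] H, CZK K C →
    ∀ f : ℝ → H, Integrable f → ∫⁻ t, ‖cv K f t‖ₑ ^ p ≤ D * ∫⁻ t, ‖f t‖ₑ ^ p := by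
  rcases lt_trichotomy p 2 with h | rfl | h
  · exact ⟨_, ENNReal.ofReal_ne_top, fun K hK f hf => mk_lt2 hK hf hp h⟩
  · refine ⟨ENNReal.ofReal (C ^ 2 + 1), ENNReal.ofReal_ne_top, fun K hK f hf => ?_⟩
    have e3 : ∀ f : ℝ → H, eLpNorm f 2 volume ^ (2:ℝ) = ∫⁻ x, ‖f x‖ₑ ^ (2:ℝ) := by
      intro f
      have := eLpNorm_nnreal_pow_eq_lintegral (f := f) (μ := volume) (p := 2) (by norm_num)
      simpa using this
    rw [← e3, ← e3]
    by_cases h2 : MemLp f 2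
    · calc _ ≤ (ENNReal.ofReal C * eLpNorm f 2 volume) ^ (2:ℝ) := by
            gcongr; exact (cv_L2 hK.int hK.four hf h2).2
        _ ≤ _ := by
            rw [ENNReal.mul_rpow_of_nonneg _ _ (by norm_num)]
            gcongr
            rw [ENNReal.rpow_two, ← ENNReal.ofReal_pow hK.nonneg]
            exact ENNReal.ofReal_le_ofReal (by linarith)
    · have : eLpNorm f 2 volume = ⊤ := by
        by_contra hn
        exact h2 ⟨hf.aestronglyMeasurable, lt_top_iff_ne_top.2 hn⟩
      rw [this, ENNReal.top_rpow_of_pos (by norm_num), ENNReal.mul_top]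
      · exact le_top
      · simp; positivity
  · have hpq := Real.HolderConjugate.conjExponent hp
    set q := p.conjExponent
    have hq1 : 1 < q := hpq.symm.lt
    have hq2 : q < 2 := by
      simp only [q, Real.conjExponent]
      rw [div_lt_iff₀ (by linarith)]; linarith
    refine ⟨(ENNReal.ofReal (q * (2 * (24 * C ^ 2 + 2 + 8 * C) / (q - 1) + 4 * C ^ 2 / (2 - q)))) ^ (p / q),
      ENNReal.rpow_ne_top_of_nonneg (by positivity) ENNReal.ofReal_ne_top, fun K hK f hf => ?_⟩
    have hae := (cv_integrable hK.int hf).aestronglyMeasurable.ae_eq_mk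
    have hGm := (cv_integrable hK.int hf).aestronglyMeasurable.stronglyMeasurable_mk
    set G := (cv_integrable hK.int hf).aestronglyMeasurable.mk (cv K f)
    have e : ∫⁻ t, ‖cv K f t‖ₑ ^ p = ∫⁻ t, ‖G t‖ₑ ^ p := by
      refine lintegral_congr_ae ?_
      filter_upwards [hae] with t ht
      rw [ht]
    let E : ℕ → Set ℝ := fun n => Icc (-n : ℝ) n ∩ {t | ‖G t‖ ≤ n}
    have hU : ⋃ n, E n = univ := by
      refine eq_univ_of_forall fun t => mem_iUnion.2 ?_
      obtain ⟨n, hn⟩ := exists_nat_ge (max |t| ‖G t‖)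
      have h1 := abs_le.1 ((le_max_left _ _).trans hn)
      exact ⟨n, ⟨h1.1, h1.2⟩, (le_max_right _ _).trans hn⟩
    have hdir : Directed (fun x1 x2 => x1 ⊆ x2) E := by
      refine Monotone.directed_le (f := E) ?_
      intro m n hmn t ht
      have : (m:ℝ) ≤ n := by exact_mod_cast hmn
      have h2 : ‖G t‖ ≤ m := ht.2
      exact ⟨⟨by linarith [ht.1.1], by linarith [ht.1.2]⟩, h2.trans this⟩
    rw [e, ← setLIntegral_univ, ← hU, setLIntegral_iUnion_of_directed _ hdir]
    refine iSup_le fun n => ?_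
    refine dual_core hK h hpq (fun h hh => mk_lt2 hK.adj hh hq1 hq2) hf
      (measurableSet_Icc.inter (measurableSet_le hGm.norm.measurable measurable_const)) ?_
      (Nat.cast_nonneg n) hGm hae (fun t ht => ht.2)
    exact (measure_mono inter_subset_left).trans_lt measure_Icc_lt_top

end DS

namespace DS
set_option linter.unusedSectionVars false
open scoped ENNReal

variable {H : Type*} [NormedAddCommGroup H] [InnerProductSpace ℂ H] [CompleteSpace H]

/-- sectorial bounded operator with resolvent `R` -/
structure Sec (B : H →L[ℂ] H) (R : ℂ → H →L[ℂ] H) (M : ℝ) : Prop where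
  right : ∀ l : ℂ, 0 ≤ l.re → (l • 1 + B) * R l = 1
  left : ∀ l : ℂ, 0 ≤ l.re → R l * (l • 1 + B) = 1
  bd : ∀ l : ℂ, 0 ≤ l.re → ‖R l‖ * (1 + ‖l‖) ≤ M

lemma Sec.nonneg {B : H →L[ℂ] H} {R : ℂ → H →L[ℂ] H} {M : ℝ} (h : Sec B R M) : 0 ≤ M :=
  le_trans (by positivity) (h.bd 0 (by simp))

/-- the semigroup -/
def SG (B : H →L[ℂ] H) (t : ℝ) : H →L[ℂ] H := NormedSpace.exp ((t : ℂ) • (-B))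

lemma SG_deriv (B : H →L[ℂ] H) (t : ℝ) : HasDerivAt (SG B) (-(B * SG B t)) t := by
  have h := (hasDerivAt_exp_smul_const' (𝕂 := ℂ) (-B) (t : ℂ))
  have := HasDerivAt.scomp t h Complex.ofRealCLM.hasDerivAt
  convert! this using 1
  simp [SG]

lemma SG_continuous (B : H →L[ℂ] H) : Continuous (SG B) :=
  continuous_iff_continuousAt.2 fun t => (SG_deriv B t).continuousAt

lemma SG_zero (B : H →L[ℂ] H) : SG B 0 = 1 := by simp [SG]

lemma SG_add (B : H →L[ℂ] H) (s t : ℝ) : SG B (s + t) = SG B s * SG B t := by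
  let _ : NormedAlgebra ℚ (H →L[ℂ] H) := NormedAlgebra.restrictScalars ℚ ℂ _
  rw [SG, SG, SG, Complex.ofReal_add, add_smul, NormedSpace.exp_add_of_commute]
  exact ((Commute.refl (-B)).smul_left _).smul_right _

lemma SG_comm (B : H →L[ℂ] H) (t : ℝ) : B * SG B t = SG B t * B := by
  have : Commute B ((t : ℂ) • (-B)) := ((Commute.refl B).neg_right).smul_right _
  let _ : NormedAlgebra ℚ (H →L[ℂ] H) := NormedAlgebra.restrictScalars ℚ ℂ _
  exact this.exp_right

/-- growth bound -/
def Gr (B : H →L[ℂ] H) (σ : ℝ) : Prop := ∃ C : ℝ, 0 ≤ C ∧ ∀ t : ℝ, 0 ≤ t → ‖SG B t‖ ≤ C * Real.exp (σ * t)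

lemma Gr.mono {B : H →L[ℂ] H} {σ τ : ℝ} (h : Gr B σ) (hst : σ ≤ τ) : Gr B τ := by
  obtain ⟨C, hC, h⟩ := h
  refine ⟨C, hC, fun t ht => (h t ht).trans ?_⟩
  gcongr

lemma Gr_exists (B : H →L[ℂ] H) : ∃ σ, Gr B σ := by
  refine ⟨‖B‖, ‖SG B 0‖, norm_nonneg _, fun t ht => ?_⟩
  have := norm_le_gronwallBound_of_norm_deriv_right_le (f := SG B) (f' := fun t => -(B * SG B t))
    (δ := ‖SG B 0‖) (K := ‖B‖) (ε := 0) (a := 0) (b := t) (SG_continuous B).continuousOn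
    (fun x _ => (SG_deriv B x).hasDerivWithinAt) le_rfl
    (fun x _ => by rw [norm_neg, add_zero]; exact norm_mul_le _ _) t ⟨ht, le_rfl⟩
  rwa [gronwallBound_ε0, sub_zero] at this

lemma one_le : ‖(1 : H →L[ℂ] H)‖ ≤ 1 := ContinuousLinearMap.norm_id_le

section laplace
variable {B : H →L[ℂ] H} {R : ℂ → H →L[ℂ] H} {M : ℝ}

lemma pow_exp_int (k : ℕ) {δ : ℝ} (hδ : 0 < δ) :
    IntegrableOn (fun t : ℝ => t ^ k * Real.exp (-δ * t)) (Ioi 0) := by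
  have := integrableOn_rpow_mul_exp_neg_mul_rpow (p := 1) (s := k) (b := δ)
    (by have : (0:ℝ) ≤ k := Nat.cast_nonneg k
        linarith) one_pos hδ
  simpa using this

lemma lap_bd {C σ : ℝ} (hC : 0 ≤ C) (h : ∀ t : ℝ, 0 ≤ t → ‖SG B t‖ ≤ C * Real.exp (σ * t))
    (l : ℂ) (k : ℕ) {t : ℝ} (ht : 0 ≤ t) :
    ‖((t : ℂ) ^ k * Complex.exp (-l * t)) • SG B t‖ ≤ C * (t ^ k * Real.exp (-(l.re - σ) * t)) := by
  rw [norm_smul, norm_mul, norm_pow, Complex.norm_real, Real.norm_of_nonneg ht, Complex.norm_exp]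
  have e : (-l * (t:ℂ)).re = - l.re * t := by simp
  rw [e]
  calc _ ≤ t ^ k * Real.exp (-l.re * t) * (C * Real.exp (σ * t)) := by
        gcongr; exact h t ht
    _ = C * (t ^ k * (Real.exp (-l.re * t) * Real.exp (σ * t))) := by ring
    _ = _ := by rw [← Real.exp_add]; congr 3; ring

lemma lap_int {σ : ℝ} (h : Gr B σ) {l : ℂ} (hl : σ < l.re) (k : ℕ) :
    IntegrableOn (fun t : ℝ => ((t : ℂ) ^ k * Complex.exp (-l * t)) • SG B t) (Ioi 0) := by
  obtain ⟨C, hC, h⟩ := h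
  refine Integrable.mono' ((pow_exp_int k (sub_pos.2 hl)).const_mul C) ?_ ?_
  · have := SG_continuous B
    exact Continuous.aestronglyMeasurable (by fun_prop)
  · filter_upwards [ae_restrict_mem measurableSet_Ioi] with t ht
    exact lap_bd hC h l k (le_of_lt ht)

lemma lap_tend {σ : ℝ} (h : Gr B σ) {l : ℂ} (hl : σ < l.re) (k : ℕ) :
    Filter.Tendsto (fun t : ℝ => ((t : ℂ) ^ k * Complex.exp (-l * t)) • SG B t) Filter.atTop (nhds 0) := by
  obtain ⟨C, hC, h⟩ := h
  have h0 := (tendsto_rpow_mul_exp_neg_mul_atTop_nhds_zero k (l.re - σ) (sub_pos.2 hl)).const_mul C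
  simp only [Real.rpow_natCast, mul_zero] at h0
  refine squeeze_zero_norm' ?_ h0
  filter_upwards [Filter.eventually_ge_atTop 0] with t ht
  exact lap_bd hC h l k ht

lemma e_deriv (l : ℂ) (k : ℕ) (t : ℝ) : HasDerivAt (fun t : ℝ => (t : ℂ) ^ k * Complex.exp (-l * t))
    ((k : ℂ) * (t : ℂ) ^ (k - 1) * Complex.exp (-l * t) - l * ((t : ℂ) ^ k * Complex.exp (-l * t))) t := by
  have h1 : HasDerivAt (fun z : ℂ => z ^ k * Complex.exp (-l * z))
    ((k : ℂ) * (t : ℂ) ^ (k - 1) * Complex.exp (-l * t) + (t : ℂ) ^ k * (Complex.exp (-l * t) * (-l * 1))) t :=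
    (hasDerivAt_pow k (t : ℂ)).mul (((hasDerivAt_id (t:ℂ)).const_mul (-l)).cexp)
  convert! h1.comp_ofReal using 1
  ring

/-- recursion for Laplace transforms -/
lemma lap_deriv (hS : Sec B R M) {l : ℂ} (hl0 : 0 ≤ l.re) (k : ℕ) (t : ℝ) :
    HasDerivAt (fun t : ℝ => -(R l * (((t : ℂ) ^ k * Complex.exp (-l * t)) • SG B t)))
      ((((t : ℂ) ^ k * Complex.exp (-l * t)) • SG B t) -
        (k : ℂ) • (R l * (((t : ℂ) ^ (k - 1) * Complex.exp (-l * t)) • SG B t))) t := by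
  have h := (((e_deriv l k t).smul (SG_deriv B t)).const_mul (R l)).neg
  convert! h using 1
  have hL := hS.left l hl0
  have e2 : R l * (B * SG B t) = SG B t - l • (R l * SG B t) := by
    have e3 : l • R l + R l * B = 1 := by
      rw [← hL, mul_add, mul_smul_comm, mul_one]
    rw [← mul_assoc, eq_sub_of_add_eq' e3, sub_mul, one_mul, smul_mul_assoc]
  simp only [mul_add, mul_smul_comm, mul_neg, e2]
  module

lemma lap_zero (hS : Sec B R M) {σ : ℝ} (h : Gr B σ) {l : ℂ} (hl : σ < l.re) (hl0 : 0 ≤ l.re) :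
    ∫ t : ℝ in Ioi 0, Complex.exp (-l * t) • SG B t = R l := by
  have h1 := integral_Ioi_of_hasDerivAt_of_tendsto (a := 0) (m := 0)
    (lap_deriv hS hl0 0 0).continuousAt.continuousWithinAt
    (fun t _ => lap_deriv hS hl0 0 t) (by simpa using lap_int h hl 0)
    (by simpa using ((lap_tend h hl 0).const_mul (R l)).neg)
  simpa [SG_zero] using h1

lemma lap_succ (hS : Sec B R M) {σ : ℝ} (h : Gr B σ) {l : ℂ} (hl : σ < l.re) (hl0 : 0 ≤ l.re) (k : ℕ) :
    ∫ t : ℝ in Ioi 0, ((t : ℂ) ^ (k + 1) * Complex.exp (-l * t)) • SG B t =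
      ((k + 1 : ℕ) : ℂ) • (R l * ∫ t : ℝ in Ioi 0, ((t : ℂ) ^ k * Complex.exp (-l * t)) • SG B t) := by
  have i1 := lap_int h hl (k + 1)
  have i2 : IntegrableOn (fun t : ℝ => ((k + 1 : ℕ) : ℂ) • (R l * (((t : ℂ) ^ k * Complex.exp (-l * t)) • SG B t))) (Ioi 0) :=
    Integrable.smul (((k + 1 : ℕ) : ℂ)) (Integrable.const_mul (lap_int h hl k) (R l))
  have h1 := integral_Ioi_of_hasDerivAt_of_tendsto (a := 0) (m := 0)
    (lap_deriv hS hl0 (k + 1) 0).continuousAt.continuousWithinAt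
    (fun t _ => lap_deriv hS hl0 (k + 1) t) (i1.sub i2)
    (by simpa using ((lap_tend h hl (k + 1)).const_mul (R l)).neg)
  simp only [Nat.add_sub_cancel] at h1
  rw [integral_sub i1 i2, integral_smul, integral_const_mul_of_integrable (lap_int h hl k)] at h1
  rw [sub_eq_iff_eq_add.1 h1]
  simp

lemma lap_three (hS : Sec B R M) {σ : ℝ} (h : Gr B σ) {l : ℂ} (hl : σ < l.re) (hl0 : 0 ≤ l.re) :
    ∫ t : ℝ in Ioi 0, ((t : ℂ) ^ 3 * Complex.exp (-l * t)) • SG B t = (6 : ℂ) • (R l) ^ 4 := by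
  have h0 := lap_zero hS h hl hl0
  rw [lap_succ hS h hl hl0 2, lap_succ hS h hl hl0 1, lap_succ hS h hl hl0 0]
  simp only [pow_zero, one_mul, h0]
  simp only [mul_smul_comm, smul_smul]
  have e : R l * (R l * (R l * R l)) = R l ^ 4 := by
    rw [pow_succ', pow_succ', pow_succ', pow_one]
  rw [e]
  norm_num

end laplace
end DS

namespace DS
set_option linter.unusedSectionVars false
open scoped ENNReal

variable {H : Type*} [NormedAddCommGroup H] [InnerProductSpace ℂ H] [CompleteSpace H]

section
variable {B : H →L[ℂ] H} {R : ℂ → H →L[ℂ] H} {M : ℝ}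

/-- points on the vertical line -/
def lam (σ ξ : ℝ) : ℂ := σ + 2 * Real.pi * ξ * Complex.I

lemma lam_re (σ ξ : ℝ) : (lam σ ξ).re = σ := by simp [lam]
lemma lam_im (σ ξ : ℝ) : (lam σ ξ).im = 2 * Real.pi * ξ := by simp [lam]

lemma lam_sq (σ ξ : ℝ) : σ ^ 2 + ξ ^ 2 ≤ ‖lam σ ξ‖ ^ 2 := by
  rw [← Complex.normSq_eq_norm_sq, Complex.normSq_apply, lam_re, lam_im]
  have : (1:ℝ) ≤ (2 * Real.pi) ^ 2 := by nlinarith [Real.pi_gt_three]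
  nlinarith [sq_nonneg ξ]

lemma lam_abs (σ ξ : ℝ) : |ξ| ≤ ‖lam σ ξ‖ := by
  refine abs_le_of_sq_le_sq (a := ξ) ?_ (norm_nonneg _) |> fun h => h
  nlinarith [lam_sq σ ξ, sq_nonneg σ]

open scoped FourierTransform in
lemma inv3 (hS : Sec B R M) {σ₀ σ : ℝ} (h : Gr B σ₀) (hσ : σ₀ < σ) (hσ0 : 0 ≤ σ)
    (L : H →L[ℂ] H) {φ : ℝ → ℝ} (hφ : Integrable φ)
    (hL : ∀ ξ, ‖L * R (lam σ ξ) ^ 4‖ ≤ φ ξ) {t : ℝ} (ht : 0 < t) :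
    t ^ 3 * Real.exp (-σ * t) * ‖L * SG B t‖ ≤ 6 * ∫ ξ, φ ξ := by
  have hM := hS.nonneg
  let f : ℝ → H →L[ℂ] H := fun t => (((max t 0 : ℝ) : ℂ) ^ 3 * Complex.exp (-(σ : ℂ) * t)) • SG B t
  have hSc := SG_continuous B
  have hfc : Continuous f := by fun_prop
  have hf1 : f = (Ioi 0).indicator fun t : ℝ => ((t : ℂ) ^ 3 * Complex.exp (-(σ : ℂ) * t)) • SG B t := by
    ext1 t
    by_cases h : 0 < t
    · simp [f, indicator, h, max_eq_left h.le]
    · simp [f, indicator, h, max_eq_right (not_lt.1 h)]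
  have hfi : Integrable f := by
    rw [hf1, integrable_indicator_iff measurableSet_Ioi]
    exact lap_int h (by simpa using hσ) 3
  have hFf : ∀ ξ, 𝓕 f ξ = (6 : ℂ) • R (lam σ ξ) ^ 4 := by
    intro ξ
    rw [← lap_three hS h (by rwa [lam_re]) (by rwa [lam_re]), Real.fourier_eq', ← integral_indicator measurableSet_Ioi]
    congr 1; ext1 v
    rw [hf1]
    by_cases h : 0 < v
    · simp only [indicator, mem_Ioi, h, if_true, smul_smul]
      congr 1
      rw [mul_left_comm, ← Complex.exp_add]
      congr 2
      simp [lam]; ring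
    · simp [indicator, h]
  have hint : Integrable (𝓕 f) := by
    have h1 := (integrable_one_add_norm (E := ℝ) (μ := volume) (r := 2) (by simp)).const_mul (6 * M ^ 4)
    refine h1.mono' ?_ (Filter.Eventually.of_forall fun ξ => ?_)
    · exact (VectorFourier.fourierIntegral_continuous Real.continuous_fourierChar
        (L := innerₗ ℝ) continuous_inner hfi).aestronglyMeasurable
    · rw [hFf, norm_smul]
      have hb := hS.bd (lam σ ξ) (by rwa [lam_re])
      have ha := lam_abs σ ξ
      have e1 : ‖R (lam σ ξ) ^ 4‖ ≤ ‖R (lam σ ξ)‖ ^ 4 := norm_pow_le' _ (by norm_num)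
      have e2 : ‖R (lam σ ξ)‖ * (1 + |ξ|) ≤ M := le_trans (by gcongr) hb
      have e3 : ‖R (lam σ ξ)‖ ≤ M * (1 + |ξ|)⁻¹ := by
        rw [← div_eq_mul_inv, le_div_iff₀ (by positivity)]; exact e2
      have e4 : (1 + |ξ|)⁻¹ ≤ 1 := inv_le_one_of_one_le₀ (by linarith [abs_nonneg ξ])
      have e5 : (1 + ‖ξ‖) ^ (-2 : ℝ) = (1 + |ξ|)⁻¹ ^ 2 := by
        rw [Real.rpow_neg (by positivity), Real.norm_eq_abs, inv_pow]; norm_cast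
      rw [e5, mul_assoc, show ‖(6:ℂ)‖ = 6 by norm_num]
      gcongr
      calc _ ≤ (M * (1 + |ξ|)⁻¹) ^ 4 := e1.trans (by gcongr)
        _ = M ^ 4 * ((1 + |ξ|)⁻¹ ^ 2 * (1 + |ξ|)⁻¹ ^ 2) := by ring
        _ ≤ M ^ 4 * ((1 + |ξ|)⁻¹ ^ 2 * 1) := by
          gcongr
          exact pow_le_one₀ (by positivity) e4
        _ = _ := by ring
  have hinv := congrFun (hfc.fourierInv_fourier_eq hfi hint) t
  rw [Real.fourierInv_eq'] at hinv
  have hint2 : Integrable fun v : ℝ => Complex.exp (↑(2 * Real.pi * inner ℝ v t) * Complex.I) • 𝓕 f v := by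
    refine hint.norm.mono' ?_ (Filter.Eventually.of_forall fun v => ?_)
    · have hcc : Continuous fun v : ℝ => Complex.exp (↑(2 * Real.pi * inner ℝ v t) * Complex.I) := by fun_prop
      exact hcc.aestronglyMeasurable.smul hint.aestronglyMeasurable
    · rw [norm_smul, Complex.norm_exp_ofReal_mul_I, one_mul]
  have e1 : L * f t = ∫ v : ℝ, L * (Complex.exp (↑(2 * Real.pi * inner ℝ v t) * Complex.I) • 𝓕 f v) := by
    rw [integral_const_mul_of_integrable hint2, hinv]
  have e2 : ‖L * f t‖ = t ^ 3 * Real.exp (-σ * t) * ‖L * SG B t‖ := by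
    simp only [f, max_eq_left ht.le]
    rw [mul_smul_comm, norm_smul, norm_mul, norm_pow, Complex.norm_real, Real.norm_of_nonneg ht.le,
      Complex.norm_exp]
    simp
  rw [← e2, e1, ← integral_const_mul]
  refine norm_integral_le_of_norm_le (hφ.const_mul 6) (Filter.Eventually.of_forall fun v => ?_)
  rw [mul_smul_comm, norm_smul, Complex.norm_exp_ofReal_mul_I, one_mul, hFf, mul_smul_comm, norm_smul,
    show ‖(6:ℂ)‖ = 6 by norm_num]
  gcongr
  exact hL v

lemma Gr_step {τ t₀ : ℝ} (ht₀ : 0 < t₀) (h : ‖SG B t₀‖ ≤ Real.exp (τ * t₀)) : Gr B τ := by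
  obtain ⟨C₁, hC₁⟩ := (isCompact_Icc (a := (0:ℝ)) (b := t₀)).exists_bound_of_continuousOn
    (SG_continuous B).continuousOn
  have hC0 : 0 ≤ C₁ := (norm_nonneg _).trans (hC₁ 0 ⟨le_rfl, ht₀.le⟩)
  have hn : ∀ n : ℕ, ∀ s ∈ Icc 0 t₀, ‖SG B (n * t₀ + s)‖ ≤ Real.exp (τ * (n * t₀)) * C₁ := by
    intro n s hs
    induction n with
    | zero => simpa using hC₁ s hs
    | succ n ih =>
      have e : ((n + 1 : ℕ) : ℝ) * t₀ + s = t₀ + (n * t₀ + s) := by push_cast; ring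
      rw [e, SG_add]
      refine (norm_mul_le _ _).trans ?_
      calc _ ≤ Real.exp (τ * t₀) * (Real.exp (τ * (n * t₀)) * C₁) := by gcongr
        _ = _ := by rw [← mul_assoc, ← Real.exp_add]; congr 2; push_cast; ring
  refine ⟨Real.exp (|τ| * t₀) * C₁, by positivity, fun t ht => ?_⟩
  set n := ⌊t / t₀⌋₊
  have h1 : (n : ℝ) * t₀ ≤ t := by
    rw [← le_div_iff₀ ht₀]; exact Nat.floor_le (by positivity)
  have h2 : t < (n + 1 : ℝ) * t₀ := by
    rw [← div_lt_iff₀ ht₀]; exact Nat.lt_floor_add_one _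
  have hs : t - n * t₀ ∈ Icc 0 t₀ := ⟨by linarith, by linarith⟩
  have := hn n _ hs
  rw [add_sub_cancel] at this
  refine this.trans ?_
  rw [mul_right_comm, ← Real.exp_add]
  gcongr
  have h3 : -|τ| ≤ τ := neg_abs_le τ
  have h4 : -(|τ| * t₀) ≤ τ * (t - n * t₀) := by
    calc -(|τ| * t₀) ≤ -(|τ| * (t - n * t₀)) := by
          gcongr; exact hs.2
      _ = -|τ| * (t - n * t₀) := by ring
      _ ≤ _ := by gcongr
  linarith

lemma Gr_neg (hS : Sec B R M) : ∃ σ < 0, Gr B σ := by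
  have hM := hS.nonneg
  have hφ := (integrable_one_add_norm (E := ℝ) (μ := volume) (r := 2) (by simp)).const_mul (M ^ 4)
  set c := 6 * ∫ ξ : ℝ, M ^ 4 * (1 + ‖ξ‖) ^ (-2 : ℝ) with hc
  have hc0 : 0 ≤ c := by
    refine mul_nonneg (by norm_num) (integral_nonneg fun ξ => ?_)
    change 0 ≤ M ^ 4 * (1 + ‖ξ‖) ^ (-2 : ℝ)
    positivity
  have key : ∀ σ₀, 0 ≤ σ₀ → Gr B σ₀ → ∀ σ, σ₀ < σ → ∀ t : ℝ, 0 < t → t ^ 3 * Real.exp (-σ * t) * ‖SG B t‖ ≤ c := by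
    intro σ₀ h0 h σ hσ t ht
    have := inv3 hS h hσ (h0.trans hσ.le) 1 hφ (fun ξ => ?_) ht
    · rw [one_mul] at this; exact this
    · rw [one_mul]
      have hb := hS.bd (lam σ ξ) (by rw [lam_re]; linarith)
      have ha := lam_abs σ ξ
      have e1 : ‖R (lam σ ξ) ^ 4‖ ≤ ‖R (lam σ ξ)‖ ^ 4 := norm_pow_le' _ (by norm_num)
      have e2 : ‖R (lam σ ξ)‖ * (1 + |ξ|) ≤ M := le_trans (by gcongr) hb
      have e3 : ‖R (lam σ ξ)‖ ≤ M * (1 + |ξ|)⁻¹ := by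
        rw [← div_eq_mul_inv, le_div_iff₀ (by positivity)]; exact e2
      have e4 : (1 + |ξ|)⁻¹ ≤ 1 := inv_le_one_of_one_le₀ (by linarith [abs_nonneg ξ])
      have e5 : (1 + ‖ξ‖) ^ (-2 : ℝ) = (1 + |ξ|)⁻¹ ^ 2 := by
        rw [Real.rpow_neg (by positivity), Real.norm_eq_abs, inv_pow]; norm_cast
      rw [e5]
      calc _ ≤ (M * (1 + |ξ|)⁻¹) ^ 4 := e1.trans (by gcongr)
        _ = M ^ 4 * ((1 + |ξ|)⁻¹ ^ 2 * (1 + |ξ|)⁻¹ ^ 2) := by ring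
        _ ≤ M ^ 4 * ((1 + |ξ|)⁻¹ ^ 2 * 1) := by
          gcongr
          exact pow_le_one₀ (by positivity) e4
        _ = _ := by ring
  set t₀ := c * Real.exp 2 + 1 with ht₀
  have ht1 : 1 ≤ t₀ := by have : 0 ≤ c * Real.exp 2 := by positivity
                          linarith
  have ht0 : 0 < t₀ := by linarith
  have step : ∀ σ₀, 0 ≤ σ₀ → Gr B σ₀ → Gr B (σ₀ - 1 / t₀) := by
    intro σ₀ h0 h
    apply Gr_step ht0
    have h1 := key σ₀ h0 h (σ₀ + 1 / t₀) (by have : 0 < 1 / t₀ := by positivity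
                                             linarith) t₀ ht0
    have e1 : (σ₀ - 1 / t₀) * t₀ = σ₀ * t₀ - 1 := by field_simp
    have e2 : -(σ₀ + 1 / t₀) * t₀ = -(σ₀ * t₀ - 1) - 2 := by field_simp; ring
    rw [e1]
    rw [e2, Real.exp_sub, Real.exp_neg] at h1
    set X := Real.exp (σ₀ * t₀ - 1) with hX
    have hXp : 0 < X := Real.exp_pos _
    have he : 0 < Real.exp 2 := Real.exp_pos _
    have h2 : t₀ ^ 3 * ‖SG B t₀‖ ≤ c * Real.exp 2 * X := by
      have : t₀ ^ 3 * (X⁻¹ / Real.exp 2) * ‖SG B t₀‖ = t₀ ^ 3 * ‖SG B t₀‖ / (Real.exp 2 * X) := by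
        field_simp
      rw [this, div_le_iff₀ (by positivity)] at h1
      linarith
    have h3 : t₀ ≤ t₀ ^ 3 := by
      have : t₀ ^ 1 ≤ t₀ ^ 3 := pow_le_pow_right₀ ht1 (by norm_num)
      simpa using this
    have h4 : t₀ * ‖SG B t₀‖ ≤ t₀ * X := by
      calc _ ≤ t₀ ^ 3 * ‖SG B t₀‖ := by gcongr
        _ ≤ _ := h2
        _ ≤ t₀ * X := by gcongr; linarith
    exact le_of_mul_le_mul_left h4 ht0
  by_contra! hcon
  obtain ⟨σ₁, hσ₁⟩ := Gr_exists B
  have all : ∀ k : ℕ, Gr B (σ₁ - k / t₀) := by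
    intro k
    induction k with
    | zero => simpa using hσ₁
    | succ k ih =>
      have h0 : 0 ≤ σ₁ - k / t₀ := by
        by_contra! hlt
        exact hcon _ hlt ih
      have := step _ h0 ih
      convert! this using 1
      push_cast; ring
  obtain ⟨k, hk⟩ := exists_nat_gt (σ₁ * t₀)
  refine hcon _ ?_ (all k)
  rw [sub_neg, lt_div_iff₀ ht0]; exact hk

lemma BR_bd (hS : Sec B R M) {l : ℂ} (hl : 0 ≤ l.re) : ‖B * R l‖ ≤ 1 + M := by
  have e : B * R l = 1 - l • R l := by
    have := hS.right l hl
    rw [← this, add_mul, smul_mul_assoc, one_mul]; abel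
  rw [e]
  refine (norm_sub_le _ _).trans (add_le_add one_le ?_)
  rw [norm_smul]
  have := hS.bd l hl
  nlinarith [norm_nonneg (R l)]

lemma R_comm (hS : Sec B R M) {l : ℂ} (hl : 0 ≤ l.re) : B * R l = R l * B := by
  have h3 := (hS.right l hl).trans (hS.left l hl).symm
  rw [add_mul, mul_add, smul_mul_assoc, mul_smul_comm, one_mul, mul_one] at h3
  exact add_left_cancel h3

lemma smoothing (hS : Sec B R M) {t : ℝ} (ht : 0 < t) :
    ‖B * (B * SG B t)‖ ≤ 6 * Real.pi * Real.exp 1 * (1 + M) ^ 2 * M ^ 2 / t ^ 2 := by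
  have hM := hS.nonneg
  obtain ⟨σ₀, hσ₀, hG⟩ := Gr_neg hS
  let φ : ℝ → ℝ := fun ξ => ((1 + M) ^ 2 * M ^ 2 * t ^ 2) * (1 + (t * ξ) ^ 2)⁻¹
  have hφ : Integrable φ := ((integrable_inv_one_add_sq).comp_mul_left' ht.ne').const_mul _
  have hφ2 : ∫ ξ, φ ξ = (1 + M) ^ 2 * M ^ 2 * t * Real.pi := by
    simp only [φ]
    rw [integral_const_mul, Measure.integral_comp_mul_left (fun x : ℝ => (1 + x ^ 2)⁻¹) t,
      integral_univ_inv_one_add_sq, abs_of_pos (by positivity), smul_eq_mul]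
    field_simp
  have hσ : (0:ℝ) < 1 / t := by positivity
  have := inv3 hS hG (hσ₀.trans hσ) hσ.le (B * B) hφ (fun ξ => ?_) ht
  · rw [hφ2, show -(1 / t) * t = -1 by field_simp, Real.exp_neg, mul_assoc B B] at this
    rw [le_div_iff₀ (by positivity)]
    have he : 0 < Real.exp 1 := Real.exp_pos _
    have h1 : t ^ 3 * (Real.exp 1)⁻¹ * ‖B * (B * SG B t)‖ = t / Real.exp 1 * (‖B * (B * SG B t)‖ * t ^ 2) := by
      field_simp
    have h2 : 6 * ((1 + M) ^ 2 * M ^ 2 * t * Real.pi) = t / Real.exp 1 *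
        (6 * Real.pi * Real.exp 1 * (1 + M) ^ 2 * M ^ 2) := by field_simp
    rw [h1, h2] at this
    exact le_of_mul_le_mul_left this (by positivity)
  · have hre : 0 ≤ (lam (1/t) ξ).re := by rw [lam_re]; exact hσ.le
    set l := lam (1/t) ξ with hl
    have hc := R_comm hS hre
    have e : B * B * R l ^ 4 = (B * R l) * (B * R l) * (R l * R l) := by
      have : R l ^ 4 = R l * R l * (R l * R l) := by
        rw [pow_succ', pow_succ', pow_succ', pow_one]; simp only [mul_assoc]
      rw [this]
      simp only [mul_assoc]
      congr 1
      rw [← mul_assoc B, hc, mul_assoc]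
    rw [e]
    have hb := BR_bd hS hre
    have hR := hS.bd l hre
    have hsq := lam_sq (1/t) ξ
    rw [← hl] at hsq
    have hR2 : ‖R l‖ * ‖R l‖ ≤ M ^ 2 * (t ^ 2 * (1 + (t * ξ) ^ 2)⁻¹) := by
      have h1 : ‖R l‖ * ‖l‖ ≤ M := by nlinarith [norm_nonneg (R l)]
      have h2 : ‖R l‖ ^ 2 * ‖l‖ ^ 2 ≤ M ^ 2 := by
        rw [← mul_pow]; gcongr
      have h3 : (1/t) ^ 2 + ξ ^ 2 = (t ^ 2 * (1 + (t * ξ) ^ 2)⁻¹)⁻¹ := by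
        field_simp
      rw [← div_le_iff₀ (by positivity), div_eq_mul_inv, ← h3, ← sq]
      exact le_trans (by gcongr) h2
    calc _ ≤ ‖B * R l‖ * ‖B * R l‖ * (‖R l‖ * ‖R l‖) := by
          refine (norm_mul_le _ _).trans ?_
          gcongr <;> exact norm_mul_le _ _
      _ ≤ (1 + M) * (1 + M) * (M ^ 2 * (t ^ 2 * (1 + (t * ξ) ^ 2)⁻¹)) := by
          gcongr
      _ = _ := by simp only [φ]; ring

end
end DS

namespace DS
set_option linter.unusedSectionVars false
open scoped ENNReal

variable {H : Type*} [NormedAddCommGroup H] [InnerProductSpace ℂ H] [CompleteSpace H]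

section
variable {B : H →L[ℂ] H} {R : ℂ → H →L[ℂ] H} {M : ℝ}

/-- kernel -/
def KB (B : H →L[ℂ] H) : ℝ → H →L[ℂ] H := (Ioi 0).indicator fun t => B * SG B t

/-- constant -/
def CM (M : ℝ) : ℝ := 1 + M + 4 * (6 * Real.pi * Real.exp 1 * (1 + M) ^ 2 * M ^ 2)

open scoped FourierTransform in
lemma KB_czk (hS : Sec B R M) : CZK (KB B) (CM M) := by
  have hM := hS.nonneg
  obtain ⟨σ₀, hσ₀, hG⟩ := Gr_neg hS
  have hc2 : 0 ≤ 4 * (6 * Real.pi * Real.exp 1 * (1 + M) ^ 2 * M ^ 2) := by positivity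
  have hSc := SG_continuous B
  have hBS : Continuous fun t => B * SG B t := by fun_prop
  have hSGi : IntegrableOn (fun t => SG B t) (Ioi 0) := by
    have := lap_int hG (l := 0) (by simpa using hσ₀) 0
    simpa using this
  refine ⟨by unfold CM; linarith, ?_, ?_, ?_, ?_, ?_⟩
  · exact hBS.stronglyMeasurable.indicator measurableSet_Ioi
  · rw [KB, integrable_indicator_iff measurableSet_Ioi]
    exact hSGi.const_mul B
  · obtain ⟨C, hC, hb⟩ := hG
    refine ⟨‖B‖ * C, fun t => ?_⟩
    by_cases h : 0 < t
    · simp only [KB, indicator, mem_Ioi, h, if_true]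
      refine (norm_mul_le _ _).trans ?_
      gcongr
      refine (hb t h.le).trans ?_
      have : Real.exp (σ₀ * t) ≤ 1 := Real.exp_le_one_iff.2 (by nlinarith)
      nlinarith
    · simp only [KB, indicator, mem_Ioi, h, if_false, norm_zero]; positivity
  · intro ξ
    have hl : σ₀ < (lam 0 ξ).re := by rwa [lam_re]
    have h0 : 0 ≤ (lam 0 ξ).re := by rw [lam_re]
    have : 𝓕 (KB B) ξ = B * R (lam 0 ξ) := by
      have hi := lap_int hG hl 0
      rw [← lap_zero hS hG hl h0, ← integral_const_mul_of_integrable (by simpa [IntegrableOn] using hi), Real.fourier_eq',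
        ← integral_indicator measurableSet_Ioi]
      congr 1; ext1 v
      by_cases h : 0 < v
      · simp only [KB, indicator, mem_Ioi, h, if_true, mul_smul_comm]
        congr 2
        simp [lam]; ring
      · simp [KB, indicator, h]
    rw [this]
    refine (BR_bd hS h0).trans ?_
    unfold CM; linarith
  · intro a b hab
    rcases lt_trichotomy b 0 with hb | hb | hb
    · have ha : ¬ 0 < a := by
        rw [abs_of_neg hb] at hab
        have := le_abs_self (a - b)
        linarith
      have : 0 ≤ CM M := by unfold CM; linarith
      simp only [KB, indicator, mem_Ioi, ha, not_lt.2 hb.le, if_false, sub_zero, norm_zero]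
      positivity
    · subst hb
      have : a = 0 := by
        have := abs_nonneg a
        simp at hab
        exact abs_eq_zero.1 (by linarith)
      simp [this]
    · rw [abs_of_pos hb] at hab
      have ha : b / 2 ≤ a := by
        have := neg_abs_le (a - b)
        linarith
      have ha' : 0 < a := by linarith
      simp only [KB, indicator, mem_Ioi, ha', hb, if_true]
      have := (convex_Ici (b/2)).norm_image_sub_le_of_norm_hasDerivWithin_le
        (f := fun t => B * SG B t) (f' := fun t => B * (-(B * SG B t)))
        (C := 4 * (6 * Real.pi * Real.exp 1 * (1 + M) ^ 2 * M ^ 2) / b ^ 2) (x := b) (y := a)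
        (fun x _ => ((SG_deriv B x).const_mul B).hasDerivWithinAt) (fun x hx => ?_) (by simp; linarith) ha
      · refine this.trans ?_
        rw [Real.norm_eq_abs, div_mul_eq_mul_div]
        gcongr
        unfold CM; linarith
      · rw [mul_neg, norm_neg]
        have hx' : b / 2 ≤ x := hx
        refine (smoothing hS (by linarith)).trans ?_
        have h3 : (b/2)^2 ≤ x ^ 2 := by gcongr
        calc _ ≤ 6 * Real.pi * Real.exp 1 * (1 + M) ^ 2 * M ^ 2 / (b/2)^2 := by gcongr
          _ = _ := by field_simp; norm_num
end
end DS

namespace DS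
set_option linter.unusedSectionVars false
open scoped ENNReal

variable {H : Type*} [NormedAddCommGroup H] [InnerProductSpace ℂ H] [CompleteSpace H]

lemma ibp {Φ Φ' : ℝ → H →L[ℂ] H} (hd : ∀ s, HasDerivAt Φ (Φ' s) s) (hc : Continuous Φ') {t : ℝ}
    (ht : 0 ≤ t) {g : ℝ → H} (hg : IntegrableOn g (Ioc 0 t)) :
    ∫ s in 0..t, Φ' s (∫ r in 0..s, g r) = ∫ r in 0..t, (Φ t - Φ r) (g r) := by
  set μ := volume.restrict (Ioc 0 t) with hμ
  let F : ℝ → ℝ → H := fun s r => ({q : ℝ × ℝ | q.2 ≤ q.1}).indicator (fun q => Φ' q.1 (g q.2)) (s, r)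
  have hmS : MeasurableSet {q : ℝ × ℝ | q.2 ≤ q.1} := measurableSet_le measurable_snd measurable_fst
  obtain ⟨C, hC⟩ := (isCompact_Icc (a := (0:ℝ)) (b := t)).exists_bound_of_continuousOn
    hc.continuousOn
  have hFi : Integrable (Function.uncurry F) (μ.prod μ) := by
    have e : Function.uncurry F = ({q : ℝ × ℝ | q.2 ≤ q.1}).indicator (fun q => Φ' q.1 (g q.2)) := by
      ext1 ⟨s, r⟩; rfl
    rw [e]
    refine Integrable.indicator ?_ hmS
    have hgi : Integrable (fun q : ℝ × ℝ => C * ‖g q.2‖) (μ.prod μ) :=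
      ((Integrable.comp_snd hg.norm μ).const_mul C)
    refine hgi.mono' ?_ ?_
    · have h1 : AEStronglyMeasurable (fun q : ℝ × ℝ => g q.2) (μ.prod μ) := hg.aestronglyMeasurable.comp_snd
      have h2 : AEStronglyMeasurable (fun q : ℝ × ℝ => Φ' q.1) (μ.prod μ) :=
        (hc.comp continuous_fst).aestronglyMeasurable
      exact aesm_apply h2 h1
    · have : ∀ᵐ s ∂μ, s ∈ Ioc 0 t := ae_restrict_mem measurableSet_Ioc
      have h3 : ∀ᵐ q ∂(μ.prod μ), q.1 ∈ Ioc 0 t := Measure.quasiMeasurePreserving_fst.ae this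
      filter_upwards [h3] with q hq
      refine ((Φ' q.1).le_opNorm _).trans ?_
      gcongr
      exact hC _ ⟨hq.1.le, hq.2⟩
  have hsw := integral_integral_swap hFi
  rw [intervalIntegral.integral_of_le ht, intervalIntegral.integral_of_le ht]
  have e1 : ∀ s ∈ Ioc 0 t, ∫ r, F s r ∂μ = Φ' s (∫ r in 0..s, g r) := by
    intro s hs
    have : (fun r => F s r) = (Iic s).indicator (fun r => Φ' s (g r)) := by
      ext1 r; simp [F, indicator]
    rw [this, integral_indicator measurableSet_Iic, hμ, Measure.restrict_restrict measurableSet_Iic,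
      intervalIntegral.integral_of_le hs.1.le]
    have e : Iic s ∩ Ioc 0 t = Ioc 0 s := by
      ext x; simp only [mem_inter_iff, mem_Iic, mem_Ioc]
      constructor
      · rintro ⟨a, b, c⟩; exact ⟨b, a⟩
      · rintro ⟨a, b⟩; exact ⟨b, a, b.trans hs.2⟩
    rw [e, ContinuousLinearMap.integral_comp_comm]
    exact hg.mono_set (Ioc_subset_Ioc_right hs.2)
  have e2 : ∀ r ∈ Ioc 0 t, ∫ s, F s r ∂μ = (Φ t - Φ r) (g r) := by
    intro r hr
    have : (fun s => F s r) = (Ici r).indicator (fun s => Φ' s (g r)) := by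
      ext1 s; simp [F, indicator]
    rw [this, integral_indicator measurableSet_Ici, hμ, Measure.restrict_restrict measurableSet_Ici]
    have e : Ici r ∩ Ioc 0 t = Icc r t := by
      ext x; simp only [mem_inter_iff, mem_Ici, mem_Icc, mem_Ioc]
      constructor
      · rintro ⟨a, b, c⟩; exact ⟨a, c⟩
      · rintro ⟨a, b⟩; exact ⟨a, hr.1.trans_le a, b⟩
    rw [e, integral_Icc_eq_integral_Ioc, ← intervalIntegral.integral_of_le hr.2]
    have hd2 : ∀ s ∈ uIcc r t, HasDerivAt (fun s => Φ s (g r)) (Φ' s (g r)) s := fun s _ => by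
      have := ((ContinuousLinearMap.apply ℂ H (g r)).restrictScalars ℝ).hasFDerivAt.comp_hasDerivAt s (hd s)
      simpa using! this
    rw [intervalIntegral.integral_eq_sub_of_hasDerivAt hd2 ((hc.clm_apply continuous_const).intervalIntegrable _ _)]
    simp
  calc _ = ∫ s, ∫ r, F s r ∂μ ∂μ := by
        refine setIntegral_congr_fun measurableSet_Ioc fun s hs => (e1 s hs).symm
    _ = _ := hsw
    _ = _ := setIntegral_congr_fun measurableSet_Ioc e2

section
variable {B G : H →L[ℂ] H} {R : ℂ → H →L[ℂ] H} {M : ℝ}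

/-- convolution solution -/
def TT (B : H →L[ℂ] H) (f : ℝ → H) (t : ℝ) : H := B (SG B t (∫ s in 0..t, SG B (-s) (f s)))

lemma SG_neg (t : ℝ) : SG B t * SG B (-t) = 1 := by rw [← SG_add, add_neg_cancel, SG_zero]

lemma SGf_int {f : ℝ → H} (hf : ∀ t, IntegrableOn f (Ioc 0 t)) (t : ℝ) :
    IntegrableOn (fun s => SG B (-s) (f s)) (Ioc 0 t) := by
  have hc : Continuous fun s => SG B (-s) := (SG_continuous B).comp continuous_neg
  obtain ⟨C, hC⟩ := (isCompact_Icc (a := (0:ℝ)) (b := t)).exists_bound_of_continuousOn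
    hc.continuousOn
  refine ((hf t).norm.const_mul C).mono' (aesm_apply hc.aestronglyMeasurable (hf t).aestronglyMeasurable) ?_
  filter_upwards [ae_restrict_mem measurableSet_Ioc] with s hs
  refine ((SG B (-s)).le_opNorm _).trans ?_
  gcongr
  exact hC _ ⟨hs.1.le, hs.2⟩

lemma prim_cont {f : ℝ → H} (hf : ∀ t, IntegrableOn f (Ioc 0 t)) :
    ContinuousOn (fun t => ∫ s in 0..t, f s) (Ici 0) := by
  intro t ht
  have ht' : 0 ≤ t := ht
  have h : ContinuousOn (fun x => ∫ s in 0..x, f s) (Icc 0 (t+1)) := by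
    have h0 := intervalIntegral.continuousOn_primitive_interval (a := 0) (b := t + 1) (μ := volume) (f := f)
    rw [uIcc_of_le (by linarith), integrableOn_Icc_iff_integrableOn_Ioc] at h0
    exact h0 (hf _)
  refine (h t ⟨ht, by linarith⟩).mono_of_mem_nhdsWithin ?_
  refine mem_nhdsWithin.2 ⟨Iio (t+1), isOpen_Iio, by simp, ?_⟩
  rintro x ⟨h1, h2⟩
  exact ⟨h2, h1.le⟩

lemma TT_cont {f : ℝ → H} (hf : ∀ t, IntegrableOn f (Ioc 0 t)) : ContinuousOn (TT B f) (Ici 0) := by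
  have h1 := prim_cont (SGf_int (B := B) hf)
  have h2 := (SG_continuous B).continuousOn (s := Ici 0)
  exact B.continuous.comp_continuousOn (h2.clm_apply h1)

lemma cont_int {w : ℝ → H} (h : ContinuousOn w (Ici 0)) (t : ℝ) : IntegrableOn w (Ioc 0 t) := by
  refine (ContinuousOn.integrableOn_Icc (h.mono ?_)).mono_set Ioc_subset_Icc_self
  exact Icc_subset_Ici_self

lemma TT_eq (hGB : G * B = 1) {f : ℝ → H} (hf : ∀ t, IntegrableOn f (Ioc 0 t)) {t : ℝ} (ht : 0 ≤ t) :
    G (TT B f t) = ∫ s in 0..t, (f s - TT B f s) := by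
  have hi := SGf_int (B := B) hf
  have h1 := ibp (Φ := fun s => -SG B s) (Φ' := fun s => B * SG B s)
    (fun s => by simpa using! (SG_deriv B s).neg) (continuous_const.mul (SG_continuous B)) ht (hi t)
  have e0 : ∀ x, G (B x) = x := fun x => by
    have := congrArg (fun L : H →L[ℂ] H => L x) hGB; simpa using this
  have e1 : ∀ s, SG B s (SG B (-s) (f s)) = f s := fun s => by
    have := congrArg (fun L : H →L[ℂ] H => L (f s)) (SG_neg (B := B) s); simpa using this
  have h2 : ∫ s in 0..t, TT B f s = ∫ s in 0..t, (B * SG B s) (∫ r in 0..s, SG B (-r) (f r)) := rfl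
  have hfi : IntervalIntegrable f volume 0 t := (intervalIntegrable_iff_integrableOn_Ioc_of_le ht).2 (hf t)
  have hi2 : IntervalIntegrable (fun s => SG B (-s) (f s)) volume 0 t :=
    (intervalIntegrable_iff_integrableOn_Ioc_of_le ht).2 (hi t)
  rw [intervalIntegral.integral_sub hfi
    ((intervalIntegrable_iff_integrableOn_Ioc_of_le ht).2 (cont_int (TT_cont hf) t)), h2, h1]
  have h3 : ∀ r, (-SG B t - -SG B r) (SG B (-r) (f r)) = f r - SG B t (SG B (-r) (f r)) := by
    intro r
    simp only [sub_apply, neg_apply, e1]; abel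
  simp only [h3]
  rw [intervalIntegral.integral_sub hfi, ContinuousLinearMap.intervalIntegral_comp_comm _ hi2, TT, e0]
  · abel
  · exact ⟨(SG B t).integrable_comp hi2.1, (SG B t).integrable_comp hi2.2⟩

/-- uniqueness -/
lemma TT_uniq (hGB : G * B = 1) (hBG : B * G = 1) {d : ℝ → H} (hd : ∀ t, IntegrableOn d (Ioc 0 t))
    (h : ∀ᵐ t ∂(volume.restrict (Ioi 0)), G (d t) = - ∫ s in 0..t, d s) :
    ∀ᵐ t ∂(volume.restrict (Ioi 0)), d t = 0 := by
  have e0 : ∀ x, B (G x) = x := fun x => by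
    have := congrArg (fun L : H →L[ℂ] H => L x) hBG; simpa using this
  let y : ℝ → H := fun t => ∫ s in 0..t, d s
  have hy : ContinuousOn y (Ici 0) := prim_cont hd
  have hdy : ∀ᵐ t ∂(volume.restrict (Ioi 0)), d t = -B (y t) := by
    filter_upwards [h] with t ht
    rw [← e0 (d t), ht, map_neg]
  have hBy : ContinuousOn (fun t => -B (y t)) (Ici 0) := (B.continuous.comp_continuousOn hy).neg
  have hy2 : ∀ t, 0 ≤ t → y t = ∫ s in 0..t, -B (y s) := by
    intro t ht
    simp only [y]
    rw [intervalIntegral.integral_of_le ht, intervalIntegral.integral_of_le ht]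
    apply integral_congr_ae
    exact ae_restrict_of_ae_restrict_of_subset (Ioc_subset_Ioi_self) hdy
  have hy0 : ∀ t, 0 ≤ t → y t = 0 := by
    intro t ht
    have hder : ∀ s ∈ Ico 0 t, HasDerivWithinAt y (-B (y s)) (Ici s) s := by
      intro s hs
      have hcw : ContinuousWithinAt (fun t => -B (y t)) (Ioi s) s :=
        (hBy s hs.1).mono fun x hx => hs.1.trans (le_of_lt hx)
      have h1 : HasDerivWithinAt (fun u => ∫ x in 0..u, -B (y x)) (-B (y s)) (Ici s) s := by
        refine intervalIntegral.integral_hasDerivWithinAt_right ?_ (t := Ioi s) ?_ hcw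
        · exact (intervalIntegrable_iff_integrableOn_Ioc_of_le hs.1).2 (cont_int hBy s)
        · refine ⟨Ioi s, self_mem_nhdsWithin, ?_⟩
          exact (hBy.mono fun x hx => hs.1.trans (le_of_lt hx)).aestronglyMeasurable measurableSet_Ioi
      exact h1.congr (fun x hx => hy2 x (hs.1.trans hx)) (hy2 s hs.1)
    have := ODE_solution_unique_of_mem_Icc_right (v := fun _ x => -B x) (s := fun _ => univ) (K := ‖B‖₊)
      (f := y) (g := fun _ => 0) (a := 0) (b := t) (fun s _ => ?_) (hy.mono Icc_subset_Ici_self) hder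
      (fun _ _ => mem_univ _) continuousOn_const (fun s _ => by simpa using hasDerivWithinAt_const (c := (0:H)) s _)
      (fun _ _ => mem_univ _) (by simp [y])
    · exact this ⟨ht, le_rfl⟩
    · exact (B.lipschitz.neg).lipschitzOnWith
  filter_upwards [hdy, ae_restrict_mem measurableSet_Ioi] with t h1 h2
  rw [h1, hy0 t (le_of_lt h2)]; simp

lemma TT_cv {f : ℝ → H} (hf : ∀ t, IntegrableOn f (Ioc 0 t)) {N t : ℝ} (ht : t ∈ Ioc 0 N) :
    TT B f t = cv (KB B) ((Ioc 0 N).indicator f) t := by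
  have hi := SGf_int (B := B) hf t
  rw [TT, intervalIntegral.integral_of_le ht.1.le, ← ContinuousLinearMap.integral_comp_comm _ hi,
    ← ContinuousLinearMap.integral_comp_comm _ ((SG B t).integrable_comp hi), cv,
    ← integral_indicator measurableSet_Ioc]
  have hnt : ∀ᵐ s : ℝ, s ≠ t := by simp [ae_iff]
  apply integral_congr_ae
  filter_upwards [hnt] with s hs
  by_cases h : s ∈ Ioc 0 t
  · have h1 : s ∈ Ioc 0 N := ⟨h.1, h.2.trans ht.2⟩
    have h2 : 0 < t - s := sub_pos.2 (lt_of_le_of_ne h.2 hs)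
    rw [indicator_of_mem h, indicator_of_mem h1, KB, indicator_of_mem (by exact h2), sub_eq_add_neg, SG_add]
    simp
  · rw [indicator_of_notMem h]
    by_cases h0 : 0 < s
    · have : ¬ 0 < t - s := fun h3 => h ⟨h0, by linarith⟩
      rw [KB, indicator_of_notMem (by exact this)]; simp
    · rw [indicator_of_notMem (s := Ioc 0 N) (fun h3 => h0 h3.1)]; simp

/-- solution relation -/
def Sol (P : ℝ≥0∞) (G : H →L[ℂ] H) (f w : ℝ → H) : Prop :=
  MemLp f P (volume.restrict (Ioi 0)) ∧ MemLp w P (volume.restrict (Ioi 0)) ∧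
    ∀ᵐ t ∂(volume.restrict (Ioi 0)), G (w t) = ∫ s in 0..t, (f s - w s)

lemma memLp_loc {X : Type*} [NormedAddCommGroup X] {P : ℝ≥0∞} (hP : 1 ≤ P) {f : ℝ → X}
    (hf : MemLp f P (volume.restrict (Ioi 0))) (t : ℝ) :
    IntegrableOn f (Ioc 0 t) := by
  have : MemLp f P (volume.restrict (Ioc 0 t)) := hf.mono_measure (Measure.restrict_mono Ioc_subset_Ioi_self le_rfl)
  exact this.integrable hP

lemma sol_core (M p : ℝ) (hp : 1 < p) : ∃ D : ℝ≥0∞, D ≠ ⊤ ∧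
    ∀ (B : H →L[ℂ] H) (G : H →L[ℂ] H) (R : ℂ → H →L[ℂ] H), Sec B R M → G * B = 1 → B * G = 1 →
    (∀ f, MemLp f (ENNReal.ofReal p) (volume.restrict (Ioi 0)) → ∃ w, Sol (ENNReal.ofReal p) G f w) ∧
    ∀ f w, Sol (ENNReal.ofReal p) G f w → eLpNorm w (ENNReal.ofReal p) (volume.restrict (Ioi 0)) ≤
      D * eLpNorm f (ENNReal.ofReal p) (volume.restrict (Ioi 0)) := by
  obtain ⟨D, hD, hcz⟩ := cz_Lp (H := H) (CM M) p hp
  have hp0 : 0 < p := by linarith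
  have hP : 1 ≤ ENNReal.ofReal p := by rw [← ENNReal.ofReal_one]; exact ENNReal.ofReal_le_ofReal hp.le
  refine ⟨D ^ (1 / p), ENNReal.rpow_ne_top_of_nonneg (by positivity) hD, fun B G R hS hGB hBG => ?_⟩
  have key : ∀ f, MemLp f (ENNReal.ofReal p) (volume.restrict (Ioi 0)) →
      eLpNorm (TT B f) (ENNReal.ofReal p) (volume.restrict (Ioi 0)) ≤
      D ^ (1 / p) * eLpNorm f (ENNReal.ofReal p) (volume.restrict (Ioi 0)) := by
    intro f hf
    have hfl := memLp_loc hP hf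
    have hPt : ENNReal.ofReal p ≠ ⊤ := ENNReal.ofReal_ne_top
    have hP0 : ENNReal.ofReal p ≠ 0 := (ENNReal.ofReal_pos.2 hp0).ne'
    rw [eLpNorm_eq_lintegral_rpow_enorm_toReal hP0 hPt, eLpNorm_eq_lintegral_rpow_enorm_toReal hP0 hPt,
      ENNReal.toReal_ofReal hp0.le, ← ENNReal.mul_rpow_of_nonneg _ _ (by positivity)]
    gcongr
    have hcov : AECover (volume.restrict (Ioi (0:ℝ))) Filter.atTop (fun n : ℕ => Iic (n : ℝ)) :=
      aecover_Iic tendsto_natCast_atTop_atTop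
    have hm : AEMeasurable (fun t => ‖TT B f t‖ₑ ^ p) (volume.restrict (Ioi (0:ℝ))) := by
      have := ((TT_cont (B := B) hfl).mono Ioi_subset_Ici_self).aestronglyMeasurable (μ := volume) measurableSet_Ioi
      exact this.enorm.pow_const p
    have ht := hcov.lintegral_tendsto_of_countably_generated hm
    refine le_of_tendsto' ht fun n => ?_
    rw [Measure.restrict_restrict measurableSet_Iic, Iic_inter_Ioi]
    have hi : Integrable ((Ioc 0 (n:ℝ)).indicator f) := (integrable_indicator_iff measurableSet_Ioc).2 (hfl n)
    calc _ = ∫⁻ t in Ioc 0 (n:ℝ), ‖cv (KB B) ((Ioc 0 (n:ℝ)).indicator f) t‖ₑ ^ p :=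
          setLIntegral_congr_fun measurableSet_Ioc fun t ht => by simp only [TT_cv hfl ht]
      _ ≤ ∫⁻ t, ‖cv (KB B) ((Ioc 0 (n:ℝ)).indicator f) t‖ₑ ^ p := setLIntegral_le_lintegral _ _
      _ ≤ D * ∫⁻ t, ‖(Ioc 0 (n:ℝ)).indicator f t‖ₑ ^ p := hcz _ (KB_czk hS) _ hi
      _ ≤ _ := by
        refine mul_le_mul_right ?_ D
        rw [← lintegral_indicator measurableSet_Ioi]
        apply lintegral_mono
        intro t
        dsimp only
        by_cases h : t ∈ Ioc 0 (n:ℝ)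
        · rw [indicator_of_mem h, indicator_of_mem (by exact h.1)]
        · rw [indicator_of_notMem h]; simp [hp0]
  have ex : ∀ f, MemLp f (ENNReal.ofReal p) (volume.restrict (Ioi 0)) → Sol (ENNReal.ofReal p) G f (TT B f) := by
    intro f hf
    have hfl := memLp_loc hP hf
    refine ⟨hf, ⟨((TT_cont hfl).mono Ioi_subset_Ici_self).aestronglyMeasurable measurableSet_Ioi, ?_⟩, ?_⟩
    · refine (key f hf).trans_lt (ENNReal.mul_lt_top ?_ hf.2)
      exact (ENNReal.rpow_ne_top_of_nonneg (by positivity) hD).lt_top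
    · filter_upwards [ae_restrict_mem measurableSet_Ioi] with t ht
      exact TT_eq hGB hfl (le_of_lt ht)
  refine ⟨fun f hf => ⟨_, ex f hf⟩, fun f w hw => ?_⟩
  have h1 := ex f hw.1
  have hfl := memLp_loc hP hw.1
  have hwl := memLp_loc hP hw.2.1
  have hTl := memLp_loc hP h1.2.1
  have : ∀ᵐ t ∂(volume.restrict (Ioi 0)), w t - TT B f t = 0 := by
    refine TT_uniq hGB hBG (d := fun t => w t - TT B f t) (fun t => (hwl t).sub (hTl t)) ?_
    filter_upwards [hw.2.2, h1.2.2, ae_restrict_mem measurableSet_Ioi] with t e1 e2 ht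
    have ht' : (0:ℝ) ≤ t := le_of_lt ht
    have ii : ∀ {g : ℝ → H}, (∀ t, IntegrableOn g (Ioc 0 t)) → IntervalIntegrable g volume 0 t :=
      fun hg => (intervalIntegrable_iff_integrableOn_Ioc_of_le ht').2 (hg t)
    rw [map_sub, e1, e2, intervalIntegral.integral_sub (ii hfl) (ii hwl), intervalIntegral.integral_sub (ii hfl) (ii hTl),
      intervalIntegral.integral_sub (ii hwl) (ii hTl)]
    abel
  rw [eLpNorm_congr_ae (this.mono fun t ht => sub_eq_zero.1 ht)]
  exact key f hw.1
end
end DS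

namespace DS
set_option linter.unusedSectionVars false
open scoped ENNReal

variable {H : Type*} [NormedAddCommGroup H] [InnerProductSpace ℂ H] [CompleteSpace H]

/-- half line measure -/
abbrev hl : Measure ℝ := volume.restrict (Ioi 0)

/-- abstract Yosida data -/
structure Yos (P : ℝ≥0∞) (G : H →L[ℂ] H) (Gn Bn : ℕ → H →L[ℂ] H) (e : ℕ → ℝ) (M : ℝ) (D : ℝ≥0∞) : Prop where
  hP : 1 ≤ P
  hPt : P ≠ ⊤
  hG : ∀ n, Gn n = G + (e n : ℂ) • 1
  BG : ∀ n, Bn n * Gn n = 1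
  comm : ∀ n, G * Bn n = Bn n * G
  J : ∀ n, ‖G * Bn n‖ ≤ M
  Jlim : ∀ x, Filter.Tendsto (fun n => G (Bn n x)) Filter.atTop (nhds x)
  e0 : Filter.Tendsto e Filter.atTop (nhds 0)
  hD : D ≠ ⊤
  ex : ∀ n f, MemLp f P hl → ∃ w, Sol P (Gn n) f w
  bd : ∀ n f w, Sol P (Gn n) f w → eLpNorm w P hl ≤ D * eLpNorm f P hl

variable {P : ℝ≥0∞} {G : H →L[ℂ] H} {Gn Bn : ℕ → H →L[ℂ] H} {e : ℕ → ℝ} {M : ℝ} {D : ℝ≥0∞}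

lemma ii {P : ℝ≥0∞} (hP : 1 ≤ P) {f : ℝ → H} (hf : MemLp f P hl) {t : ℝ} (ht : 0 < t) : IntervalIntegrable f volume 0 t :=
  (intervalIntegrable_iff_integrableOn_Ioc_of_le ht.le).2 (memLp_loc hP hf t)

lemma Sol.sub (hP : 1 ≤ P) {f w f' w' : ℝ → H} (h : Sol P G f w) (h' : Sol P G f' w') :
    Sol P G (f - f') (w - w') := by
  refine ⟨h.1.sub h'.1, h.2.1.sub h'.2.1, ?_⟩
  filter_upwards [h.2.2, h'.2.2, ae_restrict_mem measurableSet_Ioi] with t h1 h2 ht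
  simp only [Pi.sub_apply]
  rw [map_sub, h1, h2, ← intervalIntegral.integral_sub]
  · congr 1; ext1 s; abel
  · exact (ii hP h.1 ht).sub (ii hP h.2.1 ht)
  · exact (ii hP h'.1 ht).sub (ii hP h'.2.1 ht)

lemma clm_memLp (L : H →L[ℂ] H) {f : ℝ → H} (hf : MemLp f P hl) : MemLp (fun t => L (f t)) P hl :=
  L.comp_memLp' hf

lemma clm_eLp (L : H →L[ℂ] H) {M : ℝ} (hL : ‖L‖ ≤ M) (f : ℝ → H) :
    eLpNorm (fun t => L (f t)) P hl ≤ ENNReal.ofReal M * eLpNorm f P hl := by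
  refine eLpNorm_le_mul_eLpNorm_of_ae_le_mul (Filter.Eventually.of_forall fun t => ?_) P
  exact (L.le_opNorm _).trans (by gcongr)

lemma Sol.map (hP : 1 ≤ P) {L : H →L[ℂ] H} (hL : L * G = G * L) {f w : ℝ → H} (h : Sol P G f w) :
    Sol P G (fun t => L (f t)) (fun t => L (w t)) := by
  refine ⟨clm_memLp L h.1, clm_memLp L h.2.1, ?_⟩
  filter_upwards [h.2.2, ae_restrict_mem measurableSet_Ioi] with t h1 ht
  have e : G (L (w t)) = L (G (w t)) := (congrArg (fun T : H →L[ℂ] H => T (w t)) hL).symm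
  rw [e, h1, ← ContinuousLinearMap.intervalIntegral_comp_comm]
  · simp
  · exact (ii hP h.1 ht).sub (ii hP h.2.1 ht)

lemma Yos.diff (hY : Yos P G Gn Bn e M D) {n m : ℕ} {h w x : ℝ → H} (hw : Sol P (Gn n) (fun t => G (h t)) w)
    (hx : Sol P (Gn m) h x) :
    eLpNorm (w - fun t => G (x t)) P hl ≤
      D * (ENNReal.ofReal |e n - e m| * (ENNReal.ofReal M * (eLpNorm h P hl + D * eLpNorm h P hl))) := by
  set c : ℂ := -((e n - e m : ℝ) : ℂ) with hc
  have hP := hY.hP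
  have hr : MemLp (fun t => (G * Bn m) (h t - x t)) P hl := clm_memLp (G * Bn m) (hx.1.sub hx.2.1)
  have hGx := clm_memLp G hx.2.1
  have hS : Sol P (Gn n) (fun t => c • (G * Bn m) (h t - x t)) (w - fun t => G (x t)) := by
    refine ⟨hr.const_smul c, hw.2.1.sub hGx, ?_⟩
    filter_upwards [hw.2.2, hx.2.2, ae_restrict_mem measurableSet_Ioi] with t h1 h2 ht
    have i1 := ii hP hw.1 ht
    have i2 := ii hP hw.2.1 ht
    have i3 := ii hP hGx ht
    have i4 := ii hP hr ht
    have i5 := (ii hP hx.1 ht).sub (ii hP hx.2.1 ht)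
    have e1 : G (x t) = ∫ s in 0..t, (G * Bn m) (h s - x s) := by
      rw [ContinuousLinearMap.intervalIntegral_comp_comm _ i5, ← h2]
      have : (Bn m * Gn m) (x t) = x t := by rw [hY.BG]; rfl
      exact congrArg G this.symm
    have e2 : Gn m (G (x t)) = ∫ s in 0..t, (G (h s) - G (x s)) := by
      have : Gn m (G (x t)) = G (Gn m (x t)) := by simp [hY.hG]
      rw [this, h2, ← ContinuousLinearMap.intervalIntegral_comp_comm _ i5]
      simp
    have e3 : ∀ y, Gn n y = Gn m y - c • y := by
      intro y; simp only [hY.hG, hc]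
      simp [sub_smul]
      abel
    have e4 : ∫ s in 0..t, (c • (G * Bn m) (h s - x s) - (w - fun t => G (x t)) s) =
        c • (∫ s in 0..t, (G * Bn m) (h s - x s)) - ((∫ s in 0..t, w s) - ∫ s in 0..t, G (x s)) := by
      simp only [Pi.sub_apply]
      have i4' : IntervalIntegrable (fun s => c • (G * Bn m) (h s - x s)) volume 0 t := i4.smul c
      rw [intervalIntegral.integral_sub i4' (i2.sub i3), intervalIntegral.integral_smul,
        intervalIntegral.integral_sub i2 i3]
    rw [e4, ← e1]
    simp only [Pi.sub_apply]
    rw [map_sub, h1, e3 (G (x t)), e2, intervalIntegral.integral_sub i1 i2, intervalIntegral.integral_sub i1 i3]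
    abel
  refine (hY.bd n _ _ hS).trans (mul_le_mul_right ?_ D)
  have h1 : eLpNorm (fun t => c • (G * Bn m) (h t - x t)) P hl =
      ENNReal.ofReal |e n - e m| * eLpNorm (fun t => (G * Bn m) (h t - x t)) P hl := by
    have := eLpNorm_const_smul (p := P) (μ := hl) c (fun t => (G * Bn m) (h t - x t))
    rw [show (fun t => c • (G * Bn m) (h t - x t)) = c • fun t => (G * Bn m) (h t - x t) from rfl, this]
    congr 1
    rw [hc, enorm_neg, ← ofReal_norm, Complex.norm_real, Real.norm_eq_abs]
  rw [h1]
  refine mul_le_mul_right ((clm_eLp (G * Bn m) (hY.J m) (fun t => h t - x t)).trans (mul_le_mul_right ?_ _)) _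
  refine (eLpNorm_sub_le hx.1.1 hx.2.1.1 hP).trans (add_le_add le_rfl (hY.bd m _ _ hx))

lemma Yos.approx (hY : Yos P G Gn Bn e M D) {f : ℝ → H} (hf : MemLp f P hl) :
    Filter.Tendsto (fun k => eLpNorm (f - fun t => G (Bn k (f t))) P hl) Filter.atTop (nhds 0) := by
  have hP0 : P ≠ 0 := (zero_lt_one.trans_le hY.hP).ne'
  have hp : 0 < P.toReal := ENNReal.toReal_pos hP0 hY.hPt
  have hM : 0 ≤ M := (norm_nonneg _).trans (hY.J 0)
  have h1 : Filter.Tendsto (fun k => ∫⁻ t, ‖f t - G (Bn k (f t))‖ₑ ^ P.toReal ∂hl) Filter.atTop (nhds (∫⁻ t, 0 ∂hl)) := by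
    refine tendsto_lintegral_of_dominated_convergence' (fun t => (ENNReal.ofReal (1 + M) * ‖f t‖ₑ) ^ P.toReal) ?_ ?_ ?_ ?_
    · intro k
      exact (hf.1.sub (clm_memLp (G * Bn k) hf).1).enorm.pow_const _
    · intro k
      refine Filter.Eventually.of_forall fun t => ?_
      refine ENNReal.rpow_le_rpow ?_ hp.le
      rw [← ofReal_norm, ← ofReal_norm, ← ENNReal.ofReal_mul (by positivity)]
      refine ENNReal.ofReal_le_ofReal ?_
      refine (norm_sub_le _ _).trans ?_
      have := ((G * Bn k).le_opNorm (f t)).trans (mul_le_mul_of_nonneg_right (hY.J k) (norm_nonneg _))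
      have h2 : ‖G (Bn k (f t))‖ ≤ M * ‖f t‖ := this
      linarith
    · simp only [ENNReal.mul_rpow_of_nonneg _ _ hp.le]
      rw [lintegral_const_mul' _ _ (ENNReal.rpow_ne_top_of_nonneg hp.le ENNReal.ofReal_ne_top)]
      exact ENNReal.mul_ne_top (ENNReal.rpow_ne_top_of_nonneg hp.le ENNReal.ofReal_ne_top)
        (lintegral_rpow_enorm_lt_top_of_eLpNorm_lt_top hP0 hY.hPt hf.2).ne
    · refine Filter.Eventually.of_forall fun t => ?_
      have h3 : Filter.Tendsto (fun k => ‖f t - G (Bn k (f t))‖ₑ) Filter.atTop (nhds 0) := by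
        have := ((hY.Jlim (f t)).const_sub (f t)).enorm
        simpa using this
      have := (ENNReal.continuous_rpow_const (y := P.toReal)).tendsto 0 |>.comp h3
      simpa [hp] using! this
  rw [lintegral_zero] at h1
  have h2 := (ENNReal.continuous_rpow_const (y := 1 / P.toReal)).tendsto 0 |>.comp h1
  rw [ENNReal.zero_rpow_of_pos (by positivity)] at h2
  refine h2.congr fun k => ?_
  rw [eLpNorm_eq_lintegral_rpow_enorm_toReal hP0 hY.hPt]
  rfl

lemma Yos.exists_sol (hY : Yos P G Gn Bn e M D) {f : ℝ → H} (hf : MemLp f P hl) : ∃ w, Sol P G f w := by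
  have hP := hY.hP
  have : Fact (1 ≤ P) := ⟨hP⟩
  choose w hw using fun n => hY.ex n f hf
  let W : ℕ → Lp H P hl := fun n => (hw n).2.1.toLp (w n)
  have hcau : CauchySeq W := by
    rw [EMetric.cauchySeq_iff]
    intro ε hε
    obtain ⟨r, hr0, hrε⟩ := ENNReal.lt_iff_exists_nnreal_btwn.1 hε
    have hr0' : 0 < r := by exact_mod_cast hr0
    have hε4 : 0 < ((r / 3 : NNReal) : ℝ≥0∞) := by
      have : 0 < r / 3 := by positivity
      exact_mod_cast this
    have hDf : Filter.Tendsto (fun k => D * eLpNorm (f - fun t => G (Bn k (f t))) P hl) Filter.atTop (nhds 0) := by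
      have := ENNReal.Tendsto.const_mul (hY.approx hf) (Or.inr hY.hD)
      simpa using this
    obtain ⟨k, hk⟩ := (hDf.eventually (gt_mem_nhds hε4)).exists
    let h : ℝ → H := fun t => Bn k (f t)
    have hh : MemLp h P hl := clm_memLp _ hf
    have hfk : MemLp (fun t => G (h t)) P hl := clm_memLp _ hh
    set c : ℝ≥0∞ := ENNReal.ofReal M * (eLpNorm h P hl + D * eLpNorm h P hl) with hc
    have hct : c ≠ ⊤ := ENNReal.mul_ne_top ENNReal.ofReal_ne_top
      (ENNReal.add_ne_top.2 ⟨hh.2.ne, ENNReal.mul_ne_top hY.hD hh.2.ne⟩)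
    have hee : Filter.Tendsto (fun q : ℕ × ℕ => D * (ENNReal.ofReal |e q.1 - e q.2| * c)) Filter.atTop (nhds 0) := by
      have h1 : Filter.Tendsto (fun q : ℕ × ℕ => |e q.1 - e q.2|) Filter.atTop (nhds 0) := by
        have := (hY.e0.comp (Filter.tendsto_fst (f := Filter.atTop) (g := Filter.atTop (α := ℕ)))).sub
          (hY.e0.comp (Filter.tendsto_snd (f := Filter.atTop (α := ℕ)) (g := Filter.atTop)))
        have := this.abs
        rw [Filter.prod_atTop_atTop_eq] at this
        simpa using this
      have h2 := (ENNReal.continuous_ofReal.tendsto 0).comp h1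
      rw [ENNReal.ofReal_zero] at h2
      have h3 := ENNReal.Tendsto.mul_const h2 (Or.inr hct)
      have h4 := ENNReal.Tendsto.const_mul h3 (Or.inr hY.hD)
      simpa using! h4
    have hev := hee.eventually (gt_mem_nhds hε4)
    rw [Filter.eventually_atTop] at hev
    obtain ⟨⟨N₁, N₂⟩, hN⟩ := hev
    refine ⟨max N₁ N₂, fun m hm n hn => ?_⟩
    have hmn := hN (m, n) ⟨(le_max_left _ _).trans hm, (le_max_right _ _).trans hn⟩
    obtain ⟨v, hv⟩ := hY.ex m _ hfk
    obtain ⟨x, hx⟩ := hY.ex n _ hh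
    have hGx : Sol P (Gn n) (fun t => G (h t)) (fun t => G (x t)) := hx.map hP (by
      rw [hY.hG]; simp [mul_add, add_mul])
    have b1 : eLpNorm (w m - v) P hl ≤ D * eLpNorm (f - fun t => G (h t)) P hl := hY.bd m _ _ ((hw m).sub hP hv)
    have b2 : eLpNorm (w n - fun t => G (x t)) P hl ≤ D * eLpNorm (f - fun t => G (h t)) P hl :=
      hY.bd n _ _ ((hw n).sub hP hGx)
    have b3 := hY.diff hv hx
    have hsplit : w m - w n = (w m - v) + ((v - fun t => G (x t)) - (w n - fun t => G (x t))) := by abel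
    rw [Lp.edist_toLp_toLp, hsplit]
    have m1 := (hw m).2.1.sub hv.2.1
    have m2 := hv.2.1.sub hGx.2.1
    have m3 := (hw n).2.1.sub hGx.2.1
    calc _ ≤ eLpNorm (w m - v) P hl + (eLpNorm (v - fun t => G (x t)) P hl + eLpNorm (w n - fun t => G (x t)) P hl) :=
          (eLpNorm_add_le m1.1 (m2.sub m3).1 hP).trans (add_le_add le_rfl (eLpNorm_sub_le m2.1 m3.1 hP))
      _ ≤ ((r / 3 : NNReal) : ℝ≥0∞) + (((r / 3 : NNReal) : ℝ≥0∞) + ((r / 3 : NNReal) : ℝ≥0∞)) := add_le_add (b1.trans hk.le) (add_le_add (b3.trans hmn.le) (b2.trans hk.le))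
      _ = r := by
        rw [← ENNReal.coe_add, ← ENNReal.coe_add]
        congr 1
        rw [← NNReal.coe_inj]; push_cast; ring
      _ < ε := hrε
  obtain ⟨W0, hW0⟩ := cauchySeq_tendsto_of_complete hcau
  have hLp : Filter.Tendsto (fun n => eLpNorm (w n - (W0 : ℝ → H)) P hl) Filter.atTop (nhds 0) := by
    have := (Lp.tendsto_Lp_iff_tendsto_eLpNorm' W W0).1 hW0
    refine this.congr fun n => eLpNorm_congr_ae ?_
    exact ((hw n).2.1.coeFn_toLp).sub (Filter.EventuallyEq.refl _ _)
  have hW0m : MemLp W0 P hl := Lp.memLp W0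
  refine ⟨W0, hf, hW0m, ?_⟩
  have hmeas := tendstoInMeasure_of_tendsto_eLpNorm (zero_lt_one.trans_le hP).ne' (fun n => (hw n).2.1.1) hW0m.1 hLp
  obtain ⟨ns, hns, hae⟩ := hmeas.exists_seq_tendsto_ae
  have hall : ∀ᵐ t ∂hl, ∀ n, Gn n (w n t) = ∫ s in 0..t, (f s - w n s) := ae_all_iff.2 fun n => (hw n).2.2
  filter_upwards [hae, hall, ae_restrict_mem measurableSet_Ioi] with t h1 h2 ht
  have ht' : (0:ℝ) < t := ht
  have l1 : Filter.Tendsto (fun i => Gn (ns i) (w (ns i) t)) Filter.atTop (nhds (G (W0 t))) := by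
    have a1 := (G.continuous.tendsto (W0 t)).comp h1
    have a2 : Filter.Tendsto (fun i => ((e (ns i) : ℝ) : ℂ)) Filter.atTop (nhds ((0:ℝ):ℂ)) :=
      (Complex.continuous_ofReal.tendsto 0).comp (hY.e0.comp hns.tendsto_atTop)
    have a3 := a1.add (a2.smul h1)
    simpa [hY.hG] using! a3
  have l2 : Filter.Tendsto (fun i => ∫ s in 0..t, (f s - w (ns i) s)) Filter.atTop (nhds (∫ s in 0..t, (f s - W0 s))) := by
    refine Filter.Tendsto.comp (g := fun n => ∫ s in 0..t, (f s - w n s)) ?_ hns.tendsto_atTop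
    simp only [intervalIntegral.integral_of_le ht'.le]
    have i0 := (memLp_loc hP hf t).sub (memLp_loc hP hW0m t)
    refine tendsto_integral_of_L1' (fun s => f s - W0 s) i0.aestronglyMeasurable (Filter.Eventually.of_forall fun n => 
      (memLp_loc hP hf t).sub (memLp_loc hP (hw n).2.1 t)) ?_
    have hle : ∀ n, eLpNorm ((fun s => f s - w n s) - fun s => f s - W0 s) 1 (volume.restrict (Ioc 0 t)) ≤
        eLpNorm (w n - (W0 : ℝ → H)) P hl * (volume.restrict (Ioc 0 t) univ) ^ (1 / (1:ℝ≥0∞).toReal - 1 / P.toReal) := by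
      intro n
      have e1 : ((fun s => f s - w n s) - fun s => f s - W0 s) = -(w n - (W0 : ℝ → H)) := by
        ext1 s; simp only [Pi.sub_apply, Pi.neg_apply]; abel
      have hm1 := ((hw n).2.1.sub hW0m).mono_measure (Measure.restrict_mono (Ioc_subset_Ioi_self : Ioc (0:ℝ) t ⊆ Ioi 0) le_rfl)
      rw [e1, eLpNorm_neg]
      refine (eLpNorm_le_eLpNorm_mul_rpow_measure_univ hP hm1.1).trans (mul_le_mul_left ?_ _)
      exact eLpNorm_mono_measure _ (Measure.restrict_mono Ioc_subset_Ioi_self le_rfl)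
    refine tendsto_of_tendsto_of_tendsto_of_le_of_le tendsto_const_nhds ?_ (fun _ => zero_le) hle
    have hfin : (volume.restrict (Ioc 0 t) univ) ^ (1 / (1:ℝ≥0∞).toReal - 1 / P.toReal) ≠ ⊤ := by
      have h1P : 1 / P.toReal ≤ 1 := by
        rw [one_div]
        refine inv_le_one_of_one_le₀ ?_
        rw [← ENNReal.toReal_one]
        exact ENNReal.toReal_mono hY.hPt hP
      refine ENNReal.rpow_ne_top_of_nonneg (by simpa using h1P) ?_
      simp
    have := ENNReal.Tendsto.mul_const hLp (Or.inr hfin)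
    simpa using this
  refine tendsto_nhds_unique l1 (l2.congr fun i => (h2 _).symm)

lemma Yos.uniq (hY : Yos P G Gn Bn e M D) {w r : ℝ → H} (hw : MemLp w P hl) (hr : MemLp r P hl)
    (h1 : ∀ᵐ t ∂hl, G (w t) = -∫ s in 0..t, w s) (h2 : ∀ᵐ t ∂hl, w t = ∫ s in 0..t, r s) :
    ∀ᵐ t ∂hl, w t = 0 := by
  have hP := hY.hP
  have key : ∀ n, eLpNorm w P hl ≤ D * (ENNReal.ofReal |e n| * eLpNorm r P hl) := by
    intro n
    have hS : Sol P (Gn n) (fun t => ((e n : ℝ) : ℂ) • r t) w := by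
      refine ⟨hr.const_smul _, hw, ?_⟩
      filter_upwards [h1, h2, ae_restrict_mem measurableSet_Ioi] with t a1 a2 ht
      have i4' : IntervalIntegrable (fun s => ((e n : ℝ) : ℂ) • r s) volume 0 t := (ii hP hr ht).smul _
      rw [intervalIntegral.integral_sub i4' (ii hP hw ht), intervalIntegral.integral_smul, ← a2, hY.hG]
      simp [a1]; abel
    refine (hY.bd n _ _ hS).trans (mul_le_mul_right (le_of_eq ?_) D)
    have := eLpNorm_const_smul (p := P) (μ := hl) ((e n : ℝ) : ℂ) r
    rw [show (fun t => ((e n : ℝ) : ℂ) • r t) = ((e n : ℝ) : ℂ) • r from rfl, this]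
    congr 1
    rw [← ofReal_norm, Complex.norm_real, Real.norm_eq_abs]
  have hlim : Filter.Tendsto (fun n => D * (ENNReal.ofReal |e n| * eLpNorm r P hl)) Filter.atTop (nhds 0) := by
    have h1 : Filter.Tendsto (fun n => |e n|) Filter.atTop (nhds 0) := by simpa using hY.e0.abs
    have h2 := (ENNReal.continuous_ofReal.tendsto 0).comp h1
    rw [ENNReal.ofReal_zero] at h2
    have h3 := ENNReal.Tendsto.mul_const h2 (Or.inr hr.2.ne)
    have h4 := ENNReal.Tendsto.const_mul h3 (Or.inr hY.hD)
    simpa using! h4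
  have h0 : eLpNorm w P hl = 0 := le_antisymm (ge_of_tendsto' hlim key) zero_le
  have := (eLpNorm_eq_zero_iff hw.1 (zero_lt_one.trans_le hP).ne').1 h0
  exact this
end DS

namespace DS
set_option linter.unusedSectionVars false
set_option linter.unusedSimpArgs false
open scoped ENNReal

variable {H : Type*} [NormedAddCommGroup H] [InnerProductSpace ℂ H] [CompleteSpace H]

section alg
variable {𝒜 : Type*} [Ring 𝒜] [Algebra ℂ 𝒜]

lemma alg1 {n m : ℂ} (hnm : n * m = 1) {s g : 𝒜} (h : n • (s * g) = g - s) :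
    (n • 1 - n ^ 2 • s) * (g + m • 1) = 1 := by
  have h2 : n ^ 2 • (s * g) = n • (g - s) := by rw [← h, smul_smul, sq]
  have e2 : n ^ 2 * m = n := by rw [sq, mul_assoc, hnm, mul_one]
  have e1 : m * n = 1 := by rw [mul_comm, hnm]
  have e3 : m * n ^ 2 = n := by rw [mul_comm, e2]
  simp only [sub_mul, mul_add, smul_mul_assoc, mul_smul_comm, one_mul, mul_one, h2, smul_smul, hnm, e1, e2, e3,
    one_smul, smul_sub, smul_add]
  abel

lemma alg2 {n a : ℂ} (ha : a ≠ 0) {s t : 𝒜} (k : (n ^ 2 / a) • (t - s) = ((n ^ 2 / a) ^ 2) • (s * t)) :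
    (a • 1 - n ^ 2 • s) * (a⁻¹ • 1 + (n ^ 2 / a ^ 2) • t) = 1 := by
  have c1 : a * a⁻¹ = 1 := mul_inv_cancel₀ ha
  have c1' : a⁻¹ * a = 1 := inv_mul_cancel₀ ha
  have c2 : n ^ 2 / a ^ 2 * a = n ^ 2 / a := by field_simp
  have c2' : a * (n ^ 2 / a ^ 2) = n ^ 2 / a := by field_simp
  have c3 : n ^ 2 * a⁻¹ = n ^ 2 / a := rfl
  have c3' : a⁻¹ * n ^ 2 = n ^ 2 / a := by field_simp
  have c4 : n ^ 2 * (n ^ 2 / a ^ 2) = (n ^ 2 / a) ^ 2 := by field_simp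
  have c4' : n ^ 2 / a ^ 2 * n ^ 2 = (n ^ 2 / a) ^ 2 := by field_simp
  simp only [sub_mul, mul_add, smul_mul_assoc, mul_smul_comm, one_mul, mul_one, smul_smul,
    c1, c1', c2, c2', c3, c3', c4, c4', ← k, one_smul, smul_sub, smul_add]
  abel

lemma alg3 {n a : ℂ} (ha : a ≠ 0) {s t : 𝒜} (k : (n ^ 2 / a) • (t - s) = ((n ^ 2 / a) ^ 2) • (t * s)) :
    (a⁻¹ • 1 + (n ^ 2 / a ^ 2) • t) * (a • 1 - n ^ 2 • s) = 1 := by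
  have c1 : a * a⁻¹ = 1 := mul_inv_cancel₀ ha
  have c1' : a⁻¹ * a = 1 := inv_mul_cancel₀ ha
  have c2 : n ^ 2 / a ^ 2 * a = n ^ 2 / a := by field_simp
  have c2' : a * (n ^ 2 / a ^ 2) = n ^ 2 / a := by field_simp
  have c3 : n ^ 2 * a⁻¹ = n ^ 2 / a := rfl
  have c3' : a⁻¹ * n ^ 2 = n ^ 2 / a := by field_simp
  have c4 : n ^ 2 * (n ^ 2 / a ^ 2) = (n ^ 2 / a) ^ 2 := by field_simp
  have c4' : n ^ 2 / a ^ 2 * n ^ 2 = (n ^ 2 / a) ^ 2 := by field_simp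
  simp only [mul_sub, add_mul, smul_mul_assoc, mul_smul_comm, one_mul, mul_one, smul_smul,
    c1, c1', c2, c2', c3, c3', c4, c4', ← k, one_smul, smul_sub, smul_add]
  abel
end alg

/-- pseudo-resolvent on the closed right half plane -/
structure PsR (S : ℂ → H →L[ℂ] H) (M : ℝ) : Prop where
  bd : ∀ l : ℂ, 0 ≤ l.re → ‖S l‖ * (1 + ‖l‖) ≤ M
  res : ∀ l m : ℂ, 0 ≤ l.re → 0 ≤ m.re → S l - S m = (m - l) • (S l * S m)

variable {S : ℂ → H →L[ℂ] H} {M : ℝ}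

/-- Yosida approximation -/
def yB (S : ℂ → H →L[ℂ] H) (n : ℝ) : H →L[ℂ] H := (n : ℂ) • 1 - ((n : ℂ) ^ 2) • S n

/-- its inverse -/
def yG (S : ℂ → H →L[ℂ] H) (n : ℝ) : H →L[ℂ] H := S 0 + ((n⁻¹ : ℝ) : ℂ) • 1

/-- its resolvent -/
def yR (S : ℂ → H →L[ℂ] H) (n : ℝ) (l : ℂ) : H →L[ℂ] H :=
  (l + n)⁻¹ • 1 + ((n : ℂ) ^ 2 / (l + n) ^ 2) • S (l * n / (l + n))

lemma PsR.comm (h : PsR S M) {l m : ℂ} (hl : 0 ≤ l.re) (hm : 0 ≤ m.re) : S l * S m = S m * S l := by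
  by_cases hlm : l = m
  · rw [hlm]
  have h1 := h.res l m hl hm
  have h2 := h.res m l hm hl
  have h3 : (m - l) • (S l * S m) = (m - l) • (S m * S l) := by
    rw [← h1, ← neg_sub, h2, ← neg_smul, neg_sub]
  exact smul_right_injective _ (sub_ne_zero.2 (Ne.symm hlm)) h3

lemma PsR.S0n (h : PsR S M) {n : ℝ} (hn : 0 < n) : (n : ℂ) • (S n * S 0) = S 0 - S n := by
  have := h.res 0 n (by simp) (by simpa using hn.le)
  rw [this, sub_zero, h.comm (m := (n:ℂ)) (by simp) (by simpa using hn.le)]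

lemma PsR.BG (h : PsR S M) {n : ℝ} (hn : 0 < n) : yB S n * yG S n = 1 := by
  have hn' : (n : ℂ) ≠ 0 := by exact_mod_cast hn.ne'
  exact alg1 (by push_cast; field_simp) (h.S0n hn)

lemma PsR.GBc (h : PsR S M) {n : ℝ} (hn : 0 < n) : S 0 * yB S n = yB S n * S 0 := by
  have h1 := h.comm (l := 0) (m := n) (by simp) (by simpa using hn.le)
  simp only [yB, sub_mul, mul_sub, smul_mul_assoc, mul_smul_comm, one_mul, mul_one, h1]

lemma PsR.GB (h : PsR S M) {n : ℝ} (hn : 0 < n) : yG S n * yB S n = 1 := by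
  rw [← h.BG hn]
  have := h.GBc hn
  rw [yG, add_mul, mul_add, this]; simp

lemma PsR.J (h : PsR S M) {n : ℝ} (hn : 0 < n) : S 0 * yB S n = (n : ℂ) • S n := by
  have h1 := h.S0n hn
  have h2 : ((n : ℂ) ^ 2) • (S n * S 0) = (n : ℂ) • (S 0 - S n) := by rw [← h1, smul_smul, sq]
  rw [h.GBc hn]
  simp only [yB, sub_mul, smul_mul_assoc, one_mul, h2, smul_sub]
  abel

lemma PsR.J_bd (h : PsR S M) {n : ℝ} (hn : 0 < n) : ‖S 0 * yB S n‖ ≤ M := by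
  rw [h.J hn, norm_smul, Complex.norm_real, Real.norm_of_nonneg hn.le]
  have := h.bd n (by simpa using hn.le)
  rw [Complex.norm_real, Real.norm_of_nonneg hn.le] at this
  nlinarith [norm_nonneg (S n)]

lemma add_norm_ge {l : ℂ} (hl : 0 ≤ l.re) {n : ℝ} (hn : 0 < n) : n ≤ ‖l + n‖ ∧ ‖l‖ ≤ ‖l + n‖ := by
  constructor
  · have := Complex.re_le_norm (l + n)
    simp at this; linarith
  · rw [← sq_le_sq₀ (norm_nonneg _) (norm_nonneg _), ← Complex.normSq_eq_norm_sq, ← Complex.normSq_eq_norm_sq,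
      Complex.normSq_apply, Complex.normSq_apply]
    simp; nlinarith

lemma mu_re {l : ℂ} (hl : 0 ≤ l.re) {n : ℝ} (hn : 0 < n) : 0 ≤ (l * n / (l + n)).re := by
  rw [Complex.div_re]
  have := Complex.normSq_nonneg (l + n)
  have h1 : 0 ≤ (l * n).re * (l + n).re := by simp; positivity
  have h2 : 0 ≤ (l * n).im * (l + n).im := by
    simp; nlinarith [mul_nonneg hn.le (mul_self_nonneg l.im)]
  positivity

lemma PsR.sec (h : PsR S M) {n : ℝ} (hn : 1 ≤ n) : Sec (yB S n) (yR S n) (M + 2) := by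
  have hn0 : 0 < n := by linarith
  have hnr : 0 ≤ (n : ℂ).re := by simpa using hn0.le
  have key : ∀ l : ℂ, 0 ≤ l.re → (l + n ≠ 0) ∧
      ((n : ℂ) ^ 2 / (l + n)) • (S (l * n / (l + n)) - S n) = (((n : ℂ) ^ 2 / (l + n)) ^ 2) • (S n * S (l * n / (l + n))) := by
    intro l hl
    have hne : l + n ≠ 0 := by
      intro h0
      have := (add_norm_ge hl hn0).1
      rw [h0, norm_zero] at this; linarith
    refine ⟨hne, ?_⟩
    have h1 := h.res (l * n / (l + n)) n (mu_re hl hn0) hnr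
    rw [h1, smul_smul, h.comm (mu_re hl hn0) hnr]
    congr 1
    field_simp; ring
  refine ⟨fun l hl => ?_, fun l hl => ?_, fun l hl => ?_⟩
  · obtain ⟨hne, k⟩ := key l hl
    set mu := l * n / (l + n)
    set a := l + (n : ℂ) with ha
    have e1 : l • (1 : H →L[ℂ] H) + yB S n = a • 1 - ((n : ℂ) ^ 2) • S n := by
      rw [yB, ha, add_smul]; abel
    rw [e1, yR]
    exact alg2 hne k
  · obtain ⟨hne, k⟩ := key l hl
    rw [h.comm hnr (mu_re hl hn0)] at k
    set mu := l * n / (l + n)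
    set a := l + (n : ℂ) with ha
    have e1 : l • (1 : H →L[ℂ] H) + yB S n = a • 1 - ((n : ℂ) ^ 2) • S n := by
      rw [yB, ha, add_smul]; abel
    rw [e1, yR]
    exact alg3 hne k
  · obtain ⟨hne, -⟩ := key l hl
    obtain ⟨g1, g2⟩ := add_norm_ge hl hn0
    have hb := h.bd _ (mu_re hl hn0)
    set mu := l * n / (l + n) with hmu
    have hmun : ‖mu‖ = ‖l‖ * n / ‖l + n‖ := by
      rw [hmu, norm_div, norm_mul, Complex.norm_real, Real.norm_of_nonneg hn0.le]
    set a := ‖l + (n : ℂ)‖ with ha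
    have ha0 : 0 < a := by linarith
    have b1 : ‖yR S n l‖ ≤ a⁻¹ + n ^ 2 / a ^ 2 * ‖S mu‖ := by
      rw [yR]
      refine (norm_add_le _ _).trans (add_le_add ?_ ?_)
      · rw [norm_smul, norm_inv]
        exact mul_le_of_le_one_right (by positivity) one_le
      · rw [norm_smul, norm_div, norm_pow, norm_pow, Complex.norm_real, Real.norm_of_nonneg hn0.le]
    have b2 : a⁻¹ * (1 + ‖l‖) ≤ 2 := by
      rw [inv_mul_le_iff₀ ha0]; linarith
    have b3 : n ^ 2 / a ^ 2 * ‖S mu‖ * (1 + ‖l‖) ≤ M := by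
      refine le_trans ?_ hb
      rw [mul_comm (n ^ 2 / a ^ 2), mul_assoc]
      refine mul_le_mul_of_nonneg_left ?_ (norm_nonneg _)
      rw [hmun, div_mul_eq_mul_div, div_le_iff₀ (by positivity)]
      have : (1 + ‖l‖ * n / a) * a ^ 2 = a * (a + ‖l‖ * n) := by field_simp
      rw [this]
      calc n ^ 2 * (1 + ‖l‖) = n * (n + ‖l‖ * n) := by ring
        _ ≤ _ := by gcongr
    calc _ ≤ (a⁻¹ + n ^ 2 / a ^ 2 * ‖S mu‖) * (1 + ‖l‖) := by gcongr
      _ = a⁻¹ * (1 + ‖l‖) + n ^ 2 / a ^ 2 * ‖S mu‖ * (1 + ‖l‖) := by ring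
      _ ≤ _ := by linarith

lemma PsR.Jlim (h : PsR S M) (hd : DenseRange (S 0)) (x : H) :
    Filter.Tendsto (fun n : ℕ => S 0 (yB S ((n : ℝ) + 1) x)) Filter.atTop (nhds x) := by
  have hpos : ∀ n : ℕ, (0:ℝ) < (n:ℝ) + 1 := fun n => by positivity
  have hM : 0 ≤ M := (norm_nonneg _).trans (h.J_bd (hpos 0))
  have h1 : ∀ n : ℕ, ∀ y, ‖S 0 (yB S ((n:ℝ)+1) (S 0 y)) - S 0 y‖ ≤ M * ‖y‖ / ((n:ℝ) + 1) := by
    intro n y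
    set r : ℝ := (n:ℝ) + 1
    have hr := hpos n
    have e1 : S 0 (yB S r (S 0 y)) = S 0 y - S r y := by
      have a1 := congrArg (fun T : H →L[ℂ] H => T (S 0 y)) (h.J hr)
      have a2 := congrArg (fun T : H →L[ℂ] H => T y) (h.S0n hr)
      have a1' : S 0 (yB S r (S 0 y)) = (r : ℂ) • S r (S 0 y) := a1
      have a2' : (r : ℂ) • S r (S 0 y) = S 0 y - S r y := a2
      rw [a1', a2']
    rw [e1, sub_sub_cancel_left, norm_neg, le_div_iff₀ hr]
    have hb := h.bd r (by simpa using hr.le)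
    rw [Complex.norm_real, Real.norm_of_nonneg hr.le] at hb
    have := (S r).le_opNorm y
    have h3 : ‖S r‖ * r ≤ M := by nlinarith [norm_nonneg (S r)]
    calc ‖S r y‖ * r ≤ ‖S r‖ * ‖y‖ * r := by gcongr
      _ = ‖S r‖ * r * ‖y‖ := by ring
      _ ≤ _ := by gcongr
  rw [Metric.tendsto_atTop]
  intro ε hε
  obtain ⟨y, hy⟩ := hd.exists_dist_lt x (ε := ε / (2 * (M + 1))) (by positivity)
  have hl : Filter.Tendsto (fun n : ℕ => M * ‖y‖ / ((n:ℝ) + 1)) Filter.atTop (nhds 0) := 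
    tendsto_const_nhds.div_atTop (Filter.tendsto_atTop_add_const_right _ _ tendsto_natCast_atTop_atTop)
  obtain ⟨N, hN⟩ := Filter.eventually_atTop.1 (hl.eventually (gt_mem_nhds (show (0:ℝ) < ε / 2 by positivity)))
  refine ⟨N, fun n hn => ?_⟩
  have h2 := hN n hn
  have h3 := h1 n y
  set L := S 0 * yB S ((n:ℝ)+1) with hL
  have hLb : ‖L‖ ≤ M := h.J_bd (hpos n)
  change dist (L x) x < ε
  have h3' : ‖L (S 0 y) - S 0 y‖ ≤ M * ‖y‖ / ((n:ℝ) + 1) := h3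
  rw [dist_eq_norm] at hy ⊢
  have e : L x - x = L (x - S 0 y) + (L (S 0 y) - S 0 y) - (x - S 0 y) := by rw [map_sub]; abel
  have h4 := L.le_opNorm (x - S 0 y)
  have h5 : ‖L (x - S 0 y)‖ ≤ M * ‖x - S 0 y‖ := h4.trans (by gcongr)
  rw [e]
  have h6 := norm_sub_le (L (x - S 0 y) + (L (S 0 y) - S 0 y)) (x - S 0 y)
  have h7 := norm_add_le (L (x - S 0 y)) (L (S 0 y) - S 0 y)
  have h8 : (M + 1) * ‖x - S 0 y‖ < ε / 2 := by
    rw [lt_div_iff₀ (by positivity)] at hy ⊢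
    linarith
  linarith

lemma PsR.yos (h : PsR S M) (hd : DenseRange (S 0)) {p : ℝ} (hp : 1 < p) :
    ∃ D, Yos (ENNReal.ofReal p) (S 0) (fun n : ℕ => yG S ((n:ℝ)+1)) (fun n : ℕ => yB S ((n:ℝ)+1))
      (fun n => ((n:ℝ)+1)⁻¹) M D := by
  obtain ⟨D, hD, hc⟩ := sol_core (H := H) (M + 2) p hp
  have hpos : ∀ n : ℕ, (0:ℝ) < (n:ℝ) + 1 := fun n => by positivity
  have hge : ∀ n : ℕ, (1:ℝ) ≤ (n:ℝ) + 1 := fun n => by simp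
  have hP : 1 ≤ ENNReal.ofReal p := by rw [← ENNReal.ofReal_one]; exact ENNReal.ofReal_le_ofReal hp.le
  have hcn := fun n : ℕ => hc _ _ _ (h.sec (hge n)) (h.GB (hpos n)) (h.BG (hpos n))
  exact ⟨D, ⟨hP, ENNReal.ofReal_ne_top, fun n => rfl, fun n => h.BG (hpos n), fun n => h.GBc (hpos n),
    fun n => h.J_bd (hpos n), h.Jlim hd, tendsto_inv_atTop_zero.comp
      (Filter.tendsto_atTop_add_const_right _ _ tendsto_natCast_atTop_atTop), hD, fun n => (hcn n).1, fun n => (hcn n).2⟩⟩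
end DS

namespace DS
set_option linter.unusedSectionVars false
set_option linter.unusedSimpArgs false
open scoped ENNReal

variable {H : Type*} [NormedAddCommGroup H] [InnerProductSpace ℂ H] [CompleteSpace H]

lemma memW_iff {X : Type*} [NormedAddCommGroup X] {p : ℝ} (hp : 1 < p) (f : ℝ → X) :
    MemWLp p 1 (Ioi 0) f ↔ MemLp f (ENNReal.ofReal p) hl := by
  have hp0 : 0 < p := by linarith
  have e : (fun t : ℝ => (t ^ ((1:ℝ) - 1) * ‖f t‖) ^ p) = fun t => ‖f t‖ ^ (ENNReal.ofReal p).toReal := by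
    funext t; rw [sub_self, Real.rpow_zero, one_mul, ENNReal.toReal_ofReal hp0.le]
  have h0 : ENNReal.ofReal p ≠ 0 := (ENNReal.ofReal_pos.2 hp0).ne'
  unfold MemWLp
  rw [e]
  constructor
  · rintro ⟨h1, h2⟩
    exact (integrable_norm_rpow_iff h1 h0 ENNReal.ofReal_ne_top).1 h2
  · intro h
    exact ⟨h.1, (integrable_norm_rpow_iff h.1 h0 ENNReal.ofReal_ne_top).2 h⟩

lemma locI {f : ℝ → H} (hf : ∀ t, IntegrableOn f (Ioc 0 t)) : LocallyIntegrable f hl := by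
  intro x
  refine ⟨Iio (x + 1), Iio_mem_nhds (by linarith), ?_⟩
  rw [IntegrableOn, Measure.restrict_restrict measurableSet_Iio]
  refine (hf (x + 1)).mono_set ?_
  rintro y ⟨h1, h2⟩
  exact ⟨h2, le_of_lt h1⟩

lemma supp_bd {φ : ℝ → ℝ} (h2 : HasCompactSupport φ) (h3 : tsupport φ ⊆ Ioi 0) :
    ∃ a > 0, ∃ N, a ≤ N ∧ ∀ t, t ∉ Icc a N → t ∉ tsupport φ := by
  by_cases hne : (tsupport φ).Nonempty
  · obtain ⟨a, ha, ha'⟩ := h2.isCompact.exists_isLeast hne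
    obtain ⟨N, hN, hN'⟩ := h2.isCompact.exists_isGreatest hne
    exact ⟨a, h3 ha, N, ha' hN, fun t ht h => ht ⟨ha' h, hN' h⟩⟩
  · refine ⟨1, one_pos, 1, le_rfl, fun t _ h => hne ⟨t, h⟩⟩

lemma cut {F : ℝ → H} {N : ℝ} (hN : 0 ≤ N) (h : ∀ t, N < t → F t = 0) :
    ∫ t in Ioi 0, F t = ∫ t in 0..N, F t := by
  rw [intervalIntegral.integral_of_le hN]
  refine setIntegral_eq_of_subset_of_forall_sdiff_eq_zero measurableSet_Ioi Ioc_subset_Ioi_self ?_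
  rintro x ⟨h1, h2⟩
  refine h x ?_
  by_contra h3
  exact h2 ⟨h1, not_lt.1 h3⟩

lemma weak {g : ℝ → H} (hg : ∀ t, IntegrableOn g (Ioc 0 t)) {φ : ℝ → ℝ}
    (h1 : ContDiff ℝ (⊤ : ℕ∞) φ) (h2 : HasCompactSupport φ) (h3 : tsupport φ ⊆ Ioi 0) :
    (∫ t in Ioi 0, deriv φ t • ∫ s in 0..t, g s) = -∫ t in Ioi 0, φ t • g t := by
  obtain ⟨a, ha, N, haN, hs⟩ := supp_bd h2 h3
  have hN : 0 < N + 1 := by linarith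
  have z1 : ∀ t, N < t → φ t = 0 := fun t ht => image_eq_zero_of_notMem_tsupport (hs t fun h => absurd h.2 (not_le.2 ht))
  have z2 : ∀ t, N < t → deriv φ t = 0 := fun t ht => by
    by_contra h
    exact hs t (fun h => absurd h.2 (not_le.2 ht)) (support_deriv_subset h)
  rw [cut hN.le (fun t ht => by rw [z2 t (by linarith), zero_smul]),
    cut hN.le (fun t ht => by rw [z1 t (by linarith), zero_smul])]
  have := ibp (H := H) (Φ := fun s => ((φ s : ℝ) : ℂ) • (1 : H →L[ℂ] H))
    (Φ' := fun s => ((deriv φ s : ℝ) : ℂ) • (1 : H →L[ℂ] H)) (fun s => by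
      have hd : HasDerivAt φ (deriv φ s) s := ((h1.differentiable (by simp)) s).hasDerivAt
      exact hd.ofReal_comp.smul_const _) (by
      have : Continuous (deriv φ) := h1.continuous_deriv (by simp)
      fun_prop) hN.le (hg (N + 1))
  simp only [z1 (N+1) (by linarith), Complex.ofReal_zero, zero_smul, zero_sub, ContinuousLinearMap.neg_apply,
    ContinuousLinearMap.smul_apply, ContinuousLinearMap.one_apply, Complex.coe_smul, intervalIntegral.integral_neg] at this
  exact this

lemma prim {k : ℝ → ℝ} (h1 : ContDiff ℝ (⊤ : ℕ∞) k) (h2 : HasCompactSupport k) (h3 : tsupport k ⊆ Ioi 0)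
    (h0 : ∫ t, k t = 0) :
    ∃ φ : ℝ → ℝ, ContDiff ℝ (⊤ : ℕ∞) φ ∧ HasCompactSupport φ ∧ tsupport φ ⊆ Ioi 0 ∧ deriv φ = k := by
  obtain ⟨a, ha, N, haN, hs⟩ := supp_bd h2 h3
  have z : ∀ t, t ∉ Icc a N → k t = 0 := fun t ht => image_eq_zero_of_notMem_tsupport (hs t ht)
  have hc := h1.continuous
  have hd : ∀ t, HasDerivAt (fun t => ∫ s in 0..t, k s) (k t) t := fun t =>
    intervalIntegral.integral_hasDerivAt_right (hc.intervalIntegrable _ _) hc.aestronglyMeasurable.stronglyMeasurableAtFilter hc.continuousAt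
  have e : deriv (fun t => ∫ s in 0..t, k s) = k := funext fun t => (hd t).deriv
  have hsup : Function.support (fun t => ∫ s in 0..t, k s) ⊆ Icc a N := by
    intro t ht
    by_contra hn
    apply ht
    by_cases hta : t < a
    · refine (intervalIntegral.integral_congr (g := fun _ => (0:ℝ)) ?_).trans (by simp)
      intro s hs'
      refine z s fun h => ?_
      have := hs'.2
      have h5 : max 0 t < a := max_lt ha hta
      linarith [h.1]
    · have hNt : N < t := by
        by_contra h; exact hn ⟨not_lt.1 hta, not_lt.1 h⟩
      show ∫ s in 0..t, k s = 0
      rw [intervalIntegral.integral_of_le (by linarith), ← h0]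
      refine setIntegral_eq_integral_of_forall_compl_eq_zero fun x hx => z x fun h => hx ⟨?_, ?_⟩
      · linarith [h.1]
      · linarith [h.2]
  have hts : tsupport (fun t => ∫ s in 0..t, k s) ⊆ Icc a N := closure_minimal hsup isClosed_Icc
  refine ⟨_, contDiff_infty_iff_deriv.2 ⟨fun t => (hd t).differentiableAt, by rw [e]; exact h1⟩,
    HasCompactSupport.of_support_subset_isCompact isCompact_Icc hsup, hts.trans fun x hx => lt_of_lt_of_le ha hx.1, e⟩

lemma const_ae {v : ℝ → H} (hv : ∀ t, IntegrableOn v (Ioc 0 t))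
    (h : ∀ φ : ℝ → ℝ, ContDiff ℝ (⊤ : ℕ∞) φ → HasCompactSupport φ → tsupport φ ⊆ Ioi 0 →
      ∫ t in Ioi 0, deriv φ t • v t = 0) : ∃ c : H, ∀ᵐ t ∂hl, v t = c := by
  obtain ⟨η, e1, e2, e3, e4, e5⟩ := exists_contDiff_tsupport_subset (n := ⊤) (Ioi_mem_nhds (zero_lt_one' ℝ))
  have hpos : 0 < ∫ t, η t := by
    refine e3.continuous.integral_pos_of_hasCompactSupport_nonneg_nonzero e2 (fun t => (e4 ⟨t, rfl⟩).1) (x := 1) ?_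
    rw [e5]; exact one_ne_zero
  set I := ∫ t, η t with hI
  have hvl := locI hv
  have iη := hvl.integrable_smul_left_of_hasCompactSupport e3.continuous e2
  refine ⟨I⁻¹ • ∫ t in Ioi 0, η t • v t, ?_⟩
  set c := I⁻¹ • ∫ t in Ioi 0, η t • v t with hc
  have hcl : LocallyIntegrable (fun _ : ℝ => c) hl := locI fun t => integrableOn_const (by simp)
  have key := IsOpen.ae_eq_zero_of_integral_contDiff_smul_eq_zero (E := ℝ) (F := H) (μ := hl) (U := Ioi 0) isOpen_Ioi
    (f := fun t => v t - c) ((hvl.sub hcl).locallyIntegrableOn _) ?_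
  · filter_upwards [key, ae_restrict_mem measurableSet_Ioi] with t ht h0
    exact sub_eq_zero.1 (ht h0)
  intro ψ p1 p2 p3
  have iψ := hvl.integrable_smul_left_of_hasCompactSupport p1.continuous p2
  have iψc := hcl.integrable_smul_left_of_hasCompactSupport p1.continuous p2
  set J := ∫ t, ψ t with hJ
  have hk2 : HasCompactSupport (fun t => (J * I⁻¹) * η t) := e2.mul_left
  obtain ⟨φ, q1, q2, q3, q4⟩ := prim (k := fun t => ψ t - (J * I⁻¹) * η t) (p1.sub (contDiff_const.mul e3))
    (p2.sub hk2) (by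
      refine (tsupport_sub ψ _).trans (union_subset p3 ?_)
      exact (tsupport_mul_subset_right).trans e1) (by
      rw [integral_sub (p1.continuous.integrable_of_hasCompactSupport p2)
        ((e3.continuous.integrable_of_hasCompactSupport e2).const_mul _), integral_const_mul, ← hJ, ← hI]
      field_simp; ring)
  have hh := h φ q1 q2 q3
  rw [q4] at hh
  have hψJ : ∫ t in Ioi 0, ψ t = J := by
    refine setIntegral_eq_integral_of_forall_compl_eq_zero fun x hx => image_eq_zero_of_notMem_tsupport fun h => hx (p3 h)
  simp only [sub_smul, mul_smul] at hh
  have i2 : Integrable (fun t => J • I⁻¹ • η t • v t) hl := (iη.smul I⁻¹).smul J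
  rw [integral_sub iψ i2, integral_smul, integral_smul, ← hc] at hh
  simp only [smul_sub]
  rw [integral_sub iψ iψc, integral_smul_const, hψJ]
  exact hh

lemma dubois {u g : ℝ → H} (hu : ∀ t, IntegrableOn u (Ioc 0 t)) (hg : ∀ t, IntegrableOn g (Ioc 0 t))
    (hw : IsWeakDeriv (Ioi 0) u g) (ht : HasTrace (Ioi 0) u 0) :
    ∀ᵐ t ∂hl, u t = ∫ s in 0..t, g s := by
  have hcont := prim_cont hg
  have hgi := cont_int hcont
  obtain ⟨c, hc⟩ := const_ae (v := fun t => u t - ∫ s in 0..t, g s) (fun t => (hu t).sub (hgi t)) (by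
    intro φ h1 h2 h3
    have hd := h1.continuous_deriv (by simp)
    simp only [smul_sub]
    rw [integral_sub ((locI hu).integrable_smul_left_of_hasCompactSupport hd h2.deriv)
      ((locI hgi).integrable_smul_left_of_hasCompactSupport hd h2.deriv), weak hg h1 h2 h3, hw.2.2 φ h1 h2 h3, sub_self])
  obtain ⟨w, w1, w2, w3⟩ := ht
  rw [Ioi_insert] at w1
  have hc0 : c = 0 := by
    have ev : ∀ᵐ t ∂hl, w t - (∫ s in 0..t, g s) = c := by
      filter_upwards [hc, w2] with t a b
      rw [b, a]
    have hcw : ContinuousOn (fun t => w t - (∫ s in 0..t, g s)) (Ici 0) := w1.sub hcont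
    have t1 : Filter.Tendsto (fun t => w t - (∫ s in 0..t, g s)) (nhdsWithin 0 (Ioi 0)) (nhds 0) := by
      have := (hcw 0 self_mem_Ici).mono_left (nhdsWithin_mono 0 Ioi_subset_Ici_self)
      simpa [w3] using this
    by_contra hne
    have t2 : ∀ᶠ t in nhdsWithin (0:ℝ) (Ioi 0), w t - (∫ s in 0..t, g s) ≠ c :=
      t1.eventually_ne (Ne.symm hne)
    obtain ⟨b, hb, hb'⟩ := mem_nhdsGT_iff_exists_Ioo_subset.1 t2
    have h3 : ∀ᵐ t ∂(volume.restrict (Ioo 0 b)), w t - (∫ s in 0..t, g s) = c :=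
      ae_mono (Measure.restrict_mono (fun x hx => hx.1) le_rfl) ev
    have h4 : ∀ᵐ t ∂(volume.restrict (Ioo (0:ℝ) b)), False := by
      filter_upwards [h3, ae_restrict_mem measurableSet_Ioo] with t a1 a2
      exact hb' a2 a1
    have : (volume.restrict (Ioo (0:ℝ) b)) = 0 := ae_eq_bot.1 (Filter.eventually_false_iff_eq_bot.1 h4)
    rw [Measure.restrict_eq_zero, Real.volume_Ioo, ENNReal.ofReal_eq_zero] at this
    have hb0 : (0:ℝ) < b := hb
    linarith
  filter_upwards [hc] with t h
  rw [hc0] at h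
  exact sub_eq_zero.1 h

end DS

namespace DS
set_option linter.unusedSectionVars false
set_option linter.unusedSimpArgs false
open scoped ENNReal

variable {H : Type*} [NormedAddCommGroup H] [InnerProductSpace ℂ H] [CompleteSpace H]
variable {Y : Type*} [NormedAddCommGroup Y] [NormedSpace ℂ Y] [CompleteSpace Y]

lemma exT (ι A : Y →L[ℂ] H) (l : ℂ) (h : Function.Bijective (fun x : Y => l • ι x + A x)) :
    ∃ T : H →L[ℂ] Y, (∀ y, l • ι (T y) + A (T y) = y) ∧ ∀ x, T (l • ι x + A x) = x := by
  let B : Y →L[ℂ] H := l • ι + A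
  have hB : Function.Bijective B := h
  let E := ContinuousLinearEquiv.ofBijective B (LinearMap.ker_eq_bot.2 hB.1) (LinearMap.range_eq_top.2 hB.2)
  refine ⟨E.symm, fun y => ?_, fun x => ?_⟩
  · exact E.apply_symm_apply y
  · exact E.symm_apply_apply x

lemma exPs (ι A : Y →L[ℂ] H) (hdense : DenseRange ι)
    (hres : ∃ M > (0 : ℝ), ∀ lam : ℂ, 0 ≤ lam.re →
      Function.Bijective (fun x : Y => lam • ι x + A x) ∧
      ∀ x : Y, (1 + ‖lam‖) * ‖ι x‖ ≤ M * ‖lam • ι x + A x‖) :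
    ∃ (T : H →L[ℂ] Y) (S : ℂ → H →L[ℂ] H) (M : ℝ), PsR S M ∧ DenseRange (S 0) ∧ (∀ y, S 0 y = ι (T y)) ∧
      (∀ y, A (T y) = y) ∧ ∀ x, T (A x) = x := by
  obtain ⟨M, hM, hr⟩ := hres
  have : ∀ l : ℂ, ∃ T : H →L[ℂ] Y, 0 ≤ l.re → (∀ y, l • ι (T y) + A (T y) = y) ∧ ∀ x, T (l • ι x + A x) = x := by
    intro l
    by_cases h : 0 ≤ l.re
    · obtain ⟨T, hT⟩ := exT ι A l (hr l h).1
      exact ⟨T, fun _ => hT⟩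
    · exact ⟨0, fun h' => absurd h' h⟩
  choose T hT using this
  have h0 := hT 0 (by simp)
  simp only [zero_smul, zero_add] at h0
  refine ⟨T 0, fun l => ι ∘L T l, M, ⟨?_, ?_⟩, ?_, fun y => rfl, h0.1, h0.2⟩
  · intro l hl
    have hp : 0 < 1 + ‖l‖ := by positivity
    rw [← le_div_iff₀ hp]
    refine ContinuousLinearMap.opNorm_le_bound _ (by positivity) fun y => ?_
    have := (hr l hl).2 (T l y)
    rw [(hT l hl).1 y] at this
    rw [div_mul_eq_mul_div, le_div_iff₀ hp, mul_comm]
    exact this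
  · intro l m hl hm
    ext y
    show ι (T l y) - ι (T m y) = (m - l) • ι (T l (ι (T m y)))
    have e1 : T l y = T l (l • ι (T m y) + A (T m y)) + T l ((m - l) • ι (T m y)) := by
      rw [← map_add]
      congr 1
      conv_lhs => rw [← (hT m hm).1 y]
      rw [sub_smul]; abel
    rw [(hT l hl).2] at e1
    rw [e1, map_smul, map_add, map_smul]; abel
  · have e : range (ι ∘L T 0) = range ι := by
      ext z; constructor
      · rintro ⟨y, rfl⟩; exact ⟨T 0 y, rfl⟩
      · rintro ⟨x, rfl⟩; exact ⟨A x, by simp [h0.2]⟩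
    show Dense (range (ι ∘L T 0))
    rw [e]; exact hdense

lemma locOn {X : Type*} [NormedAddCommGroup X] {P : ℝ≥0∞} (hP : 1 ≤ P) {f : ℝ → X} (hf : MemLp f P hl) :
    LocallyIntegrableOn f (Ioi 0) :=
  locallyIntegrableOn_of_locallyIntegrable_restrict (hf.locallyIntegrable hP)

theorem main (ι A : Y →L[ℂ] H) (hinj : Function.Injective ι) (hdense : DenseRange ι)
    (hres : ∃ M > (0 : ℝ), ∀ lam : ℂ, 0 ≤ lam.re →
      Function.Bijective (fun x : Y => lam • ι x + A x) ∧
      ∀ x : Y, (1 + ‖lam‖) * ‖ι x‖ ≤ M * ‖lam • ι x + A x‖) (p : ℝ) (hp : 1 < p) : MRw p 1 ι A := by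
  obtain ⟨T, S, M, hPs, hSd, hST, hAT, hTA⟩ := exPs ι A hdense hres
  obtain ⟨D, hY⟩ := hPs.yos hSd hp
  have hP := hY.hP
  intro f hf
  rw [memW_iff hp] at hf
  constructor
  · obtain ⟨w, -, hw, hw2⟩ := hY.exists_sol hf
    have hr : MemLp (fun t => f t - w t) (ENNReal.ofReal p) hl := hf.sub hw
    have hTw : MemLp (fun t => T (w t)) (ENNReal.ofReal p) hl := T.comp_memLp' hw
    have hιw : MemLp (fun t => ι (T (w t))) (ENNReal.ofReal p) hl := ι.comp_memLp' hTw
    have hrl := memLp_loc hP hr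
    have hae : ∀ᵐ t ∂hl, (∫ s in 0..t, (f s - w s)) = ι (T (w t)) := by
      filter_upwards [hw2] with t ht
      rw [← ht, hST]
    refine ⟨fun t => T (w t), fun t => f t - w t, ⟨(memW_iff hp _).2 hTw, (memW_iff hp _).2 hιw, (memW_iff hp _).2 hr,
      locOn hP hιw, locOn hP hr, ?_⟩, ?_, ?_⟩
    · intro φ h1 h2 h3
      rw [← weak hrl h1 h2 h3]
      refine integral_congr_ae ?_
      filter_upwards [hae] with t ht
      rw [ht]
    · refine Filter.Eventually.of_forall fun t => ?_
      simp [hAT]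
    · refine ⟨fun t => ∫ s in 0..t, (f s - w s), ?_, hae, by simp⟩
      rw [Ioi_insert]
      exact prim_cont hrl
  · rintro u₁ r₁ u₂ r₂ ⟨⟨a1, a2, a3, a4⟩, a5, a6⟩ ⟨⟨b1, b2, b3, b4⟩, b5, b6⟩
    rw [memW_iff hp] at a1 a2 a3 b1 b2 b3
    have d1 := dubois (memLp_loc hP a2) (memLp_loc hP a3) a4 a6
    have d2 := dubois (memLp_loc hP b2) (memLp_loc hP b3) b4 b6
    have hw : MemLp (fun t => ι (u₁ t) - ι (u₂ t)) (ENNReal.ofReal p) hl := a2.sub b2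
    have hr : MemLp (fun t => r₁ t - r₂ t) (ENNReal.ofReal p) hl := a3.sub b3
    have h2 : ∀ᵐ t ∂hl, ι (u₁ t) - ι (u₂ t) = ∫ s in 0..t, (r₁ s - r₂ s) := by
      filter_upwards [d1, d2, ae_restrict_mem measurableSet_Ioi] with t c1 c2 ht
      rw [c1, c2, intervalIntegral.integral_sub (ii hP a3 ht) (ii hP b3 ht)]
    have h3 : ∀ᵐ t ∂hl, S 0 (r₁ t - r₂ t) = -(ι (u₁ t) - ι (u₂ t)) := by
      filter_upwards [a5, b5] with t c1 c2
      have : r₁ t - r₂ t = A (u₂ t) - A (u₁ t) := by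
        rw [sub_eq_sub_iff_add_eq_add, c1, ← c2]; abel
      rw [this, hST, map_sub, map_sub, hTA, hTA]; abel
    have h1 : ∀ᵐ t ∂hl, S 0 (ι (u₁ t) - ι (u₂ t)) = -∫ s in 0..t, (ι (u₁ s) - ι (u₂ s)) := by
      filter_upwards [h2, ae_restrict_mem measurableSet_Ioi] with t c1 ht
      have ht0 : (0:ℝ) < t := ht
      rw [c1, ← ContinuousLinearMap.intervalIntegral_comp_comm _ (ii hP hr ht), ← intervalIntegral.integral_neg]
      refine intervalIntegral.integral_congr_ae ?_
      rw [uIoc_of_le ht0.le]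
      have := (ae_restrict_iff' measurableSet_Ioi).1 h3
      filter_upwards [this] with s hs hs'
      exact hs hs'.1
    have := hY.uniq hw hr h1 h2
    filter_upwards [this] with t ht
    exact hinj (sub_eq_zero.1 ht)

end DS

/-- **de Simon's theorem, Hilbert space case.** Suppose `X₀ = H` is a complex
Hilbert space and `−A` generates an exponentially stable analytic semigroup in `H`, in the
resolvent formulation: there is `M > 0` such that for every `λ ∈ ℂ` with `Re λ ≥ 0` the
operator `λ + A : X₁ → H` is bijective with `‖(λ+A)⁻¹‖_{B(H)} ≤ M/(1+|λ|)`. Then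
`A ∈ MR_p(H)` for every `p ∈ (1,∞)`. -/
theorem statement6 {H Y : Type*} [NormedAddCommGroup H] [InnerProductSpace ℂ H]
    [CompleteSpace H] [NormedAddCommGroup Y] [NormedSpace ℂ Y] [CompleteSpace Y]
    (ι A : Y →L[ℂ] H) (hinj : Function.Injective ι) (hdense : DenseRange ι)
    (hgraph : GraphNormEquiv ι A)
    (hres : ∃ M > (0 : ℝ), ∀ lam : ℂ, 0 ≤ lam.re →
      Function.Bijective (fun x : Y => lam • ι x + A x) ∧
      ∀ x : Y, (1 + ‖lam‖) * ‖ι x‖ ≤ M * ‖lam • ι x + A x‖) :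
    ∀ p : ℝ, 1 < p → MRw p 1 ι A := by
  intro p hp
  exact DS.main ι A hinj hdense hres p hp
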